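/- There exists a constant C > 0, depending only on d and v, such that for every integer N ≥ 2 and every P ∈ (2πℤ)^d one has E_P(N) − E₀(N) ≥ |P| · inf_{p∈(2πℤ)^d, p≠0} √(2v̂(p) + |p|²) − C·(1 + |P|)^{3/2}·N^{−1/2}. -/

import Mathlib

open MeasureTheory Real

noncomputable section

/-- The unit box `[0,1]^d` in `ℝ^d`. -/
def boxd (d : ℕ) : Set (Fin d → ℝ) := Set.univ.pi fun _ => Set.Icc (0 : ℝ) 1

/-- The unit box `[0,1]^{dN}` in `(ℝ^d)^N`. -/
def boxN (d N : ℕ) : Set (Fin N → Fin d → ℝ) :=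
  Set.univ.pi fun _ => Set.univ.pi fun _ => Set.Icc (0 : ℝ) 1

/-- `|p|²` for the lattice point `p = 2πk ∈ (2πℤ)^d`. -/
def pSq (d : ℕ) (k : Fin d → ℤ) : ℝ := ∑ j, (2 * π * (k j : ℝ)) ^ 2

/-- `v` is 1-periodic in each coordinate. -/
def PeriodicPot (d : ℕ) (v : (Fin d → ℝ) → ℝ) : Prop :=
  ∀ (x : Fin d → ℝ) (k : Fin d → ℤ), v (fun j => x j + (k j : ℝ)) = v x

/-- `vhat` gives the Fourier coefficients of `v`:
`v̂(p) = ∫_{[0,1]^d} v(x) e^{-ip·x} dx` for `p = 2πk`. -/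
def HasFourierCoeffs (d : ℕ) (v : (Fin d → ℝ) → ℝ) (vhat : (Fin d → ℤ) → ℝ) : Prop :=
  ∀ k : Fin d → ℤ, (vhat k : ℂ) =
    ∫ x in boxd d, (v x : ℂ) * Complex.exp (-Complex.I * ∑ j, (2 * π * (k j : ℝ)) * x j)

/-- `v` equals its Fourier series pointwise. -/
def HasFourierExpansion (d : ℕ) (v : (Fin d → ℝ) → ℝ) (vhat : (Fin d → ℤ) → ℝ) : Prop :=
  ∀ x : Fin d → ℝ, (v x : ℂ) =
    ∑' k : Fin d → ℤ, (vhat k : ℂ) * Complex.exp (Complex.I * ∑ j, (2 * π * (k j : ℝ)) * x j)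

/-- The standing assumptions on the interaction potential `v` with Fourier
coefficients `vhat`: continuous, periodic, even, with nonnegative summable
Fourier coefficients, equal to its Fourier series. -/
structure PotentialAssumptions (d : ℕ) (v : (Fin d → ℝ) → ℝ)
    (vhat : (Fin d → ℤ) → ℝ) : Prop where
  continuous : Continuous v
  periodic : PeriodicPot d v
  even : ∀ x, v (-x) = v x
  coeffs : HasFourierCoeffs d v vhat
  nonneg : ∀ k, 0 ≤ vhat k
  summable : Summable vhat
  expansion : HasFourierExpansion d v vhat

/-- An `N`-particle wave function is 1-periodic in each coordinate. -/
def PeriodicWF (d N : ℕ) (Ψ : (Fin N → Fin d → ℝ) → ℂ) : Prop :=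
  ∀ (x : Fin N → Fin d → ℝ) (k : Fin N → Fin d → ℤ),
    Ψ (fun i j => x i j + (k i j : ℝ)) = Ψ x

/-- An `N`-particle wave function is symmetric under permutation of the particles. -/
def SymmetricWF (d N : ℕ) (Ψ : (Fin N → Fin d → ℝ) → ℂ) : Prop :=
  ∀ (σ : Equiv.Perm (Fin N)) (x : Fin N → Fin d → ℝ), Ψ (fun i => x (σ i)) = Ψ x

/-- `∫_{[0,1]^{dN}} |Ψ|² = 1`. -/
def Normalized (d N : ℕ) (Ψ : (Fin N → Fin d → ℝ) → ℂ) : Prop :=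
  ∫ x in boxN d N, ‖Ψ x‖ ^ 2 = 1

/-- The unit vector in the direction of the `j`-th coordinate of the `i`-th particle. -/
def dir (d N : ℕ) (i : Fin N) (j : Fin d) : Fin N → Fin d → ℝ :=
  Pi.single i (Pi.single j 1)

/-- The kinetic energy `∑_{i=1}^N ∫_{[0,1]^{dN}} |∇_{x_i}Ψ|² dx`. -/
def kineticEnergy (d N : ℕ) (Ψ : (Fin N → Fin d → ℝ) → ℂ) : ℝ :=
  ∑ i : Fin N, ∫ x in boxN d N, ∑ j : Fin d, ‖fderiv ℝ Ψ x (dir d N i j)‖ ^ 2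

/-- The potential energy `(N-1)⁻¹ ∑_{i<j} ∫_{[0,1]^{dN}} v(x_i - x_j)|Ψ|² dx`. -/
def potentialEnergy (d N : ℕ) (v : (Fin d → ℝ) → ℝ) (Ψ : (Fin N → Fin d → ℝ) → ℂ) : ℝ :=
  ((N : ℝ) - 1)⁻¹ * ∑ i : Fin N, ∑ j : Fin N,
    if i < j then ∫ x in boxN d N, v (x i - x j) * ‖Ψ x‖ ^ 2 else 0

/-- The energy form `E_N(Ψ)`. -/
def energyForm (d N : ℕ) (v : (Fin d → ℝ) → ℝ) (Ψ : (Fin N → Fin d → ℝ) → ℂ) : ℝ :=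
  kineticEnergy d N Ψ + potentialEnergy d N v Ψ

/-- The ground state energy `E₀(N)`: the infimum of the energy form over smooth,
periodic, permutation-symmetric, normalized wave functions. -/
def E0 (d N : ℕ) (v : (Fin d → ℝ) → ℝ) : ℝ :=
  sInf {E : ℝ | ∃ Ψ : (Fin N → Fin d → ℝ) → ℂ, ContDiff ℝ (⊤ : ℕ∞) Ψ ∧ PeriodicWF d N Ψ ∧
    SymmetricWF d N Ψ ∧ Normalized d N Ψ ∧ E = energyForm d N v Ψ}

/-- The elementary excitation energy `e_p = √(|p|⁴ + 2|p|²v̂(p))` for `p = 2πk`. -/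
def excitation (d : ℕ) (vhat : (Fin d → ℤ) → ℝ) (k : Fin d → ℤ) : ℝ :=
  Real.sqrt ((pSq d k) ^ 2 + 2 * pSq d k * vhat k)

/-- The Bogoliubov energy `E^Bog = -(1/2)∑_{p≠0}(|p|² + v̂(p) - e_p)`. -/
def Ebog (d : ℕ) (vhat : (Fin d → ℤ) → ℝ) : ℝ :=
  -(1 / 2) * ∑' k : {k : Fin d → ℤ // k ≠ 0},
    (pSq d k.1 + vhat k.1 - excitation d vhat k.1)

/-- The total-momentum condition `Ψ(x₁+t,…,x_N+t) = e^{iP·t}Ψ(x)` for `P = 2πk`. -/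
def MomentumWF (d N : ℕ) (P : Fin d → ℤ) (Ψ : (Fin N → Fin d → ℝ) → ℂ) : Prop :=
  ∀ (t : Fin d → ℝ) (x : Fin N → Fin d → ℝ),
    Ψ (fun i => x i + t) = Complex.exp (Complex.I * ∑ j, (2 * π * (P j : ℝ)) * t j) * Ψ x

/-- The ground state energy in the sector of total momentum `P = 2πk`. -/
def EP (d N : ℕ) (v : (Fin d → ℝ) → ℝ) (P : Fin d → ℤ) : ℝ :=
  sInf {E : ℝ | ∃ Ψ : (Fin N → Fin d → ℝ) → ℂ, ContDiff ℝ (⊤ : ℕ∞) Ψ ∧ PeriodicWF d N Ψ ∧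
    SymmetricWF d N Ψ ∧ MomentumWF d N P Ψ ∧ Normalized d N Ψ ∧ E = energyForm d N v Ψ}

open scoped ComplexConjugate

section FinsuppInner

variable {ι : Type*}

/-- The `ℓ²` inner product on finitely supported functions. -/
@[reducible] def finsuppInnerCore (ι : Type*) : InnerProductSpace.Core ℂ (ι →₀ ℂ) where
  inner f g := f.sum fun k z => conj z * g k
  conj_inner_symm f g := by
    classical
    rw [Finsupp.sum_of_support_subset f (Finset.subset_union_left (s₂ := g.support)) _ (by simp),
      Finsupp.sum_of_support_subset g (Finset.subset_union_right (s₁ := f.support)) _ (by simp),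
      map_sum]
    refine Finset.sum_congr rfl fun k _ => ?_
    simp [mul_comm]
  re_inner_nonneg f := by
    rw [Finsupp.sum, map_sum]
    refine Finset.sum_nonneg fun k _ => ?_
    rw [← Complex.normSq_eq_conj_mul_self]
    simpa using Complex.normSq_nonneg (f k)
  add_left f g h := by
    rw [Finsupp.sum_add_index'] <;> intros <;> simp [add_mul]
  smul_left f g r := by
    rw [Finsupp.sum_smul_index' (by simp), Finsupp.mul_sum]
    simp [mul_assoc]
  definite f h := by
    have h2 : ∑ k ∈ f.support, ‖f k‖ ^ 2 = 0 := by
      have : (f.sum fun k z => conj z * f k) = ((∑ k ∈ f.support, ‖f k‖ ^ 2 : ℝ) : ℂ) := by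
        rw [Finsupp.sum]; push_cast
        exact Finset.sum_congr rfl fun k _ => Complex.conj_mul' _
      rw [this] at h
      exact_mod_cast h
    rw [Finset.sum_eq_zero_iff_of_nonneg (fun _ _ => by positivity)] at h2
    ext k
    by_cases hk : k ∈ f.support
    · simpa using h2 k hk
    · simpa using hk

instance : NormedAddCommGroup (ι →₀ ℂ) := (finsuppInnerCore ι).toNormedAddCommGroup

instance : InnerProductSpace ℂ (ι →₀ ℂ) := InnerProductSpace.ofCore (finsuppInnerCore ι).toCore

lemma finsupp_inner_def (f g : ι →₀ ℂ) : inner ℂ f g = f.sum fun k z => conj z * g k := rfl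

lemma inner_self_eq_ofReal {F : Type*} [NormedAddCommGroup F] [InnerProductSpace ℂ F] (f : F) :
    inner ℂ f f = ((‖f‖ ^ 2 : ℝ) : ℂ) := by
  rw [inner_self_eq_norm_sq_to_K]
  push_cast
  rfl

lemma finsupp_norm_sq (f : ι →₀ ℂ) : ‖f‖ ^ 2 = f.sum fun _ z => ‖z‖ ^ 2 := by
  have h := inner_self_eq_norm_sq (𝕜 := ℂ) f
  rw [← h, finsupp_inner_def, Finsupp.sum, map_sum, Finsupp.sum]
  refine Finset.sum_congr rfl fun k _ => ?_
  rw [Complex.conj_mul']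
  norm_cast

/-- The quadratic form of the multiplication operator by `m`. -/
def ev (m : ι → ℝ) (f : ι →₀ ℂ) : ℝ := f.sum fun k z => m k * ‖z‖ ^ 2

/-- The multiplication operator by `m`. -/
def diagOp (m : ι → ℝ) : (ι →₀ ℂ) →ₗ[ℂ] (ι →₀ ℂ) :=
  Finsupp.linearCombination ℂ fun k => Finsupp.single k (m k : ℂ)

lemma diagOp_single (m : ι → ℝ) (k : ι) :
    diagOp m (Finsupp.single k 1) = Finsupp.single k (m k : ℂ) := by
  simp [diagOp]

lemma diagOp_apply (m : ι → ℝ) (f : ι →₀ ℂ) (k : ι) : diagOp m f k = m k * f k := by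
  classical
  induction f using Finsupp.induction_linear with
  | zero => simp
  | add f g hf hg => simp [hf, hg, mul_add]
  | single l z =>
    simp only [diagOp, Finsupp.linearCombination_single, Finsupp.smul_apply, Finsupp.single_apply]
    split_ifs with h
    · simp [h, mul_comm]
    · simp

lemma inner_diagOp (m : ι → ℝ) (f : ι →₀ ℂ) : inner ℂ f (diagOp m f) = (ev m f : ℂ) := by
  rw [finsupp_inner_def, ev, Finsupp.sum, Finsupp.sum]
  push_cast
  refine Finset.sum_congr rfl fun k _ => ?_
  rw [diagOp_apply, ← Complex.conj_mul']
  ring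

lemma ev_mono {m m' : ι → ℝ} (f : ι →₀ ℂ) (h : ∀ k ∈ f.support, m k ≤ m' k) :
    ev m f ≤ ev m' f :=
  Finset.sum_le_sum fun k hk => mul_le_mul_of_nonneg_right (h k hk) (by positivity)

lemma ev_nonneg {m : ι → ℝ} (f : ι →₀ ℂ) (h : ∀ k, 0 ≤ m k) : 0 ≤ ev m f :=
  Finset.sum_nonneg fun k _ => mul_nonneg (h k) (by positivity)

lemma ev_one (f : ι →₀ ℂ) : ev (fun _ => 1) f = ‖f‖ ^ 2 := by
  simp [ev, finsupp_norm_sq]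

lemma ev_add (m m' : ι → ℝ) (f : ι →₀ ℂ) :
    ev (fun k => m k + m' k) f = ev m f + ev m' f := by
  simp [ev, Finsupp.sum, add_mul, Finset.sum_add_distrib]

lemma ev_sub (m m' : ι → ℝ) (f : ι →₀ ℂ) :
    ev (fun k => m k - m' k) f = ev m f - ev m' f := by
  simp [ev, Finsupp.sum, sub_mul, Finset.sum_sub_distrib]

lemma ev_const_mul (c : ℝ) (m : ι → ℝ) (f : ι →₀ ℂ) :
    ev (fun k => c * m k) f = c * ev m f := by
  simp [ev, Finsupp.sum, Finset.mul_sum, mul_assoc]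

lemma ev_sum {α : Type*} (s : Finset α) (m : α → ι → ℝ) (f : ι →₀ ℂ) :
    ev (fun k => ∑ a ∈ s, m a k) f = ∑ a ∈ s, ev (m a) f := by
  simp only [ev, Finsupp.sum, Finset.sum_mul]
  exact Finset.sum_comm

lemma ev_diagOp (m m' : ι → ℝ) (f : ι →₀ ℂ) :
    ev m (diagOp m' f) = ev (fun k => m k * m' k ^ 2) f := by
  classical
  have h : (diagOp m' f).support ⊆ f.support := by
    intro k hk
    rw [Finsupp.mem_support_iff, diagOp_apply] at hk
    exact Finsupp.mem_support_iff.mpr (right_ne_zero_of_mul hk)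
  rw [ev, Finsupp.sum_of_support_subset _ h _ (by simp), ev, Finsupp.sum]
  refine Finset.sum_congr rfl fun k _ => ?_
  rw [diagOp_apply, norm_mul, mul_pow]
  simp [mul_assoc]

lemma norm_diagOp_sq (m : ι → ℝ) (f : ι →₀ ℂ) : ‖diagOp m f‖ ^ 2 = ev (fun k => m k ^ 2) f := by
  rw [← ev_one, ev_diagOp]; simp

/-- Adjointness of linear maps on finitely supported functions may be checked on basis vectors. -/
lemma adjoint_of_single {A B : (ι →₀ ℂ) →ₗ[ℂ] (ι →₀ ℂ)}
    (h : ∀ k l, A (Finsupp.single k 1) l = conj (B (Finsupp.single l 1) k)) (f g : ι →₀ ℂ) :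
    inner ℂ (A f) g = inner ℂ f (B g) := by
  induction f using Finsupp.induction_linear with
  | zero => simp
  | add f₁ f₂ h₁ h₂ => rw [map_add, inner_add_left, inner_add_left, h₁, h₂]
  | single k z =>
    induction g using Finsupp.induction_linear with
    | zero => simp
    | add g₁ g₂ h₁ h₂ => rw [map_add, inner_add_right, inner_add_right, h₁, h₂]
    | single l w =>
      have hz : Finsupp.single k z = z • (Finsupp.single k (1 : ℂ)) := by simp
      have hw : Finsupp.single l w = w • (Finsupp.single l (1 : ℂ)) := by simp
      rw [hz, hw, map_smul, map_smul, inner_smul_left, inner_smul_left, inner_smul_right,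
        inner_smul_right, ← inner_conj_symm, finsupp_inner_def, finsupp_inner_def,
        Finsupp.sum_single_index (by simp), Finsupp.sum_single_index (by simp), h]
      simp

lemma diagOp_adjoint (m : ι → ℝ) (f g : ι →₀ ℂ) :
    inner ℂ (diagOp m f) g = inner ℂ f (diagOp m g) := by
  classical
  refine adjoint_of_single (fun k l => ?_) f g
  simp only [diagOp_apply, Finsupp.single_apply, eq_comm (a := l)]
  split_ifs with h <;> simp [h]

end FinsuppInner

section ManyBody

variable {Λ : Type*} [AddCommGroup Λ] [DecidableEq Λ] {N : ℕ}

/-- The operator `|p⟩⟨q|` acting on the `i`-th particle. -/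
def unitOp (i : Fin N) (p q : Λ) : ((Fin N → Λ) →₀ ℂ) →ₗ[ℂ] ((Fin N → Λ) →₀ ℂ) :=
  Finsupp.linearCombination ℂ fun k =>
    if k i = q then Finsupp.single (Function.update k i p) 1 else 0

/-- Multiplication by a plane wave in the `i`-th variable, in momentum space. -/
def shiftOp (i : Fin N) (p : Λ) : ((Fin N → Λ) →₀ ℂ) →ₗ[ℂ] ((Fin N → Λ) →₀ ℂ) :=
  Finsupp.linearCombination ℂ fun k => Finsupp.single (Function.update k i (k i + p)) 1

/-- The indicator of the `i`-th particle being outside the condensate. -/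
def exc (i : Fin N) (k : Fin N → Λ) : ℝ := if k i = 0 then 0 else 1

/-- The number of particles outside the condensate. -/
def excNum (k : Fin N → Λ) : ℝ := ∑ i, exc i k

/-- The indicator of the `i`-th particle having momentum `p`. -/
def occ (p : Λ) (i : Fin N) (k : Fin N → Λ) : ℝ := if k i = p then 1 else 0

/-- The number of particles with momentum `p`. -/
def occNum (p : Λ) (k : Fin N → Λ) : ℝ := ∑ i, occ p i k

/-- Moving one particle from the mode `p` to the condensate. -/
def toCond (p : Λ) : ((Fin N → Λ) →₀ ℂ) →ₗ[ℂ] ((Fin N → Λ) →₀ ℂ) := ∑ i, unitOp i 0 p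

/-- Moving one particle from the condensate to the mode `p`. -/
def fromCond (p : Λ) : ((Fin N → Λ) →₀ ℂ) →ₗ[ℂ] ((Fin N → Λ) →₀ ℂ) := ∑ i, unitOp i p 0

/-- The density mode `∑ᵢ exp (i p xᵢ)` as a multiplication operator, in momentum space. -/
def density (p : Λ) : ((Fin N → Λ) →₀ ℂ) →ₗ[ℂ] ((Fin N → Λ) →₀ ℂ) := ∑ i, shiftOp i p

/-- The part of the density mode acting only outside the condensate. -/
def densityExc (p : Λ) : ((Fin N → Λ) →₀ ℂ) →ₗ[ℂ] ((Fin N → Λ) →₀ ℂ) :=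
  ∑ i, diagOp (exc i) ∘ₗ shiftOp i p ∘ₗ diagOp (exc i)

lemma unitOp_single (i : Fin N) (p q : Λ) (k : Fin N → Λ) :
    unitOp i p q (Finsupp.single k 1) =
      if k i = q then Finsupp.single (Function.update k i p) 1 else 0 := by
  simp [unitOp]

lemma shiftOp_single (i : Fin N) (p : Λ) (k : Fin N → Λ) :
    shiftOp i p (Finsupp.single k 1) = Finsupp.single (Function.update k i (k i + p)) 1 := by
  simp [shiftOp]

lemma diagOp_single_smul {ι : Type*} (m : ι → ℝ) (k : ι) :
    diagOp m (Finsupp.single k 1) = (m k : ℂ) • Finsupp.single k 1 := by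
  simp [diagOp_single]

lemma end_ext_single {ι : Type*} {A B : (ι →₀ ℂ) →ₗ[ℂ] (ι →₀ ℂ)}
    (h : ∀ k, A (Finsupp.single k 1) = B (Finsupp.single k 1)) : A = B :=
  Finsupp.lhom_ext' fun k => LinearMap.ext_ring (h k)

lemma unitOp_adjoint (i : Fin N) (p q : Λ) (f g : (Fin N → Λ) →₀ ℂ) :
    inner ℂ (unitOp i p q f) g = inner ℂ f (unitOp i q p g) := by
  refine adjoint_of_single (fun k l => ?_) f g
  rw [unitOp_single, unitOp_single]
  have h : (k i = q ∧ Function.update k i p = l) ↔ (l i = p ∧ Function.update l i q = k) := by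
    constructor
    · rintro ⟨rfl, rfl⟩; simp
    · rintro ⟨rfl, rfl⟩; simp
  by_cases h1 : k i = q ∧ Function.update k i p = l
  · have h2 := h.mp h1
    rw [if_pos h1.1, if_pos h2.1, h1.2, h2.2]; simp
  · have h2 := fun hh => h1 (h.mpr hh)
    have e1 : ((if k i = q then Finsupp.single (Function.update k i p) (1 : ℂ) else 0) :
        (Fin N → Λ) →₀ ℂ) l = 0 := by
      split_ifs with h3
      · exact Finsupp.single_eq_of_ne (fun h4 => h1 ⟨h3, h4.symm⟩)
      · rfl
    have e2 : ((if l i = p then Finsupp.single (Function.update l i q) (1 : ℂ) else 0) :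
        (Fin N → Λ) →₀ ℂ) k = 0 := by
      split_ifs with h3
      · exact Finsupp.single_eq_of_ne (fun h4 => h2 ⟨h3, h4.symm⟩)
      · rfl
    rw [e1, e2, map_zero]

lemma unitOp_comp_same (i : Fin N) (p q r : Λ) :
    unitOp i p q ∘ₗ unitOp i q r = unitOp i p r := by
  refine end_ext_single fun k => ?_
  rw [LinearMap.comp_apply, unitOp_single, unitOp_single]
  split_ifs with h
  · simp [unitOp_single]
  · simp

lemma unitOp_comp_comm {i j : Fin N} (hij : i ≠ j) (p q r s : Λ) :
    unitOp i p q ∘ₗ unitOp j r s = unitOp j r s ∘ₗ unitOp i p q := by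
  refine end_ext_single fun k => ?_
  rw [LinearMap.comp_apply, LinearMap.comp_apply, unitOp_single, unitOp_single]
  by_cases h1 : k i = q <;> by_cases h2 : k j = s <;>
    simp [h1, h2, unitOp_single, hij, hij.symm, Function.update_comm hij]

lemma unitOp_comp_ne (i : Fin N) (p r : Λ) {q q' : Λ} (h : q ≠ q') :
    unitOp i p q ∘ₗ unitOp i q' r = 0 := by
  refine end_ext_single fun k => ?_
  rw [LinearMap.comp_apply, unitOp_single]
  split_ifs
  · simp [unitOp_single, h.symm]
  · simp

lemma unitOp_self (i : Fin N) (p : Λ) : unitOp i p p = diagOp (occ p i) := by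
  refine end_ext_single fun k => ?_
  rw [unitOp_single, diagOp_single_smul]
  split_ifs with h
  · rw [← h, Function.update_eq_self]; simp [occ]
  · simp [occ, h]

lemma diagOp_sum {ι α : Type*} (s : Finset α) (m : α → ι → ℝ) :
    ∑ a ∈ s, diagOp (m a) = diagOp fun k => ∑ a ∈ s, m a k := by
  refine end_ext_single fun k => ?_
  simp only [LinearMap.sum_apply, diagOp_single_smul, ← Finset.sum_smul]
  push_cast
  rfl

lemma norm_unitOp_sq (i : Fin N) (p q : Λ) (f : (Fin N → Λ) →₀ ℂ) :
    ‖unitOp i p q f‖ ^ 2 = ev (occ q i) f := by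
  have h : inner ℂ (unitOp i p q f) (unitOp i p q f) = (ev (occ q i) f : ℂ) := by
    rw [unitOp_adjoint, ← LinearMap.comp_apply, unitOp_comp_same, unitOp_self, inner_diagOp]
  rw [inner_self_eq_ofReal] at h
  exact_mod_cast h

lemma toCond_adjoint (p : Λ) (f g : (Fin N → Λ) →₀ ℂ) :
    inner ℂ (toCond p f) g = inner ℂ f (fromCond p g) := by
  simp [toCond, fromCond, LinearMap.sum_apply, unitOp_adjoint]

lemma fromCond_adjoint (p : Λ) (f g : (Fin N → Λ) →₀ ℂ) :
    inner ℂ (fromCond p f) g = inner ℂ f (toCond p g) := by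
  simp [toCond, fromCond, LinearMap.sum_apply, unitOp_adjoint]

lemma toCond_comp_fromCond {p : Λ} (f : (Fin N → Λ) →₀ ℂ) :
    toCond p (fromCond p f) =
      fromCond p (toCond p f) + diagOp (fun k => occNum 0 k - occNum p k) f := by
  have h : ∀ i j : Fin N, unitOp i 0 p ∘ₗ unitOp j p 0 =
      unitOp j p 0 ∘ₗ unitOp i 0 p +
        if i = j then diagOp (fun k => occ 0 i k - occ p i k) else 0 := by
    intro i j
    split_ifs with hij
    · subst hij
      rw [unitOp_comp_same, unitOp_comp_same, unitOp_self, unitOp_self]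
      refine end_ext_single fun k => ?_
      simp [diagOp_single_smul]
    · rw [unitOp_comp_comm hij, add_zero]
  have h' := fun i j => LinearMap.congr_fun (h i j) f
  simp only [LinearMap.comp_apply, LinearMap.add_apply] at h'
  simp only [toCond, fromCond, LinearMap.sum_apply, map_sum, h', Finset.sum_add_distrib]
  congr 1
  · rw [Finset.sum_comm]
  · have : ∀ i j : Fin N,
        (if i = j then diagOp (fun k : Fin N → Λ => occ 0 i k - occ p i k) else 0) f
        = if i = j then diagOp (fun k => occ 0 i k - occ p i k) f else 0 := by
      intro i j; split_ifs <;> simp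
    simp only [this]
    simp only [occNum, ← Finset.sum_sub_distrib]
    rw [← diagOp_sum]
    simp

lemma norm_fromCond_sq (p : Λ) (f : (Fin N → Λ) →₀ ℂ) :
    ‖fromCond p f‖ ^ 2 = ‖toCond p f‖ ^ 2 + (ev (occNum 0) f - ev (occNum p) f) := by
  have h : inner ℂ (fromCond p f) (fromCond p f) =
      inner ℂ (toCond p f) (toCond p f) + ((ev (occNum 0) f - ev (occNum p) f : ℝ) : ℂ) := by
    rw [fromCond_adjoint, toCond_comp_fromCond, inner_add_right, inner_diagOp, toCond_adjoint,
      ev_sub]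
  rw [inner_self_eq_ofReal, inner_self_eq_ofReal] at h
  exact_mod_cast h

lemma fromCond_comm (p q : Λ) (f : (Fin N → Λ) →₀ ℂ) (hp : p ≠ 0) (hq : q ≠ 0) :
    fromCond p (fromCond q f) = fromCond q (fromCond p f) := by
  have h : ∀ i j : Fin N, unitOp i p 0 ∘ₗ unitOp j q 0 = unitOp j q 0 ∘ₗ unitOp i p (0 : Λ) := by
    intro i j
    by_cases hij : i = j
    · subst hij
      rw [unitOp_comp_ne _ _ _ hq.symm, unitOp_comp_ne _ _ _ hp.symm]
    · exact unitOp_comp_comm hij _ _ _ _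
  have h' := fun i j => LinearMap.congr_fun (h i j) f
  simp only [LinearMap.comp_apply] at h'
  simp only [fromCond, LinearMap.sum_apply, map_sum, h']
  rw [Finset.sum_comm]

lemma inner_toCond_fromCond_comm (p q : Λ) (f : (Fin N → Λ) →₀ ℂ) (hp : p ≠ 0) (hq : q ≠ 0) :
    inner ℂ (toCond p f) (fromCond q f) = inner ℂ (toCond q f) (fromCond p f) := by
  rw [toCond_adjoint, toCond_adjoint, fromCond_comm p q f hp hq]

lemma norm_sum_sq_le {α F : Type*} [Fintype α] [NormedAddCommGroup F] (v : α → F) :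
    ‖∑ i, v i‖ ^ 2 ≤ Fintype.card α * ∑ i, ‖v i‖ ^ 2 := by
  calc ‖∑ i, v i‖ ^ 2 ≤ (∑ i, ‖v i‖) ^ 2 := by gcongr; exact norm_sum_le _ _
    _ ≤ _ := by simpa using sq_sum_le_card_mul_sum_sq (s := Finset.univ) (f := fun i => ‖v i‖)

lemma norm_toCond_sq_le (p : Λ) (f : (Fin N → Λ) →₀ ℂ) :
    ‖toCond p f‖ ^ 2 ≤ N * ev (occNum p) f := by
  rw [toCond, LinearMap.sum_apply]
  refine (norm_sum_sq_le _).trans_eq ?_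
  simp only [norm_unitOp_sq, Fintype.card_fin]
  congr 1
  exact (ev_sum _ _ _).symm

end ManyBody

section ManyBody

variable {Λ : Type*} [AddCommGroup Λ] [DecidableEq Λ] {N : ℕ}

lemma unitOp_apply (i : Fin N) (p q : Λ) (f : (Fin N → Λ) →₀ ℂ) (k : Fin N → Λ) :
    unitOp i p q f k = if k i = p then f (Function.update k i q) else 0 := by
  induction f using Finsupp.induction_linear with
  | zero => simp
  | add f g hf hg => rw [map_add, Finsupp.add_apply, hf, hg]; split_ifs <;> simp
  | single l z =>
    have hz : Finsupp.single l z = z • (Finsupp.single l (1 : ℂ)) := by simp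
    rw [hz, map_smul, unitOp_single, Finsupp.smul_apply]
    by_cases h1 : k i = p
    · rw [if_pos h1, Finsupp.smul_apply]
      congr 1
      split_ifs with h2
      · rw [Finsupp.single_apply, Finsupp.single_apply]
        refine if_congr ⟨?_, ?_⟩ rfl rfl
        · intro h; subst h; simp [← h2]
        · intro h; subst h; simp [← h1]
      · rw [Finsupp.single_eq_of_ne]
        · rfl
        · intro h; subst h; simp at h2
    · rw [if_neg h1]
      split_ifs with h2
      · rw [Finsupp.single_eq_of_ne, smul_zero]
        intro h; subst h; simp at h1
      · simp

lemma shiftOp_apply (i : Fin N) (p : Λ) (f : (Fin N → Λ) →₀ ℂ) (k : Fin N → Λ) :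
    shiftOp i p f k = f (Function.update k i (k i - p)) := by
  induction f using Finsupp.induction_linear with
  | zero => simp
  | add f g hf hg => rw [map_add, Finsupp.add_apply, hf, hg]; simp
  | single l z =>
    have hz : Finsupp.single l z = z • (Finsupp.single l (1 : ℂ)) := by simp
    rw [hz, map_smul, shiftOp_single, Finsupp.smul_apply, Finsupp.smul_apply]
    congr 1
    rw [Finsupp.single_apply, Finsupp.single_apply]
    refine if_congr ⟨?_, ?_⟩ rfl rfl
    · intro h; subst h; simp
    · intro h; subst h; simp

lemma shiftOp_adjoint (i : Fin N) (p : Λ) (f g : (Fin N → Λ) →₀ ℂ) :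
    inner ℂ (shiftOp i p f) g = inner ℂ f (shiftOp i (-p) g) := by
  refine adjoint_of_single (fun k l => ?_) f g
  rw [shiftOp_single, shiftOp_single, Finsupp.single_apply, Finsupp.single_apply]
  have : (Function.update k i (k i + p) = l) ↔ (Function.update l i (l i + -p) = k) := by
    constructor
    · intro h; subst h; simp
    · intro h; subst h; simp
  simp only [this]
  split_ifs <;> simp

lemma norm_shiftOp (i : Fin N) (p : Λ) (f : (Fin N → Λ) →₀ ℂ) : ‖shiftOp i p f‖ = ‖f‖ := by
  have h1 : shiftOp i (-p) (shiftOp i p f) = f := by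
    ext k; simp [shiftOp_apply]
  have h : inner ℂ (shiftOp i p f) (shiftOp i p f) = (inner ℂ f f : ℂ) := by
    rw [shiftOp_adjoint, h1]
  rw [inner_self_eq_ofReal, inner_self_eq_ofReal] at h
  have h3 : ‖shiftOp i p f‖ ^ 2 = ‖f‖ ^ 2 := by exact_mod_cast h
  exact (sq_eq_sq₀ (norm_nonneg _) (norm_nonneg _)).mp h3

lemma diagOp_occ_add_exc (i : Fin N) (f : (Fin N → Λ) →₀ ℂ) :
    diagOp (occ 0 i) f + diagOp (exc i) f = f := by
  ext k
  simp only [Finsupp.add_apply, diagOp_apply, occ, exc]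
  split_ifs <;> simp

lemma diagOp_exc_unitOp {i j : Fin N} (hij : i ≠ j) (p q : Λ) (f : (Fin N → Λ) →₀ ℂ) :
    diagOp (exc j) (unitOp i p q f) = unitOp i p q (diagOp (exc j) f) := by
  ext k
  simp only [diagOp_apply, unitOp_apply, exc]
  rw [Function.update_of_ne hij.symm]
  split_ifs <;> simp

lemma card_mul_sum_norm_sq_sub {α F : Type*} [Fintype α] [NormedAddCommGroup F]
    [InnerProductSpace ℂ F] (v : α → F) :
    Fintype.card α * ∑ i, ‖v i‖ ^ 2 - ‖∑ i, v i‖ ^ 2 =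
      (1 / 2) * ∑ i, ∑ j, ‖v i - v j‖ ^ 2 := by
  have h1 : ‖∑ i, v i‖ ^ 2 = ∑ i, ∑ j, RCLike.re (inner ℂ (v i) (v j)) := by
    rw [← inner_self_eq_norm_sq (𝕜 := ℂ), sum_inner, map_sum]
    refine Finset.sum_congr rfl fun i _ => ?_
    rw [inner_sum, map_sum]
  have h2 : ∀ i j, ‖v i - v j‖ ^ 2 =
      ‖v i‖ ^ 2 - 2 * RCLike.re (inner ℂ (v i) (v j)) + ‖v j‖ ^ 2 :=
    fun i j => norm_sub_sq (𝕜 := ℂ) _ _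
  simp only [h1, h2, Finset.sum_add_distrib, Finset.sum_sub_distrib, Finset.sum_const,
    Finset.card_univ, nsmul_eq_mul, ← Finset.mul_sum]
  ring

/-- Bosonic symmetry of a finitely supported function. -/
def SymmState (f : (Fin N → Λ) →₀ ℂ) : Prop :=
  ∀ (σ : Equiv.Perm (Fin N)) (k : Fin N → Λ), f (fun i => k (σ i)) = f k

lemma unitOp_sub_unitOp {p : Λ} {f : (Fin N → Λ) →₀ ℂ} (hf : SymmState f) {i j : Fin N}
    (hij : i ≠ j) : unitOp i 0 p f - unitOp j 0 p f =
      diagOp (exc j) (unitOp i 0 p f) - diagOp (exc i) (unitOp j 0 p f) := by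
  have h : diagOp (occ 0 j) (unitOp i 0 p f) = diagOp (occ 0 i) (unitOp j 0 p f) := by
    ext k
    simp only [diagOp_apply, unitOp_apply, occ]
    by_cases h1 : k i = 0 <;> by_cases h2 : k j = 0 <;> simp only [h1, h2, if_true, if_false,
      Complex.ofReal_one, Complex.ofReal_zero, one_mul, zero_mul]
    rw [← hf (Equiv.swap i j)]
    congr 1
    funext l
    rcases eq_or_ne l i with rfl | hli
    · simp [Function.update_of_ne hij, Function.update_of_ne hij.symm, h1, h2]
    · rcases eq_or_ne l j with rfl | hlj
      · simp
      · rw [Equiv.swap_apply_of_ne_of_ne hli hlj, Function.update_of_ne hli,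
          Function.update_of_ne hlj]
  have e1 := diagOp_occ_add_exc j (unitOp i 0 p f)
  have e2 := diagOp_occ_add_exc i (unitOp j 0 p f)
  rw [h] at e1
  nth_rewrite 1 [← e1]
  nth_rewrite 2 [← e2]
  abel

lemma exc_sq (i : Fin N) (k : Fin N → Λ) : exc i k ^ 2 = exc i k := by
  unfold exc; split_ifs <;> simp

lemma exc_nonneg (i : Fin N) (k : Fin N → Λ) : 0 ≤ exc i k := by
  unfold exc; split_ifs <;> simp

lemma occ_nonneg (p : Λ) (i : Fin N) (k : Fin N → Λ) : 0 ≤ occ p i k := by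
  unfold occ; split_ifs <;> simp

lemma norm_toCond_sq_ge {p : Λ} {f : (Fin N → Λ) →₀ ℂ} (hf : SymmState f) :
    N * ev (occNum p) f - 2 * ev (fun k => occNum p k * excNum k) f ≤ ‖toCond p f‖ ^ 2 := by
  have h1 := card_mul_sum_norm_sq_sub (fun i => unitOp i 0 p f)
  simp only [norm_unitOp_sq, Fintype.card_fin] at h1
  have h2 : ev (occNum p) f = ∑ i, ev (occ p i) f := ev_sum _ _ _
  have h3 : toCond p f = ∑ i, unitOp i 0 p f := by rw [toCond, LinearMap.sum_apply]
  rw [← h2, ← h3] at h1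
  have h4 : ∀ i j, ‖unitOp i 0 p f - unitOp j 0 p f‖ ^ 2 ≤
      2 * ev (fun k => occ p i k * exc j k) f + 2 * ev (fun k => occ p j k * exc i k) f := by
    intro i j
    have e : ∀ i j : Fin N, 0 ≤ ev (fun k => occ p i k * exc j k) f := fun i j =>
      ev_nonneg _ fun k => mul_nonneg (occ_nonneg _ _ _) (exc_nonneg _ _)
    rcases eq_or_ne i j with rfl | hij
    · simp only [sub_self, norm_zero]
      have := e i i
      nlinarith
    · rw [unitOp_sub_unitOp hf hij, diagOp_exc_unitOp hij, diagOp_exc_unitOp hij.symm]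
      have e3 : ∀ i j : Fin N, ‖unitOp i 0 p (diagOp (exc j) f)‖ ^ 2 =
          ev (fun k => occ p i k * exc j k) f := fun i j => by
        rw [norm_unitOp_sq, ev_diagOp]; simp only [exc_sq]
      rw [← e3, ← e3]
      have := norm_sub_le (unitOp i 0 p (diagOp (exc j) f)) (unitOp j 0 p (diagOp (exc i) f))
      calc _ ≤ (‖unitOp i 0 p (diagOp (exc j) f)‖ + ‖unitOp j 0 p (diagOp (exc i) f)‖) ^ 2 := by
            gcongr
        _ ≤ _ := by
          nlinarith [sq_nonneg (‖unitOp i 0 p (diagOp (exc j) f)‖ -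
            ‖unitOp j 0 p (diagOp (exc i) f)‖)]
  have h5 : ev (fun k => occNum p k * excNum k) f =
      ∑ i, ∑ j, ev (fun k => occ p i k * exc j k) f := by
    simp only [← ev_sum, occNum, excNum, Finset.sum_mul_sum]
  have h6 : ∑ i, ∑ j, ‖unitOp i 0 p f - unitOp j 0 p f‖ ^ 2 ≤
      4 * ev (fun k => occNum p k * excNum k) f := by
    refine (Finset.sum_le_sum fun i _ => Finset.sum_le_sum fun j _ => h4 i j).trans_eq ?_
    simp only [Finset.sum_add_distrib, ← Finset.mul_sum]
    rw [Finset.sum_comm (f := fun i j => ev (fun k => occ p j k * exc i k) f), ← h5]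
    ring
  linarith

lemma density_eq {p : Λ} (hp : p ≠ 0) (f : (Fin N → Λ) →₀ ℂ) :
    density p f = fromCond p f + toCond (-p) f + densityExc p f := by
  simp only [density, fromCond, toCond, densityExc, LinearMap.sum_apply, ← Finset.sum_add_distrib]
  refine Finset.sum_congr rfl fun i _ => ?_
  ext k
  simp only [LinearMap.comp_apply, Finsupp.add_apply, diagOp_apply, shiftOp_apply, unitOp_apply,
    exc, Function.update_self]
  by_cases h1 : k i = p
  · simp [h1, hp]
  · by_cases h2 : k i = 0
    · simp [h2, hp, hp.symm]
    · simp [h1, h2, sub_eq_zero]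

lemma diagOp_exc_shiftOp {i j : Fin N} (hij : i ≠ j) (p : Λ) (f : (Fin N → Λ) →₀ ℂ) :
    diagOp (exc j) (shiftOp i p f) = shiftOp i p (diagOp (exc j) f) := by
  ext k
  simp only [diagOp_apply, shiftOp_apply, exc]
  rw [Function.update_of_ne hij.symm]

lemma norm_diagOp_exc_le (i : Fin N) (f : (Fin N → Λ) →₀ ℂ) : ‖diagOp (exc i) f‖ ≤ ‖f‖ := by
  rw [← sq_le_sq₀ (norm_nonneg _) (norm_nonneg _), norm_diagOp_sq, ← ev_one]
  refine ev_mono _ fun k _ => ?_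
  unfold exc; split_ifs <;> simp

lemma diagOp_exc_idem (i : Fin N) (f : (Fin N → Λ) →₀ ℂ) :
    diagOp (exc i) (diagOp (exc i) f) = diagOp (exc i) f := by
  ext k; simp only [diagOp_apply, exc]; split_ifs <;> simp

lemma diagOp_exc_comm (i j : Fin N) (f : (Fin N → Λ) →₀ ℂ) :
    diagOp (exc i) (diagOp (exc j) f) = diagOp (exc j) (diagOp (exc i) f) := by
  ext k; simp only [diagOp_apply]; ring

lemma norm_densityExc_sq_le (p : Λ) (f : (Fin N → Λ) →₀ ℂ) :
    ‖densityExc p f‖ ^ 2 ≤ ev (fun k => excNum k ^ 2) f := by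
  set R : Fin N → ((Fin N → Λ) →₀ ℂ) → ((Fin N → Λ) →₀ ℂ) := fun i g =>
    diagOp (exc i) (shiftOp i p (diagOp (exc i) g)) with hR
  have hRn : ∀ i g, ‖R i g‖ ≤ ‖g‖ := fun i g =>
    (norm_diagOp_exc_le _ _).trans ((norm_shiftOp _ _ _).trans_le (norm_diagOp_exc_le _ _))
  have h0 : densityExc p f = ∑ i, R i f := by
    simp only [densityExc, LinearMap.sum_apply, LinearMap.comp_apply, hR]
  have h1 : ‖densityExc p f‖ ^ 2 = ∑ i, ∑ j, RCLike.re (inner ℂ (R i f) (R j f)) := by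
    rw [h0, ← inner_self_eq_norm_sq (𝕜 := ℂ), sum_inner, map_sum]
    refine Finset.sum_congr rfl fun i _ => ?_
    rw [inner_sum, map_sum]
  have h2 : ∀ i j, inner ℂ (R i f) (R j f) =
      (inner ℂ (R i (diagOp (exc i) (diagOp (exc j) f)))
        (R j (diagOp (exc j) (diagOp (exc i) f))) : ℂ) := by
    intro i j
    rcases eq_or_ne i j with rfl | hij
    · simp only [hR, diagOp_exc_idem]
    · have hRi : ∀ i g, diagOp (exc i) (R i g) = R i g := fun i g => diagOp_exc_idem _ _
      have hRc : ∀ i g, R i (diagOp (exc i) g) = R i g := fun i g => by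
        simp only [hR, diagOp_exc_idem]
      have hcomm : ∀ i j : Fin N, i ≠ j → ∀ g, R i (diagOp (exc j) g) = diagOp (exc j) (R i g) := by
        intro i j hij g
        simp only [hR]
        rw [diagOp_exc_comm i j, ← diagOp_exc_shiftOp hij, diagOp_exc_comm i j]
      clear_value R
      rw [hRc, hRc, hcomm i j hij, hcomm j i hij.symm, ← diagOp_adjoint, diagOp_exc_comm, hRi,
        diagOp_adjoint, hRi]
  have h3 : ev (fun k => excNum k ^ 2) f = ∑ i, ∑ j, ‖diagOp (exc i) (diagOp (exc j) f)‖ ^ 2 := by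
    simp only [norm_diagOp_sq, ev_diagOp, exc_sq, ← ev_sum, excNum]
    congr 1
    funext k
    rw [sq, Finset.sum_mul_sum]
  rw [h1, h3]
  refine Finset.sum_le_sum fun i _ => Finset.sum_le_sum fun j _ => ?_
  rw [h2]
  refine (re_inner_le_norm _ _).trans ?_
  refine (mul_le_mul (hRn _ _) (hRn _ _) (norm_nonneg _) (norm_nonneg _)).trans_eq ?_
  rw [diagOp_exc_comm j i, sq]

lemma density_diagOp_excNum (p : Λ) (hp : p ≠ 0) (f : (Fin N → Λ) →₀ ℂ) :
    density p (diagOp excNum f) =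
      diagOp excNum (density p f) + (toCond (-p) f - fromCond p f) := by
  ext k
  simp only [density, toCond, fromCond, LinearMap.sum_apply, Finsupp.add_apply, Finsupp.sub_apply,
    Finsupp.finsetSum_apply, diagOp_apply, shiftOp_apply, unitOp_apply]
  rw [Finset.mul_sum, ← Finset.sum_sub_distrib, ← Finset.sum_add_distrib]
  refine Finset.sum_congr rfl fun i _ => ?_
  have h : excNum (Function.update k i (k i - p)) =
      excNum k + (if k i - p = 0 then 0 else 1) - (if k i = 0 then 0 else 1) := by
    unfold excNum
    rw [← Finset.add_sum_erase _ _ (Finset.mem_univ i),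
      ← Finset.add_sum_erase Finset.univ (fun j => exc j k) (Finset.mem_univ i)]
    have : ∑ j ∈ Finset.univ.erase i, exc j (Function.update k i (k i - p)) =
        ∑ j ∈ Finset.univ.erase i, exc j k := by
      refine Finset.sum_congr rfl fun j hj => ?_
      unfold exc
      rw [Function.update_of_ne (Finset.ne_of_mem_erase hj)]
    rw [this]
    simp only [exc, Function.update_self]
    ring
  rw [h]
  by_cases h1 : k i = p
  · simp [h1, hp]; ring
  · by_cases h2 : k i = 0
    · simp [h2, hp, hp.symm]; ring
    · simp [h1, h2, sub_eq_zero]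

end ManyBody

section Bogoliubov

variable {Λ : Type*} [AddCommGroup Λ] [DecidableEq Λ] {N : ℕ}

/-- The hypotheses on kinetic symbol `a`, interaction `vh`, momentum functional `l` and mode
set `S` under which the momentum-shifted Bogoliubov form is bounded below. -/
structure Modes (a vh l : Λ → ℝ) (S : Finset Λ) (V : ℝ) : Prop where
  zero_notMem : (0 : Λ) ∉ S
  neg_mem : ∀ p ∈ S, -p ∈ S
  a_zero : a 0 = 0
  one_le_a : ∀ p, p ≠ 0 → 1 ≤ a p
  a_neg : ∀ p, a (-p) = a p
  vh_nonneg : ∀ p, 0 ≤ vh p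
  vh_neg : ∀ p, vh (-p) = vh p
  l_neg : ∀ p, l (-p) = -l p
  abs_l_le : ∀ p ∈ S, |l p| ≤ √(a p ^ 2 + 2 * a p * vh p)
  l_le : ∀ p, p ∉ S → l p ≤ a p
  sum_le : ∑ p ∈ S, vh p ≤ V

/-- The Hamiltonian quadratic form in momentum space. -/
def hamForm (a w : Λ → ℝ) (S : Finset Λ) (f : (Fin N → Λ) →₀ ℂ) : ℝ :=
  ev (fun k => ∑ i, a (k i)) f + ∑ p ∈ S, w p * ‖density p f‖ ^ 2

lemma sum_neg_eq {S : Finset Λ} (hS : ∀ p ∈ S, -p ∈ S) (g : Λ → ℝ) :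
    ∑ p ∈ S, g (-p) = ∑ p ∈ S, g p :=
  Finset.sum_nbij' (fun p => -p) (fun p => -p) hS hS (by simp) (by simp) (by simp)

lemma sum_odd_eq_zero {S : Finset Λ} (hS : ∀ p ∈ S, -p ∈ S) (g : Λ → ℝ)
    (hg : ∀ p, g (-p) = -g p) : ∑ p ∈ S, g p = 0 := by
  have h := sum_neg_eq hS g
  simp only [hg, Finset.sum_neg_distrib] at h
  linarith

lemma excNum_nonneg (k : Fin N → Λ) : 0 ≤ excNum k :=
  Finset.sum_nonneg fun i _ => exc_nonneg i k

lemma excNum_le (k : Fin N → Λ) : excNum k ≤ N := by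
  refine (Finset.sum_le_card_nsmul _ _ 1 fun i _ => ?_).trans (by simp)
  unfold exc; split_ifs <;> simp

lemma occNum_nonneg (p : Λ) (k : Fin N → Λ) : 0 ≤ occNum p k :=
  Finset.sum_nonneg fun i _ => occ_nonneg p i k

lemma occNum_zero_eq (k : Fin N → Λ) : occNum 0 k = N - excNum k := by
  have : ∀ i, occ 0 i k = 1 - exc i k := fun i => by unfold occ exc; split_ifs <;> simp
  simp [occNum, excNum, this]

lemma sum_occNum_le {S : Finset Λ} (h0 : (0 : Λ) ∉ S) (k : Fin N → Λ) :
    ∑ p ∈ S, occNum p k ≤ excNum k := by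
  unfold occNum excNum
  rw [Finset.sum_comm]
  refine Finset.sum_le_sum fun i _ => ?_
  simp only [occ, exc, Finset.sum_ite_eq]
  by_cases h : k i = 0
  · simp [h, h0]
  · simp only [h, if_false]; split_ifs <;> simp

lemma occNum_le {p : Λ} (hp : p ≠ 0) (k : Fin N → Λ) : occNum p k ≤ excNum k := by
  simpa using sum_occNum_le (S := {p}) (by simpa using hp.symm) k

lemma ev_occNum_zero {f : (Fin N → Λ) →₀ ℂ} (hn : ‖f‖ = 1) :
    ev (occNum 0) f = N - ev excNum f := by
  have h1 : ev (fun _ : Fin N → Λ => (N : ℝ)) f = N := by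
    have := ev_const_mul (N : ℝ) (fun _ => 1) f
    simpa [ev_one, hn] using this
  have h2 : (occNum 0 : (Fin N → Λ) → ℝ) = fun k => N - excNum k := funext occNum_zero_eq
  rw [h2, ev_sub, h1]

lemma norm_fromCond_sq_le {p : Λ} {f : (Fin N → Λ) →₀ ℂ} (hn : ‖f‖ = 1) (hp : p ≠ 0) :
    ‖fromCond p f‖ ^ 2 ≤ N * (ev excNum f + 1) := by
  have h1 := norm_toCond_sq_le p f
  have h2 : ev (occNum p) f ≤ ev excNum f := ev_mono f fun k _ => occNum_le hp k
  have h3 : 0 ≤ ev (occNum p) f := ev_nonneg f fun k => occNum_nonneg p k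
  have h4 : 0 ≤ ev excNum f := ev_nonneg f excNum_nonneg
  have h5 : (N : ℝ) * ev (occNum p) f ≤ N * ev excNum f := by gcongr
  rw [norm_fromCond_sq, ev_occNum_zero hn]
  linarith

lemma norm_toCond_sq_le' {p : Λ} (f : (Fin N → Λ) →₀ ℂ) (hp : p ≠ 0) :
    ‖toCond p f‖ ^ 2 ≤ N * ev excNum f := by
  have h1 := norm_toCond_sq_le p f
  have h2 : ev (occNum p) f ≤ ev excNum f := ev_mono f fun k _ => occNum_le hp k
  have h5 : (N : ℝ) * ev (occNum p) f ≤ N * ev excNum f := by gcongr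
  linarith

/-- The pairing form of a single mode is nonnegative. -/
lemma pair_form_nonneg {a v x y r : ℝ} (ha : 0 < a) (hv : 0 ≤ v) (hx : 0 ≤ x) (hy : 0 ≤ y)
    (hr : r ^ 2 ≤ x * y) :
    0 ≤ (a + v + √(a ^ 2 + 2 * a * v)) / 2 * x +
      (a + v - √(a ^ 2 + 2 * a * v)) / 2 * y + v * r := by
  set e := √(a ^ 2 + 2 * a * v)
  have he : e ^ 2 = a ^ 2 + 2 * a * v := Real.sq_sqrt (by positivity)
  have he0 : 0 ≤ e := Real.sqrt_nonneg _
  have h1 : e ≤ a + v := by nlinarith [sq_nonneg v]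
  set α := (a + v + e) / 2 with hα
  set β := (a + v - e) / 2 with hβ
  have h2 : 0 ≤ α := by positivity
  have h3 : 0 ≤ β := by rw [hβ]; linarith
  have h4 : α * β = v ^ 2 / 4 := by rw [hα, hβ]; nlinarith
  have h5 : (v * r) ^ 2 ≤ (α * x + β * y) ^ 2 := by
    have : (v * r) ^ 2 ≤ 4 * (α * x) * (β * y) := by
      have : 4 * (α * x) * (β * y) = v ^ 2 * (x * y) := by linear_combination 4 * x * y * h4
      rw [this, mul_pow]; gcongr
    nlinarith [sq_nonneg (α * x - β * y)]
  have h6 := abs_le.mp (abs_le_of_sq_le_sq h5 (by positivity))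
  linarith [h6.1]

lemma mode_identity {a v e l x y θ r : ℝ} (he : e ≠ 0) (hy : y = x + θ) :
    (a - l) * x + v / 2 * (x + y) + v * r =
      ((1 - l / e) * ((a + v + e) / 2) * x + (1 + l / e) * ((a + v - e) / 2) * y + v * r)
      + θ * (v / 2 - (1 + l / e) * ((a + v - e) / 2)) := by
  subst hy; field_simp; ring

lemma hamForm_lower {a vh l : Λ → ℝ} {S : Finset Λ} {V m : ℝ} (h : Modes a vh l S V)
    (hN : 2 ≤ N) {f : (Fin N → Λ) →₀ ℂ} (hf : SymmState f) (hn : ‖f‖ = 1)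
    (hm : ∀ k, f k ≠ 0 → ∑ i, l (k i) = m) :
    m + (1 / 2) * ∑ p ∈ S, (√(a p ^ 2 + 2 * a p * vh p) - a p)
        - V * (ev excNum f / N + 2 * ev (fun k => excNum k ^ 2) f / N
          + √(2 * (2 * ev excNum f + 1) * ev (fun k => excNum k ^ 2) f / N)) ≤
      hamForm a (fun p => vh p / (2 * ((N : ℝ) - 1))) S f := by
  have hNr : (2 : ℝ) ≤ N := by exact_mod_cast hN
  have hN0 : (0 : ℝ) < N := by linarith
  set ν := ev excNum f with hν
  set ν2 := ev (fun k => excNum k ^ 2) f with hν2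
  have hν0 : 0 ≤ ν := ev_nonneg f excNum_nonneg
  have hν20 : 0 ≤ ν2 := ev_nonneg f fun k => sq_nonneg _
  set e : Λ → ℝ := fun p => √(a p ^ 2 + 2 * a p * vh p) with he
  set n : Λ → ℝ := fun p => ev (occNum p) f with hnp
  set x : Λ → ℝ := fun p => ‖toCond p f‖ ^ 2 / N with hx
  set y : Λ → ℝ := fun p => ‖fromCond p f‖ ^ 2 / N with hy
  set r : Λ → ℝ := fun p => RCLike.re (inner ℂ (toCond (-p) f) (fromCond p f)) / N with hr
  set t : ℝ := √(2 * (2 * ν + 1) * ν2 / N) with ht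
  have hS0 : ∀ p ∈ S, p ≠ 0 := fun p hp h0 => h.zero_notMem (h0 ▸ hp)
  have hap : ∀ p ∈ S, 0 < a p := fun p hp => lt_of_lt_of_le one_pos (h.one_le_a p (hS0 p hp))
  have he2 : ∀ p ∈ S, e p ^ 2 = a p ^ 2 + 2 * a p * vh p := fun p hp => Real.sq_sqrt (by
    have := hap p hp; have := h.vh_nonneg p; positivity)
  have hepos : ∀ p ∈ S, 0 < e p := fun p hp => Real.sqrt_pos.mpr (by
    have := hap p hp; have := h.vh_nonneg p; positivity)
  have hea : ∀ p ∈ S, a p ≤ e p := fun p hp => by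
    have := hap p hp; have := h.vh_nonneg p; have := he2 p hp; have := hepos p hp
    exact le_of_sq_le_sq (by nlinarith) this.le
  have heav : ∀ p ∈ S, e p ≤ a p + vh p := fun p hp => by
    have := hap p hp; have := h.vh_nonneg p; have := he2 p hp; have := hepos p hp
    exact le_of_sq_le_sq (by nlinarith) (by linarith)
  have hen : ∀ p, e (-p) = e p := fun p => by simp only [he, h.a_neg, h.vh_neg]
  have hxnn : ∀ p, 0 ≤ x p := fun p => by positivity
  have hynn : ∀ p, 0 ≤ y p := fun p => by positivity
  have hrn : ∀ p ∈ S, r (-p) = r p := fun p hp => by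
    simp only [hr, neg_neg]
    rw [inner_toCond_fromCond_comm p (-p) f (hS0 p hp) (neg_ne_zero.mpr (hS0 p hp))]
  have hrsq : ∀ p, r p ^ 2 ≤ x (-p) * y p := fun p => by
    have h1 := RCLike.abs_re_le_norm (inner ℂ (toCond (-p) f) (fromCond p f))
    have h2 := norm_inner_le_norm (𝕜 := ℂ) (toCond (-p) f) (fromCond p f)
    have h3 : |RCLike.re (inner ℂ (toCond (-p) f) (fromCond p f))| ^ 2 ≤
        (‖toCond (-p) f‖ * ‖fromCond p f‖) ^ 2 := by
      gcongr; exact h1.trans h2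
    rw [sq_abs, mul_pow] at h3
    simp only [hr, hx, hy, div_pow]
    rw [div_mul_div_comm, ← sq]
    gcongr
  -- the kinetic part
  have hkin : m + ∑ p ∈ S, (a p - l p) * n p ≤ ev (fun k => ∑ i, a (k i)) f := by
    have h1 : ev (fun k => ∑ i, l (k i)) f = m := by
      have : ev (fun k => ∑ i, l (k i)) f = ev (fun _ => m * 1) f :=
        Finset.sum_congr rfl fun k hk => by
          simp only [hm k (Finsupp.mem_support_iff.mp hk), mul_one]
      rw [this, ev_const_mul, ev_one, hn]; ring
    have h2 : ev (fun k => ∑ i, a (k i) - ∑ i, l (k i)) f ≥ ∑ p ∈ S, (a p - l p) * n p := by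
      simp only [hnp, ← ev_const_mul, ← ev_sum]
      refine ev_mono f fun k _ => ?_
      rw [← Finset.sum_sub_distrib]
      simp only [occNum, Finset.mul_sum]
      rw [Finset.sum_comm]
      refine Finset.sum_le_sum fun i _ => ?_
      simp only [occ, mul_ite, mul_one, mul_zero, Finset.sum_ite_eq]
      split_ifs with hi
      · exact le_rfl
      · linarith [h.l_le _ hi]
    rw [ev_sub, h1] at h2
    linarith
  have hocc : ∑ p ∈ S, (a p - l p) * x p - 2 * V * ν2 / N ≤ ∑ p ∈ S, (a p - l p) * n p := by
    set z : Λ → ℝ := fun p => ev (fun k => occNum p k * excNum k) f with hz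
    have hz0 : ∀ p, 0 ≤ z p := fun p =>
      ev_nonneg f fun k => mul_nonneg (occNum_nonneg _ _) (excNum_nonneg _)
    have hzν : ∀ p ∈ S, z p ≤ ν2 := fun p hp => ev_mono f fun k _ => by
      rw [sq]; exact mul_le_mul_of_nonneg_right (occNum_le (hS0 p hp) k) (excNum_nonneg k)
    have h1 : ∀ p ∈ S, (a p - l p) * x p - 2 * vh p * ν2 / N ≤ (a p - l p) * n p := by
      intro p hp
      have e1 : x p ≤ n p := by
        rw [hx]; rw [div_le_iff₀ hN0, mul_comm]; exact norm_toCond_sq_le p f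
      have e2 : n p - x p ≤ 2 * ν2 / N := by
        have := norm_toCond_sq_ge (p := p) hf
        rw [le_div_iff₀ hN0]
        have e3 : x p * N = ‖toCond p f‖ ^ 2 := div_mul_cancel₀ _ hN0.ne'
        have := hzν p hp
        nlinarith
      have e4 : -vh p ≤ a p - l p := by
        linarith [le_abs_self (l p), h.abs_l_le p hp, heav p hp]
      have := h.vh_nonneg p
      have e5 : vh p * (n p - x p) ≤ vh p * (2 * ν2 / N) := by gcongr
      have e6 : 2 * vh p * ν2 / N = vh p * (2 * ν2 / N) := by ring
      nlinarith
    have h2 := Finset.sum_le_sum h1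
    rw [Finset.sum_sub_distrib] at h2
    have h3 : ∑ p ∈ S, 2 * vh p * ν2 / N = 2 * (∑ p ∈ S, vh p) * ν2 / N := by
      rw [Finset.mul_sum, Finset.sum_mul, Finset.sum_div]
    have h4 : 2 * (∑ p ∈ S, vh p) * ν2 / N ≤ 2 * V * ν2 / N := by
      gcongr; exact h.sum_le
    linarith
  -- the potential part
  have hpot : ∀ p ∈ S, vh p / 2 * (x (-p) + y p) + vh p * r p - vh p * t ≤
      vh p / (2 * ((N : ℝ) - 1)) * ‖density p f‖ ^ 2 := by
    intro p hp
    have hv0 := h.vh_nonneg p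
    have e1 : vh p / (2 * N) * ‖density p f‖ ^ 2 ≤
        vh p / (2 * ((N : ℝ) - 1)) * ‖density p f‖ ^ 2 := by
      gcongr <;> linarith
    refine le_trans ?_ e1
    rw [density_eq (hS0 p hp)]
    set L := fromCond p f + toCond (-p) f with hL
    have e2 : ‖L‖ ^ 2 = N * (x (-p) + y p + 2 * r p) := by
      rw [hL, norm_add_sq (𝕜 := ℂ), ← inner_conj_symm, RCLike.conj_re]
      simp only [hx, hy, hr]
      field_simp; ring
    have e3 : ‖L‖ ^ 2 - 2 * ‖L‖ * ‖densityExc p f‖ ≤ ‖L + densityExc p f‖ ^ 2 := by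
      have := norm_sub_norm_le L (-densityExc p f)
      rw [norm_neg, sub_neg_eq_add] at this
      have h1 := abs_norm_sub_norm_le L (-densityExc p f)
      rw [norm_neg, sub_neg_eq_add] at h1
      have h2 : (‖L‖ - ‖densityExc p f‖) ^ 2 ≤ ‖L + densityExc p f‖ ^ 2 := by
        rw [← sq_abs]; gcongr
      nlinarith [sq_nonneg ‖densityExc p f‖]
    have e4 : ‖L‖ * ‖densityExc p f‖ ≤ N * t := by
      have h1 : ‖L‖ ^ 2 ≤ 2 * N * (2 * ν + 1) := by
        have b1 := norm_fromCond_sq_le hn (hS0 p hp)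
        have b2 := norm_toCond_sq_le' f (neg_ne_zero.mpr (hS0 p hp))
        have b3 := norm_add_le (fromCond p f) (toCond (-p) f)
        calc ‖L‖ ^ 2 ≤ (‖fromCond p f‖ + ‖toCond (-p) f‖) ^ 2 := by gcongr
          _ ≤ 2 * (‖fromCond p f‖ ^ 2 + ‖toCond (-p) f‖ ^ 2) := add_sq_le
          _ ≤ _ := by linarith
      have h2 := norm_densityExc_sq_le p f
      rw [← sq_le_sq₀ (by positivity) (by positivity), mul_pow, mul_pow, ht,
        Real.sq_sqrt (by positivity)]
      calc ‖L‖ ^ 2 * ‖densityExc p f‖ ^ 2 ≤ (2 * N * (2 * ν + 1)) * ν2 := by gcongr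
        _ = _ := by field_simp
    have e5 : vh p / (2 * N) * (N * (x (-p) + y p + 2 * r p) - 2 * (N * t)) ≤
        vh p / (2 * N) * ‖L + densityExc p f‖ ^ 2 := by
      gcongr; linarith
    refine le_trans (le_of_eq ?_) e5
    field_simp
  have hyx : ∀ p, y p = x p + (N - ν - n p) / N := fun p => by
    simp only [hy, hx, norm_fromCond_sq, ev_occNum_zero hn]; ring
  -- the quadratic form
  have hquad : (1 / 2) * ∑ p ∈ S, (e p - a p) - V * (ν / N) ≤
      ∑ p ∈ S, ((a p - l p) * x p + vh p / 2 * (x p + y p) + vh p * r p) := by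
    have h1 : ∀ p ∈ S, (a p - l p) * x p + vh p / 2 * (x p + y p) + vh p * r p =
      ((1 - l p / e p) * ((a p + vh p + e p) / 2) * x p +
        (1 + l p / e p) * ((a p + vh p - e p) / 2) * y p + vh p * r p)
      + (N - ν - n p) / N * (vh p / 2 - (1 + l p / e p) * ((a p + vh p - e p) / 2)) :=
      fun p hp => mode_identity (hepos p hp).ne' (hyx p)
    rw [Finset.sum_congr rfl h1, Finset.sum_add_distrib]
    have h2 : 0 ≤ ∑ p ∈ S, ((1 - l p / e p) * ((a p + vh p + e p) / 2) * x p +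
        (1 + l p / e p) * ((a p + vh p - e p) / 2) * y p + vh p * r p) := by
      have g1 : ∑ p ∈ S, ((1 - l p / e p) * ((a p + vh p + e p) / 2) * x p +
          (1 + l p / e p) * ((a p + vh p - e p) / 2) * y p + vh p * r p) =
          ∑ p ∈ S, (1 + l p / e p) * ((a p + vh p + e p) / 2 * x (-p) +
            (a p + vh p - e p) / 2 * y p + vh p * r p) := by
        have g2 : ∑ p ∈ S, (1 - l p / e p) * ((a p + vh p + e p) / 2) * x p =
            ∑ p ∈ S, (1 + l p / e p) * ((a p + vh p + e p) / 2) * x (-p) := by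
          rw [← sum_neg_eq h.neg_mem]
          refine Finset.sum_congr rfl fun p _ => ?_
          rw [h.l_neg, hen, h.a_neg, h.vh_neg]; ring
        have g3 : ∑ p ∈ S, l p / e p * (vh p * r p) = 0 := by
          have := sum_neg_eq h.neg_mem fun p => l p / e p * (vh p * r p)
          have g4 : ∑ p ∈ S, l (-p) / e (-p) * (vh (-p) * r (-p)) =
              ∑ p ∈ S, -(l p / e p * (vh p * r p)) :=
            Finset.sum_congr rfl fun p hp => by rw [h.l_neg, hen, h.vh_neg, hrn p hp]; ring
          rw [g4, Finset.sum_neg_distrib] at this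
          linarith
        have g5 : ∑ p ∈ S, (1 + l p / e p) * ((a p + vh p + e p) / 2 * x (-p) +
            (a p + vh p - e p) / 2 * y p + vh p * r p) =
            ∑ p ∈ S, (1 + l p / e p) * ((a p + vh p + e p) / 2) * x (-p) +
            ∑ p ∈ S, (1 + l p / e p) * ((a p + vh p - e p) / 2) * y p + ∑ p ∈ S, vh p * r p +
            ∑ p ∈ S, l p / e p * (vh p * r p) := by
          simp only [← Finset.sum_add_distrib]
          exact Finset.sum_congr rfl fun p _ => by ring
        rw [g5, g3, Finset.sum_add_distrib, Finset.sum_add_distrib, g2, add_zero]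
      rw [g1]
      refine Finset.sum_nonneg fun p hp => mul_nonneg ?_ ?_
      · have := (abs_le.mp (h.abs_l_le p hp)).1
        have : -1 ≤ l p / e p := by rw [le_div_iff₀ (hepos p hp)]; linarith
        linarith
      · exact pair_form_nonneg (hap p hp) (h.vh_nonneg p) (hxnn _) (hynn _) (hrsq p)
    have h3 : ∑ p ∈ S, (1 / 2 * (e p - a p) - l p / e p * ((a p + vh p - e p) / 2)
        - vh p * (ν / N)) ≤
        ∑ p ∈ S, (N - ν - n p) / N * (vh p / 2 - (1 + l p / e p) * ((a p + vh p - e p) / 2)) := by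
      refine Finset.sum_le_sum fun p hp => ?_
      have hl := abs_le.mp (h.abs_l_le p hp)
      have q1 : -1 ≤ l p / e p := by rw [le_div_iff₀ (hepos p hp)]; linarith [hl.1]
      have q2 : l p / e p ≤ 1 := by rw [div_le_iff₀ (hepos p hp)]; linarith [hl.2]
      have q3 : 0 ≤ (a p + vh p - e p) / 2 := by linarith [heav p hp]
      have q4 : (a p + vh p - e p) / 2 ≤ vh p / 2 := by linarith [hea p hp]
      set c := vh p / 2 - (1 + l p / e p) * ((a p + vh p - e p) / 2) with hc
      have q5 : c ≤ vh p / 2 := by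
        have : 0 ≤ (1 + l p / e p) * ((a p + vh p - e p) / 2) := mul_nonneg (by linarith) q3
        linarith
      have q6 : 0 ≤ (ν + n p) / N := by
        have : 0 ≤ n p := ev_nonneg f fun k => occNum_nonneg p k
        positivity
      have q7 : (ν + n p) / N ≤ 2 * (ν / N) := by
        have : n p ≤ ν := ev_mono f fun k _ => occNum_le (hS0 p hp) k
        rw [← mul_div_assoc]; gcongr; linarith
      have q8 : (N - ν - n p) / N = 1 - (ν + n p) / N := by field_simp; ring
      rw [q8]
      have hv0 := h.vh_nonneg p
      have q9 : (ν + n p) / N * c ≤ 2 * (ν / N) * (vh p / 2) := by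
        calc (ν + n p) / N * c ≤ (ν + n p) / N * (vh p / 2) := by gcongr
          _ ≤ _ := by gcongr
      have q10 : 1 / 2 * (e p - a p) - l p / e p * ((a p + vh p - e p) / 2) = c := by
        rw [hc]; ring
      rw [q10]
      linarith
    have h4 : ∑ p ∈ S, l p / e p * ((a p + vh p - e p) / 2) = 0 :=
      sum_odd_eq_zero h.neg_mem _ fun p => by rw [h.l_neg, hen, h.a_neg, h.vh_neg]; ring
    rw [Finset.sum_sub_distrib, Finset.sum_sub_distrib, h4, ← Finset.mul_sum, ← Finset.sum_mul,
      sub_zero] at h3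
    have h5 : (∑ p ∈ S, vh p) * (ν / N) ≤ V * (ν / N) := by gcongr; exact h.sum_le
    linarith
  have hpot' := Finset.sum_le_sum hpot
  rw [Finset.sum_sub_distrib, ← Finset.sum_mul] at hpot'
  have hxs : ∑ p ∈ S, (vh p / 2 * (x (-p) + y p) + vh p * r p) =
      ∑ p ∈ S, (vh p / 2 * (x p + y p) + vh p * r p) := by
    have := sum_neg_eq h.neg_mem fun p => vh p / 2 * x p
    simp only [h.vh_neg] at this
    simp only [mul_add, Finset.sum_add_distrib, this]
  rw [hxs] at hpot'
  have hVt : (∑ p ∈ S, vh p) * t ≤ V * t := by gcongr; exact h.sum_le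
  have hsplit : ∑ p ∈ S, ((a p - l p) * x p + vh p / 2 * (x p + y p) + vh p * r p) =
      ∑ p ∈ S, (a p - l p) * x p + ∑ p ∈ S, (vh p / 2 * (x p + y p) + vh p * r p) := by
    rw [← Finset.sum_add_distrib]
    exact Finset.sum_congr rfl fun p _ => by ring
  rw [hsplit] at hquad
  unfold hamForm
  have : V * (ν / N + 2 * ν2 / N + t) = V * (ν / N) + 2 * V * ν2 / N + V * t := by ring
  rw [this]
  linarith

end Bogoliubov

section Variation

variable {Λ : Type*} [AddCommGroup Λ] [DecidableEq Λ] {N : ℕ}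

lemma re_inner_density_excNum_ge {p : Λ} (hp : p ≠ 0) (f : (Fin N → Λ) →₀ ℂ) :
    -(1 / 2) * ‖density p f‖ ^ 2 - ‖toCond (-p) f‖ ^ 2 - ‖fromCond p f‖ ^ 2 ≤
      RCLike.re (inner ℂ (density p f) (density p (diagOp excNum f))) := by
  rw [density_diagOp_excNum p hp, inner_add_right, inner_diagOp, map_add]
  have h1 : 0 ≤ ev excNum (density p f) := ev_nonneg _ excNum_nonneg
  have h2 := (abs_le.mp ((RCLike.abs_re_le_norm _).trans
    (norm_inner_le_norm (𝕜 := ℂ) (density p f) (toCond (-p) f - fromCond p f)))).1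
  have h3 := norm_sub_le (toCond (-p) f) (fromCond p f)
  have h4 : ‖density p f‖ * ‖toCond (-p) f - fromCond p f‖ ≤
      ‖density p f‖ * (‖toCond (-p) f‖ + ‖fromCond p f‖) := by gcongr
  have h5 : RCLike.re ((ev excNum (density p f) : ℝ) : ℂ) = ev excNum (density p f) :=
    Complex.ofReal_re _
  rw [h5]
  nlinarith [sq_nonneg (‖density p f‖ - ‖toCond (-p) f‖ - ‖fromCond p f‖),
    sq_nonneg (‖toCond (-p) f‖ - ‖fromCond p f‖)]

lemma norm_density_le (p : Λ) (f : (Fin N → Λ) →₀ ℂ) : ‖density p f‖ ≤ N * ‖f‖ := by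
  rw [density, LinearMap.sum_apply]
  refine (norm_sum_le _ _).trans ?_
  simp [norm_shiftOp]

lemma hamForm_nonneg {a w : Λ → ℝ} {S : Finset Λ} (ha : ∀ p, 0 ≤ a p) (hw : ∀ p ∈ S, 0 ≤ w p)
    (f : (Fin N → Λ) →₀ ℂ) : 0 ≤ hamForm a w S f :=
  add_nonneg (ev_nonneg f fun _ => Finset.sum_nonneg fun _ _ => ha _)
    (Finset.sum_nonneg fun p hp => mul_nonneg (hw p hp) (sq_nonneg _))

lemma hamForm_smul (a w : Λ → ℝ) (S : Finset Λ) (c : ℂ) (f : (Fin N → Λ) →₀ ℂ) :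
    hamForm a w S (c • f) = ‖c‖ ^ 2 * hamForm a w S f := by
  have h1 : ∀ m : (Fin N → Λ) → ℝ, ev m (c • f) = ‖c‖ ^ 2 * ev m f := fun m => by
    rcases eq_or_ne c 0 with rfl | hc
    · simp [ev]
    · rw [ev, Finsupp.sum_smul_index' (by simp), ev, Finsupp.mul_sum]
      refine Finset.sum_congr rfl fun k _ => ?_
      simp only [smul_eq_mul, norm_mul, mul_pow]; ring
  simp only [hamForm, h1, map_smul, norm_smul, mul_pow, mul_add, Finset.mul_sum]
  congr 1
  exact Finset.sum_congr rfl fun p _ => by ring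

lemma hamForm_perturb (a w : Λ → ℝ) (S : Finset Λ) (s : ℝ) (f : (Fin N → Λ) →₀ ℂ) :
    hamForm a w S (diagOp (fun k => 1 + s * excNum k) f) =
      hamForm a w S f + 2 * s * (ev (fun k => (∑ i, a (k i)) * excNum k) f +
        ∑ p ∈ S, w p * RCLike.re (inner ℂ (density p f) (density p (diagOp excNum f)))) +
      s ^ 2 * hamForm a w S (diagOp excNum f) := by
  have h1 : diagOp (fun k => 1 + s * excNum k) f = f + (s : ℂ) • diagOp excNum f := by
    ext k
    simp only [Finsupp.add_apply, Finsupp.smul_apply, diagOp_apply, smul_eq_mul]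
    push_cast; ring
  have h2 : ∀ p, ‖density p (diagOp (fun k => 1 + s * excNum k) f)‖ ^ 2 =
      ‖density p f‖ ^ 2 +
        2 * s * RCLike.re (inner ℂ (density p f) (density p (diagOp excNum f))) +
        s ^ 2 * ‖density p (diagOp excNum f)‖ ^ 2 := fun p => by
    rw [h1, map_add, map_smul, norm_add_sq (𝕜 := ℂ), inner_smul_right, norm_smul, mul_pow]
    have : RCLike.re ((s : ℂ) * inner ℂ (density p f) (density p (diagOp excNum f))) =
        s * RCLike.re (inner ℂ (density p f) (density p (diagOp excNum f))) :=
      Complex.re_ofReal_mul _ _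
    rw [this]
    simp only [Complex.norm_real, Real.norm_eq_abs, sq_abs]
    ring
  have h3 : ev (fun k => ∑ i, a (k i)) (diagOp (fun k => 1 + s * excNum k) f) =
      ev (fun k => ∑ i, a (k i)) f + 2 * s * ev (fun k => (∑ i, a (k i)) * excNum k) f +
        s ^ 2 * ev (fun k => ∑ i, a (k i)) (diagOp excNum f) := by
    rw [ev_diagOp, ev_diagOp, ← ev_const_mul, ← ev_const_mul, ← ev_add, ← ev_add]
    congr 1; funext k; ring
  simp only [hamForm, h2, h3, mul_add, Finset.sum_add_distrib, Finset.mul_sum]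
  have e1 : ∀ p, w p * (2 * s * RCLike.re (inner ℂ (density p f) (density p (diagOp excNum f)))) =
    2 * s * (w p * RCLike.re (inner ℂ (density p f) (density p (diagOp excNum f)))) :=
    fun p => by ring
  have e2 : ∀ p, w p * (s ^ 2 * ‖density p (diagOp excNum f)‖ ^ 2) =
    s ^ 2 * (w p * ‖density p (diagOp excNum f)‖ ^ 2) := fun p => by ring
  simp only [e1, e2]
  ring

lemma excNum_le_sum {a : Λ → ℝ} (ha0 : a 0 = 0) (ha : ∀ p, p ≠ 0 → 1 ≤ a p) (k : Fin N → Λ) :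
    excNum k ≤ ∑ i, a (k i) :=
  Finset.sum_le_sum fun i _ => by
    unfold exc; split_ifs with h
    · rw [h, ha0]
    · exact ha _ h

/-- The second moment of the excitation number of an approximate minimizer is controlled by
its energy. -/
lemma ev_excNum_sq_le {a vh l : Λ → ℝ} {S : Finset Λ} {V μ K : ℝ} (h : Modes a vh l S V)
    (hN : 2 ≤ N) {f : (Fin N → Λ) →₀ ℂ} (hn : ‖f‖ = 1) (hμ : 0 ≤ μ) (hK : 0 < K)
    (hKb : hamForm a (fun p => vh p / (2 * ((N : ℝ) - 1))) S (diagOp excNum f) ≤ K)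
    (hb : hamForm a (fun p => vh p / (2 * ((N : ℝ) - 1))) S f ≤ μ + 1 / K)
    (hmin : μ * ‖diagOp (fun k => 1 + (-(1 / K)) * excNum k) f‖ ^ 2 ≤
      hamForm a (fun p => vh p / (2 * ((N : ℝ) - 1))) S
        (diagOp (fun k => 1 + (-(1 / K)) * excNum k) f)) :
    ev (fun k => excNum k ^ 2) f ≤ 1 + μ * ev excNum f +
      hamForm a (fun p => vh p / (2 * ((N : ℝ) - 1))) S f / 2 + V * (2 * ev excNum f + 1) := by
  have hNr : (2 : ℝ) ≤ N := by exact_mod_cast hN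
  have hS0 : ∀ p ∈ S, p ≠ 0 := fun p hp h0 => h.zero_notMem (h0 ▸ hp)
  rw [hamForm_perturb, norm_diagOp_sq] at hmin
  set w : Λ → ℝ := fun p => vh p / (2 * ((N : ℝ) - 1)) with hw
  set X := ev (fun k => (∑ i, a (k i)) * excNum k) f +
        ∑ p ∈ S, w p * RCLike.re (inner ℂ (density p f) (density p (diagOp excNum f))) with hX
  set ν := ev excNum f with hν
  set ν2 := ev (fun k => excNum k ^ 2) f with hν2
  have hν20 : 0 ≤ ν2 := ev_nonneg f fun k => sq_nonneg _
  have hν0 : 0 ≤ ν := ev_nonneg f excNum_nonneg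
  have e1 : ev (fun k => (1 + (-(1 / K)) * excNum k) ^ 2) f =
      1 - 2 * (1 / K) * ν + (1 / K) ^ 2 * ν2 := by
    have : (fun k : Fin N → Λ => (1 + (-(1 / K)) * excNum k) ^ 2) =
        fun k => (1 - (2 * (1 / K)) * excNum k) + (1 / K) ^ 2 * excNum k ^ 2 := by
      funext k; ring
    rw [this, ev_add, ev_sub, ev_const_mul, ev_const_mul, ev_one, hn]; ring
  rw [e1] at hmin
  have hXle : X - μ * ν ≤ 1 := by
    set κ := 1 / K with hκ
    have hκ0 : 0 < κ := by positivity
    have h1 : κ ^ 2 * hamForm a w S (diagOp excNum f) ≤ κ := by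
      calc κ ^ 2 * hamForm a w S (diagOp excNum f) ≤ κ ^ 2 * K := by gcongr
        _ = κ := by rw [hκ]; field_simp
    have h2 : 0 ≤ μ * (κ ^ 2 * ν2) := by positivity
    have h3 : 2 * κ * (X - μ * ν) ≤ 2 * κ * 1 := by nlinarith
    exact le_of_mul_le_mul_left h3 (by positivity)
  have hkin : ν2 ≤ ev (fun k => (∑ i, a (k i)) * excNum k) f := ev_mono f fun k _ => by
    rw [sq]
    exact mul_le_mul_of_nonneg_right (excNum_le_sum h.a_zero h.one_le_a k) (excNum_nonneg k)
  have hw0 : ∀ p, 0 ≤ w p := fun p => div_nonneg (h.vh_nonneg p) (by linarith)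
  have hwN : ∀ p, w p * N ≤ vh p := fun p => by
    have := h.vh_nonneg p
    rw [hw]; simp only
    rw [div_mul_eq_mul_div, div_le_iff₀ (by linarith)]
    nlinarith
  have hpot : -(1 / 2) * ∑ p ∈ S, w p * ‖density p f‖ ^ 2 - V * (2 * ν + 1) ≤
      ∑ p ∈ S, w p * RCLike.re (inner ℂ (density p f) (density p (diagOp excNum f))) := by
    have h1 : ∀ p ∈ S, -(1 / 2) * (w p * ‖density p f‖ ^ 2) - vh p * (2 * ν + 1) ≤
        w p * RCLike.re (inner ℂ (density p f) (density p (diagOp excNum f))) := by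
      intro p hp
      have g1 := re_inner_density_excNum_ge (hS0 p hp) f
      have g2 := norm_toCond_sq_le' f (neg_ne_zero.mpr (hS0 p hp))
      have g3 := norm_fromCond_sq_le hn (hS0 p hp)
      have g4 : -(1 / 2) * ‖density p f‖ ^ 2 - N * (2 * ν + 1) ≤
        RCLike.re (inner ℂ (density p f) (density p (diagOp excNum f))) := by linarith
      have g5 := mul_le_mul_of_nonneg_left g4 (hw0 p)
      have g6 : w p * N * (2 * ν + 1) ≤ vh p * (2 * ν + 1) := by
        have := hwN p; gcongr
      linarith
    have h2 := Finset.sum_le_sum h1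
    rw [Finset.sum_sub_distrib, ← Finset.mul_sum, ← Finset.sum_mul] at h2
    have h3 : (∑ p ∈ S, vh p) * (2 * ν + 1) ≤ V * (2 * ν + 1) := by gcongr; exact h.sum_le
    linarith
  have hkin0 : 0 ≤ ev (fun k => ∑ i, a (k i)) f := ev_nonneg f fun k =>
    (excNum_nonneg k).trans (excNum_le_sum h.a_zero h.one_le_a k)
  have : hamForm a w S f / 2 = ev (fun k => ∑ i, a (k i)) f / 2 +
      (1 / 2) * ∑ p ∈ S, w p * ‖density p f‖ ^ 2 := by rw [hamForm]; ring
  rw [this]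
  linarith

set_option maxHeartbeats 1000000 in
/-- The lower bound on the Hamiltonian form in a sector of fixed momentum. -/
lemma hamForm_ge_of_norm_eq_one {a vh l : Λ → ℝ} {S : Finset Λ} {V m B : ℝ}
    (h : Modes a vh l S V) (hN : 2 ≤ N) (hB : 1 ≤ B) (hBN : B ≤ N)
    {f : (Fin N → Λ) →₀ ℂ} (hf : SymmState f) (hn : ‖f‖ = 1)
    (hm : ∀ k, f k ≠ 0 → ∑ i, l (k i) = m) :
    min B (m + (1 / 2) * ∑ p ∈ S, (√(a p ^ 2 + 2 * a p * vh p) - a p)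
      - V * (1 + 2 * (3 + 3 * V) + √(6 * (3 + 3 * V))) * √(B ^ 3 / N)) ≤
    hamForm a (fun p => vh p / (2 * ((N : ℝ) - 1))) S f := by
  have hNr : (2 : ℝ) ≤ N := by exact_mod_cast hN
  have hN0 : (0 : ℝ) < N := by linarith
  have hV : 0 ≤ V := (Finset.sum_nonneg fun p _ => h.vh_nonneg p).trans h.sum_le
  set w : Λ → ℝ := fun p => vh p / (2 * ((N : ℝ) - 1)) with hw
  have hw0 : ∀ p, 0 ≤ w p := fun p => div_nonneg (h.vh_nonneg p) (by linarith)
  have hwv : ∀ p, w p ≤ vh p := fun p => div_le_self (h.vh_nonneg p) (by linarith)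
  have ha : ∀ p, 0 ≤ a p := fun p => by
    rcases eq_or_ne p 0 with rfl | hp
    · rw [h.a_zero]
    · exact zero_le_one.trans (h.one_le_a p hp)
  by_contra! hlt
  set T := m + (1 / 2) * ∑ p ∈ S, (√(a p ^ 2 + 2 * a p * vh p) - a p)
      - V * (1 + 2 * (3 + 3 * V) + √(6 * (3 + 3 * V))) * √(B ^ 3 / N) with hT
  set A : Set ℝ := {x | ∃ g : (Fin N → Λ) →₀ ℂ, SymmState g ∧
    (∀ k, g k ≠ 0 → ∑ i, l (k i) = m) ∧ ‖g‖ = 1 ∧ x = hamForm a w S g} with hA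
  have hAne : A.Nonempty := ⟨_, f, hf, hm, hn, rfl⟩
  have hA0 : ∀ x ∈ A, 0 ≤ x := by
    rintro x ⟨g, -, -, -, rfl⟩
    exact hamForm_nonneg ha (fun p _ => hw0 p) g
  have hAb : BddBelow A := ⟨0, hA0⟩
  set μ := sInf A with hμ
  have hμ0 : 0 ≤ μ := le_csInf hAne hA0
  have hμlt : μ < min B T := (csInf_le hAb ⟨f, hf, hm, hn, rfl⟩).trans_lt hlt
  set K : ℝ := N ^ 2 * B + V * N ^ 4 + 1 with hK
  have hK0 : 0 < K := by positivity
  obtain ⟨x, ⟨g, hgs, hgm, hgn, rfl⟩, hgx⟩ := exists_lt_of_csInf_lt hAne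
    (show sInf A < min (μ + 1 / K) (min B T) from
      lt_min (lt_add_of_pos_right _ (by positivity)) hμlt)
  have hg1 : hamForm a w S g ≤ μ + 1 / K := (hgx.le.trans (min_le_left _ _))
  have hg2 : hamForm a w S g < min B T := hgx.trans_le (min_le_right _ _)
  have hgB : hamForm a w S g ≤ B := hg2.le.trans (min_le_left _ _)
  have hpot0 : 0 ≤ ∑ p ∈ S, w p * ‖density p g‖ ^ 2 :=
    Finset.sum_nonneg fun p _ => mul_nonneg (hw0 p) (sq_nonneg _)
  set ν := ev excNum g with hν
  set ν2 := ev (fun k => excNum k ^ 2) g with hν2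
  have hν0 : 0 ≤ ν := ev_nonneg g excNum_nonneg
  have hν20 : 0 ≤ ν2 := ev_nonneg g fun k => sq_nonneg _
  have hνB : ν ≤ B := by
    have : ν ≤ ev (fun k => ∑ i, a (k i)) g :=
      ev_mono g fun k _ => excNum_le_sum h.a_zero h.one_le_a k
    have h2 : hamForm a w S g = ev (fun k => ∑ i, a (k i)) g +
      ∑ p ∈ S, w p * ‖density p g‖ ^ 2 := rfl
    linarith
  have hKb : hamForm a w S (diagOp excNum g) ≤ K := by
    have h1 : ev (fun k => ∑ i, a (k i)) (diagOp excNum g) ≤ N ^ 2 * B := by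
      rw [ev_diagOp]
      have h2 : hamForm a w S g = ev (fun k => ∑ i, a (k i)) g +
        ∑ p ∈ S, w p * ‖density p g‖ ^ 2 := rfl
      calc _ ≤ ev (fun k => (N : ℝ) ^ 2 * ∑ i, a (k i)) g := by
            refine ev_mono g fun k _ => ?_
            rw [mul_comm]
            have := excNum_le k
            have := excNum_nonneg k
            have : 0 ≤ ∑ i, a (k i) := Finset.sum_nonneg fun i _ => ha _
            gcongr
        _ = N ^ 2 * ev (fun k => ∑ i, a (k i)) g := ev_const_mul _ _ _
        _ ≤ _ := by gcongr; linarith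
    have h2 : ‖diagOp excNum g‖ ≤ N := by
      rw [← sq_le_sq₀ (norm_nonneg _) hN0.le, norm_diagOp_sq]
      calc _ ≤ ev (fun _ => (N : ℝ) ^ 2 * 1) g := by
            refine ev_mono g fun k _ => ?_
            have := excNum_le k
            have := excNum_nonneg k
            rw [mul_one]; gcongr
        _ = _ := by rw [ev_const_mul, ev_one, hgn]; ring
    have h3 : ∑ p ∈ S, w p * ‖density p (diagOp excNum g)‖ ^ 2 ≤ V * N ^ 4 := by
      calc _ ≤ ∑ p ∈ S, vh p * (N : ℝ) ^ 4 := by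
            refine Finset.sum_le_sum fun p _ => ?_
            have h4 : ‖density p (diagOp excNum g)‖ ≤ N ^ 2 :=
              (norm_density_le p _).trans (by rw [sq]; gcongr)
            have h5 : ‖density p (diagOp excNum g)‖ ^ 2 ≤ (N ^ 2) ^ 2 := by gcongr
            have h6 : ((N : ℝ) ^ 2) ^ 2 = N ^ 4 := by ring
            rw [h6] at h5
            exact mul_le_mul (hwv p) h5 (sq_nonneg _) (h.vh_nonneg p)
        _ = (∑ p ∈ S, vh p) * N ^ 4 := by rw [Finset.sum_mul]
        _ ≤ _ := by gcongr; exact h.sum_le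
    have h4 : hamForm a w S (diagOp excNum g) = ev (fun k => ∑ i, a (k i)) (diagOp excNum g) +
        ∑ p ∈ S, w p * ‖density p (diagOp excNum g)‖ ^ 2 := rfl
    linarith
  have hmin : μ * ‖diagOp (fun k => 1 + (-(1 / K)) * excNum k) g‖ ^ 2 ≤
      hamForm a w S (diagOp (fun k => 1 + (-(1 / K)) * excNum k) g) := by
    set g' := diagOp (fun k => 1 + (-(1 / K)) * excNum k) g with hg'
    rcases eq_or_ne g' 0 with h0 | h0
    · rw [h0]; simp only [norm_zero]
      have := hamForm_nonneg (N := N) ha (fun p (_ : p ∈ S) => hw0 p) 0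
      linarith
    · have hpos : 0 < ‖g'‖ := norm_pos_iff.mpr h0
      have hmem : hamForm a w S (((‖g'‖⁻¹ : ℝ) : ℂ) • g') ∈ A := by
        refine ⟨_, ?_, ?_, ?_, rfl⟩
        · intro σ k
          simp only [Finsupp.smul_apply, hg', diagOp_apply, hgs σ k]
          have : excNum (fun i => k (σ i)) = excNum k := by
            unfold excNum exc
            exact Equiv.sum_comp σ fun i => if k i = 0 then (0 : ℝ) else 1
          rw [this]
        · intro k hk
          refine hgm k fun h1 => hk ?_
          simp [hg', diagOp_apply, h1]
        · rw [norm_smul, Complex.norm_real, norm_inv, norm_norm, inv_mul_cancel₀ hpos.ne']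
      have := csInf_le hAb hmem
      rw [hamForm_smul, Complex.norm_real, norm_inv, norm_norm, inv_pow, ← hμ] at this
      rw [← le_div_iff₀ (by positivity)]
      rwa [div_eq_inv_mul]
  have hsq := ev_excNum_sq_le h hN hgn hμ0 hK0 hKb hg1 hmin
  rw [← hν, ← hν2] at hsq
  have hμB : μ ≤ B := hμlt.le.trans (min_le_left _ _)
  have hν2B : ν2 ≤ (3 + 3 * V) * B ^ 2 := by
    have h1 : μ * ν ≤ B * B := by gcongr
    have h2 : V * (2 * ν + 1) ≤ V * (3 * B ^ 2) := by
      have : 2 * ν + 1 ≤ 3 * B ^ 2 := by nlinarith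
      gcongr
    have h3 : hamForm a (fun p => vh p / (2 * ((N : ℝ) - 1))) S g ≤ B := hgB
    nlinarith
  have hlow := hamForm_lower h hN hgs hgn hgm
  rw [← hν, ← hν2] at hlow
  set E := √(B ^ 3 / N) with hE
  have hE2 : B ^ 2 / N ≤ E := by
    apply Real.le_sqrt_of_sq_le
    rw [div_pow, div_le_div_iff₀ (by positivity) hN0]
    have : (0 : ℝ) ≤ B ^ 3 * N := by positivity
    nlinarith
  have hE1 : B / N ≤ E := by
    refine le_trans ?_ hE2
    gcongr; nlinarith
  have t1 : ν / N ≤ E := le_trans (by gcongr) hE1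
  have t2 : 2 * ν2 / N ≤ 2 * (3 + 3 * V) * E := by
    calc 2 * ν2 / N ≤ 2 * ((3 + 3 * V) * B ^ 2) / N := by gcongr
      _ = 2 * (3 + 3 * V) * (B ^ 2 / N) := by ring
      _ ≤ _ := by gcongr
  have t3 : √(2 * (2 * ν + 1) * ν2 / N) ≤ √(6 * (3 + 3 * V)) * E := by
    rw [hE, ← Real.sqrt_mul (by positivity)]
    apply Real.sqrt_le_sqrt
    calc 2 * (2 * ν + 1) * ν2 / N ≤ 2 * (3 * B) * ((3 + 3 * V) * B ^ 2) / N := by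
          gcongr; linarith
      _ = _ := by ring
  have t4 : V * (ν / N + 2 * ν2 / N + √(2 * (2 * ν + 1) * ν2 / N)) ≤
      V * (1 + 2 * (3 + 3 * V) + √(6 * (3 + 3 * V))) * E := by
    rw [mul_assoc V]
    refine mul_le_mul_of_nonneg_left ?_ hV
    linarith
  have : hamForm a w S g < T := hg2.trans_le (min_le_right _ _)
  have hlow' : m + (1 / 2) * ∑ p ∈ S, (√(a p ^ 2 + 2 * a p * vh p) - a p)
        - V * (ν / N + 2 * ν2 / N + √(2 * (2 * ν + 1) * ν2 / N)) ≤ hamForm a w S g := hlow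
  linarith

lemma hamForm_ge {a vh l : Λ → ℝ} {S : Finset Λ} {V m B : ℝ}
    (h : Modes a vh l S V) (hN : 2 ≤ N) (hB : 1 ≤ B) (hBN : B ≤ N)
    {f : (Fin N → Λ) →₀ ℂ} (hf : SymmState f)
    (hm : ∀ k, f k ≠ 0 → ∑ i, l (k i) = m) :
    min B (m + (1 / 2) * ∑ p ∈ S, (√(a p ^ 2 + 2 * a p * vh p) - a p)
      - V * (1 + 2 * (3 + 3 * V) + √(6 * (3 + 3 * V))) * √(B ^ 3 / N)) * ‖f‖ ^ 2 ≤
    hamForm a (fun p => vh p / (2 * ((N : ℝ) - 1))) S f := by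
  rcases eq_or_ne f 0 with rfl | h0
  · simp [hamForm, ev]
  · have hpos : 0 < ‖f‖ := norm_pos_iff.mpr h0
    have := hamForm_ge_of_norm_eq_one (f := ((‖f‖⁻¹ : ℝ) : ℂ) • f) h hN hB hBN
      (fun σ k => by simp only [Finsupp.smul_apply, hf σ k])
      (by rw [norm_smul, Complex.norm_real, norm_inv, norm_norm, inv_mul_cancel₀ hpos.ne'])
      (m := m) (fun k hk => hm k fun h1 => hk (by simp [h1]))
    rw [hamForm_smul, Complex.norm_real, norm_inv, norm_norm, inv_pow] at this
    rw [← le_div_iff₀ (by positivity)]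
    exact this.trans_eq (div_eq_inv_mul _ _).symm

end Variation

section Torus

variable {d N : ℕ} {E : Type*} [NormedAddCommGroup E] [NormedSpace ℝ E]

attribute [local instance] instMeasureSpaceUnitAddCircle
  instIsAddHaarMeasureUnitAddCircleVolume instIsProbabilityMeasureUnitAddCircleVolume

/-- `F` is 1-periodic in each coordinate. -/
def PeriodicFn {E : Type*} (F : (Fin N → Fin d → ℝ) → E) : Prop :=
  ∀ (x : Fin N → Fin d → ℝ) (k : Fin N → Fin d → ℤ), F (fun i j => x i j + (k i j : ℝ)) = F x

/-- The function on the torus induced by a function of the configuration. -/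
def torusLift {E : Type*} (F : (Fin N → Fin d → ℝ) → E) (y : UnitAddTorus (Fin N × Fin d)) : E :=
  F fun i j => (AddCircle.equivIoc (1 : ℝ) 0 (y (i, j)) : ℝ)

lemma torusLift_coe {E : Type*} {F : (Fin N → Fin d → ℝ) → E} (hF : PeriodicFn F)
    (x : Fin N → Fin d → ℝ) :
    torusLift F (fun ij => (x ij.1 ij.2 : UnitAddCircle)) = F x := by
  have h : ∀ i j, ∃ k : ℤ, ((AddCircle.equivIoc (1 : ℝ) 0 (x i j : UnitAddCircle)) : ℝ)
      = x i j + k := by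
    intro i j
    have h1 : (((AddCircle.equivIoc (1 : ℝ) 0 (x i j : UnitAddCircle)) : ℝ) : UnitAddCircle)
        = (x i j : UnitAddCircle) := AddCircle.coe_equivIoc
    rw [← sub_eq_zero, ← AddCircle.coe_sub, AddCircle.coe_eq_zero_iff] at h1
    obtain ⟨k, hk⟩ := h1
    exact ⟨k, by rw [zsmul_eq_mul, mul_one] at hk; linarith⟩
  choose k hk using h
  rw [torusLift]
  simp only [hk]
  exact hF x k

lemma continuous_torusLift {E : Type*} [TopologicalSpace E] {F : (Fin N → Fin d → ℝ) → E}
    (hF : PeriodicFn F) (hc : Continuous F) : Continuous (torusLift F) := by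
  have hq : IsOpenQuotientMap
      (Pi.map fun (_ : Fin N × Fin d) (t : ℝ) => (t : UnitAddCircle)) :=
    IsOpenQuotientMap.piMap fun _ => QuotientAddGroup.isOpenQuotientMap_mk
  rw [hq.isQuotientMap.continuous_iff]
  have : torusLift F ∘ (Pi.map fun (_ : Fin N × Fin d) (t : ℝ) => (t : UnitAddCircle)) =
      fun z => F fun i j => z (i, j) := by
    funext z
    exact torusLift_coe hF (fun i j => z (i, j))
  rw [this]
  fun_prop

lemma isCompact_boxN : IsCompact (boxN d N) :=
  isCompact_univ_pi fun _ => isCompact_univ_pi fun _ => isCompact_Icc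

lemma measurableSet_boxN : MeasurableSet (boxN d N) :=
  MeasurableSet.univ_pi fun _ => MeasurableSet.univ_pi fun _ => measurableSet_Icc

lemma integrableOn_boxN {F : (Fin N → Fin d → ℝ) → E} (hc : Continuous F) :
    IntegrableOn F (boxN d N) :=
  hc.continuousOn.integrableOn_compact isCompact_boxN

lemma measurePreserving_uncurry : MeasurePreserving
    (MeasurableEquiv.curry (Fin N) (Fin d) ℝ).symm := by
  refine ⟨MeasurableEquiv.measurable _, ?_⟩
  symm
  refine Measure.pi_eq fun s hs => ?_
  rw [MeasurableEquiv.map_apply]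
  have : (MeasurableEquiv.curry (Fin N) (Fin d) ℝ).symm ⁻¹' Set.univ.pi s =
      Set.univ.pi fun i => Set.univ.pi fun j => s (i, j) := by
    ext x
    simp [Set.mem_pi, MeasurableEquiv.curry, Function.uncurry]
  rw [this, volume_pi_pi]
  simp only [volume_pi_pi]
  rw [Fintype.prod_prod_type]

lemma integral_boxN_eq (F : (Fin N → Fin d → ℝ) → E) :
    ∫ x in boxN d N, F x = ∫ y : UnitAddTorus (Fin N × Fin d), torusLift F y := by
  rw [UnitAddTorus.integral_preimage _ 0]
  have h1 : ({x | ∀ i, x i ∈ Set.Ioc ((0 : Fin N × Fin d → ℝ) i) ((0 : Fin N × Fin d → ℝ) i + 1)} :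
      Set (Fin N × Fin d → ℝ)) = Set.univ.pi fun _ => Set.Ioc 0 1 := by
    ext x; simp
  rw [h1]
  have h2 : ∫ x in Set.univ.pi fun _ : Fin N × Fin d => Set.Ioc (0 : ℝ) 1,
      torusLift F (fun i => (x i : UnitAddCircle)) =
      ∫ x in Set.univ.pi fun _ : Fin N × Fin d => Set.Ioc (0 : ℝ) 1, F fun i j => x (i, j) := by
    refine setIntegral_congr_fun (MeasurableSet.univ_pi fun _ => measurableSet_Ioc) fun x hx => ?_
    simp only [torusLift]
    congr 1
    funext i j
    have : x (i, j) ∈ Set.Ioc (0 : ℝ) (0 + 1) := by simpa using hx (i, j) trivial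
    exact AddCircle.equivIoc_coe_of_mem this
  have h3 : (Set.univ.pi fun _ : Fin N × Fin d => Set.Ioc (0 : ℝ) 1) =ᵐ[volume]
      (Set.univ.pi fun _ : Fin N × Fin d => Set.Icc (0 : ℝ) 1) :=
    Measure.pi_Ioc_ae_eq_pi_Icc (μ := fun _ => volume) (f := fun _ => 0) (g := fun _ => 1)
  rw [h2, setIntegral_congr_set h3,
    ← (measurePreserving_uncurry (d := d) (N := N)).setIntegral_preimage_emb
      (MeasurableEquiv.measurableEmbedding _)]
  congr 2
  ext x
  simp [boxN, Set.mem_pi, MeasurableEquiv.curry, Function.uncurry, -Set.pi_univ_Icc]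

/-- Integrals of periodic functions over the box are translation invariant. -/
lemma integral_boxN_translate {F : (Fin N → Fin d → ℝ) → E} (hF : PeriodicFn F)
    (t : Fin N → Fin d → ℝ) : ∫ x in boxN d N, F (t + x) = ∫ x in boxN d N, F x := by
  rw [integral_boxN_eq, integral_boxN_eq,
    ← integral_add_left_eq_self (torusLift F) (fun ij => (t ij.1 ij.2 : UnitAddCircle))]
  congr 1
  funext y
  have hy : y = fun ij : Fin N × Fin d =>
      (((fun i j => (AddCircle.equivIoc (1 : ℝ) 0 (y (i, j)) : ℝ)) ij.1 ij.2 : ℝ)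
        : UnitAddCircle) := by
    funext ij
    exact (AddCircle.coe_equivIoc).symm
  conv_rhs => rw [hy]
  have := torusLift_coe hF (t + fun i j => (AddCircle.equivIoc (1 : ℝ) 0 (y (i, j)) : ℝ))
  rw [← torusLift_coe hF] at this
  rw [torusLift, ← torusLift_coe hF]
  rfl

/-- The plane wave with momenta `2πk`. -/
def wave (k : Fin N → Fin d → ℤ) (x : Fin N → Fin d → ℝ) : ℂ :=
  Complex.exp (Complex.I * ∑ i, ∑ j, (2 * π * (k i j : ℝ)) * x i j)

/-- The Fourier coefficients over the box. -/
def coef (F : (Fin N → Fin d → ℝ) → ℂ) (k : Fin N → Fin d → ℤ) : ℂ :=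
  ∫ x in boxN d N, wave (-k) x * F x

lemma wave_eq_ofReal (k : Fin N → Fin d → ℤ) (x : Fin N → Fin d → ℝ) :
    wave k x = Complex.exp ((∑ i, ∑ j, (2 * π * (k i j : ℝ)) * x i j : ℝ) * Complex.I) := by
  rw [wave, mul_comm]

lemma norm_wave (k : Fin N → Fin d → ℤ) (x : Fin N → Fin d → ℝ) : ‖wave k x‖ = 1 := by
  rw [wave_eq_ofReal, Complex.norm_exp_ofReal_mul_I]

lemma wave_add (k l : Fin N → Fin d → ℤ) (x : Fin N → Fin d → ℝ) :
    wave (k + l) x = wave k x * wave l x := by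
  rw [wave, wave, wave, ← Complex.exp_add, ← mul_add, ← Complex.ofReal_add,
    ← Finset.sum_add_distrib]
  congr 3
  refine Finset.sum_congr rfl fun i _ => ?_
  rw [← Finset.sum_add_distrib]
  refine Finset.sum_congr rfl fun j _ => ?_
  simp only [Pi.add_apply]; push_cast; ring

lemma contDiff_wave (k : Fin N → Fin d → ℤ) :
    ContDiff ℝ (⊤ : ℕ∞) (wave k : (Fin N → Fin d → ℝ) → ℂ) := by
  have : (wave k : (Fin N → Fin d → ℝ) → ℂ) = fun x => Complex.exp (
      ((∑ i, ∑ j, (2 * π * (k i j : ℝ)) * x i j : ℝ) : ℂ) * Complex.I) :=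
    funext fun x => wave_eq_ofReal k x
  rw [this]
  have h : ContDiff ℝ (⊤ : ℕ∞) fun x : Fin N → Fin d → ℝ =>
      ∑ i, ∑ j, (2 * π * (k i j : ℝ)) * x i j :=
    ContDiff.sum fun i _ => ContDiff.sum fun j _ => by fun_prop
  exact ((Complex.ofRealCLM.contDiff.comp h).mul contDiff_const).cexp

lemma continuous_wave (k : Fin N → Fin d → ℤ) :
    Continuous (wave k : (Fin N → Fin d → ℝ) → ℂ) := (contDiff_wave k).continuous

lemma periodic_wave (k : Fin N → Fin d → ℤ) :
    PeriodicFn (wave k : (Fin N → Fin d → ℝ) → ℂ) := by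
  intro x m
  rw [wave, wave, Complex.exp_eq_exp_iff_exists_int]
  refine ⟨∑ i, ∑ j, k i j * m i j, ?_⟩
  push_cast
  rw [Finset.sum_mul, Finset.mul_sum, Finset.mul_sum, ← Finset.sum_add_distrib]
  refine Finset.sum_congr rfl fun i _ => ?_
  rw [Finset.sum_mul, Finset.mul_sum, Finset.mul_sum, ← Finset.sum_add_distrib]
  refine Finset.sum_congr rfl fun j _ => ?_
  ring

lemma coef_eq_mFourierCoeff {F : (Fin N → Fin d → ℝ) → ℂ}
    (k : Fin N → Fin d → ℤ) :
    coef F k = UnitAddTorus.mFourierCoeff (torusLift F) (fun ij => k ij.1 ij.2) := by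
  rw [coef, integral_boxN_eq, UnitAddTorus.mFourierCoeff]
  congr 1
  funext y
  simp only [torusLift, smul_eq_mul]
  congr 1
  have hy : y = fun ij : Fin N × Fin d =>
      (((fun i j => (AddCircle.equivIoc (1 : ℝ) 0 (y (i, j)) : ℝ)) ij.1 ij.2 : ℝ)
        : UnitAddCircle) := by
    funext ij
    exact AddCircle.coe_equivIoc.symm
  conv_rhs => rw [hy]
  simp only [UnitAddTorus.mFourier, ContinuousMap.coe_mk, fourier_coe_apply, wave]
  rw [← Complex.exp_sum, Fintype.sum_prod_type, Complex.ofReal_sum, Finset.mul_sum]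
  congr 1
  refine Finset.sum_congr rfl fun i _ => ?_
  rw [Complex.ofReal_sum, Finset.mul_sum]
  refine Finset.sum_congr rfl fun j _ => ?_
  simp only [Pi.neg_apply]
  push_cast
  ring

/-- Parseval's identity on the box. -/
lemma hasSum_norm_coef_sq {F : (Fin N → Fin d → ℝ) → ℂ} (hF : PeriodicFn F)
    (hc : Continuous F) : HasSum (fun k => ‖coef F k‖ ^ 2) (∫ x in boxN d N, ‖F x‖ ^ 2) := by
  let G : C(UnitAddTorus (Fin N × Fin d), ℂ) := ⟨torusLift F, continuous_torusLift hF hc⟩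
  have h := UnitAddTorus.hasSum_sq_mFourierCoeff (ContinuousMap.toLp 2 volume ℂ G)
  simp only [UnitAddTorus.mFourierCoeff_toLp] at h
  have h1 : ∫ y, ‖(ContinuousMap.toLp 2 volume ℂ G) y‖ ^ 2 = ∫ x in boxN d N, ‖F x‖ ^ 2 := by
    rw [integral_boxN_eq]
    refine integral_congr_ae ?_
    filter_upwards [ContinuousMap.coeFn_toLp (p := 2) (𝕜 := ℂ) volume G] with y hy
    rw [hy]; rfl
  rw [h1] at h
  refine ((Equiv.curry (Fin N) (Fin d) ℤ).hasSum_iff).mp ?_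
  convert h using 1
  funext n
  simp only [Function.comp_apply, coef_eq_mFourierCoeff]
  rfl

end Torus

section Parts

variable {d N : ℕ} {E : Type*} [NormedAddCommGroup E] [NormedSpace ℝ E]

lemma periodicFn_fderiv {F : (Fin N → Fin d → ℝ) → E} (hF : PeriodicFn F) :
    PeriodicFn (fderiv ℝ F) := by
  intro x k
  have h : (fun y => F (y + fun i j => (k i j : ℝ))) = F := funext fun y => hF y k
  conv_rhs => rw [← h]
  rw [fderiv_comp_add_right]
  rfl

lemma PeriodicFn.comp {E' : Type*} {F : (Fin N → Fin d → ℝ) → E} (hF : PeriodicFn F) (g : E → E') :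
    PeriodicFn (fun x => g (F x)) := fun x k => congrArg g (hF x k)

lemma PeriodicFn.mul {F G : (Fin N → Fin d → ℝ) → ℂ} (hF : PeriodicFn F) (hG : PeriodicFn G) :
    PeriodicFn (fun x => F x * G x) := fun x k => by
  simp only; rw [hF x k, hG x k]

lemma PeriodicFn.sum {α : Type*} {s : Finset α} {F : α → (Fin N → Fin d → ℝ) → ℂ}
    (hF : ∀ a ∈ s, PeriodicFn (F a)) : PeriodicFn (fun x => ∑ a ∈ s, F a x) := fun x k =>
  Finset.sum_congr rfl fun a ha => hF a ha x k

/-- Integration by parts: the integral of a partial derivative of a periodic function vanishes. -/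
lemma integral_fderiv_eq_zero [CompleteSpace E] {F : (Fin N → Fin d → ℝ) → E}
    (hF : PeriodicFn F) (hc : ContDiff ℝ 1 F) (i : Fin N) (j : Fin d) :
    ∫ x in boxN d N, fderiv ℝ F x (dir d N i j) = 0 := by
  set e := dir d N i j with he
  have hcont : Continuous (fderiv ℝ F) := hc.continuous_fderiv one_ne_zero
  have hper : PeriodicFn (fun x => fderiv ℝ F x e) :=
    (periodicFn_fderiv hF).comp fun L => L e
  have h1 : ∀ x, ∫ s in (0 : ℝ)..1, fderiv ℝ F (s • e + x) e = 0 := by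
    intro x
    have hd : ∀ s ∈ Set.uIcc (0 : ℝ) 1,
        HasDerivAt (fun s : ℝ => F (s • e + x)) (fderiv ℝ F (s • e + x) e) s := by
      intro s _
      have h2 : HasDerivAt (fun s : ℝ => s • e + x) e s := by
        simpa using ((hasDerivAt_id s).smul_const e).add_const x
      exact ((hc.differentiable one_ne_zero).differentiableAt.hasFDerivAt).comp_hasDerivAt s h2
    rw [intervalIntegral.integral_eq_sub_of_hasDerivAt hd]
    · have h3 := hF x (Pi.single i (Pi.single j 1))
      have h4 : (fun a b => x a b + (((Pi.single i (Pi.single j 1) :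
          Fin N → Fin d → ℤ) a b : ℤ) : ℝ)) = (1 : ℝ) • e + x := by
        funext a b
        rw [one_smul, he, dir, add_comm]
        simp only [Pi.add_apply]
        congr 1
        by_cases hi : a = i
        · subst hi
          by_cases hj : b = j
          · subst hj; simp
          · simp [hj]
        · simp [hi]
      rw [h4] at h3
      rw [h3, zero_smul, zero_add, sub_self]
    · apply Continuous.intervalIntegrable
      fun_prop
  have h5 : ∫ x in boxN d N, ∫ s in Set.Ioc (0 : ℝ) 1, fderiv ℝ F (s • e + x) e = 0 := by
    have : ∀ x, ∫ s in Set.Ioc (0 : ℝ) 1, fderiv ℝ F (s • e + x) e = 0 := fun x => by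
      rw [← intervalIntegral.integral_of_le zero_le_one, h1]
    simp [this]
  rw [integral_integral_swap] at h5
  · have h6 : ∀ s : ℝ, ∫ x in boxN d N, fderiv ℝ F (s • e + x) e =
        ∫ x in boxN d N, fderiv ℝ F x e := fun s => integral_boxN_translate hper (s • e)
    simpa [h6] using h5
  · rw [Measure.prod_restrict]
    have : IntegrableOn (Function.uncurry fun x (s : ℝ) => fderiv ℝ F (s • e + x) e)
        (boxN d N ×ˢ Set.Icc (0 : ℝ) 1) (volume.prod volume) := by
      refine ContinuousOn.integrableOn_compact (isCompact_boxN.prod isCompact_Icc) ?_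
      refine Continuous.continuousOn ?_
      simp only [Function.uncurry_def]
      fun_prop
    exact this.mono_set (Set.prod_mono le_rfl Set.Ioc_subset_Icc_self)

lemma sum_mul_dir (g : Fin N → Fin d → ℝ) (i : Fin N) (j : Fin d) :
    ∑ a, ∑ b, g a b * dir d N i j a b = g i j := by
  rw [Finset.sum_eq_single i, Finset.sum_eq_single j]
  · simp [dir]
  · intro b _ hb; simp [dir, hb]
  · simp
  · intro b _ hb; simp [dir, hb]
  · simp

lemma fderiv_wave (k : Fin N → Fin d → ℤ) (x : Fin N → Fin d → ℝ) (i : Fin N) (j : Fin d) :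
    fderiv ℝ (wave k) x (dir d N i j) = Complex.I * (2 * π * (k i j : ℝ) : ℝ) * wave k x := by
  have hd : DifferentiableAt ℝ (wave k) x :=
    ((contDiff_wave k).differentiable (by simp)).differentiableAt
  rw [← hd.lineDeriv_eq_fderiv]
  refine HasLineDerivAt.lineDeriv ?_
  have h1 : ∀ t : ℝ, wave k (x + t • dir d N i j) =
      Complex.exp (Complex.I * (2 * π * (k i j : ℝ) : ℝ) * t) * wave k x := by
    intro t
    rw [wave, wave, ← Complex.exp_add]
    congr 1
    rw [mul_assoc, ← mul_add, ← Complex.ofReal_mul, ← Complex.ofReal_add]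
    congr 2
    have := sum_mul_dir (fun a b => 2 * π * (k a b : ℝ)) i j
    rw [← this, Finset.sum_mul, ← Finset.sum_add_distrib]
    refine Finset.sum_congr rfl fun a _ => ?_
    rw [Finset.sum_mul, ← Finset.sum_add_distrib]
    refine Finset.sum_congr rfl fun b _ => ?_
    simp only [Pi.add_apply, Pi.smul_apply, smul_eq_mul]
    ring
  rw [HasLineDerivAt]
  simp only [h1]
  have h2 : HasDerivAt (fun t : ℝ => Complex.I * (2 * π * (k i j : ℝ) : ℝ) * (t : ℂ))
      (Complex.I * (2 * π * (k i j : ℝ) : ℝ)) 0 := by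
    simpa using (Complex.ofRealCLM.hasDerivAt (x := (0 : ℝ))).const_mul
      (Complex.I * ((2 * π * (k i j : ℝ) : ℝ) : ℂ))
  have h3 := (h2.cexp).mul_const (wave k x)
  simpa using h3

lemma coef_fderiv {F : (Fin N → Fin d → ℝ) → ℂ} (hF : PeriodicFn F) (hc : ContDiff ℝ 1 F)
    (k : Fin N → Fin d → ℤ) (i : Fin N) (j : Fin d) :
    coef (fun x => fderiv ℝ F x (dir d N i j)) k =
      Complex.I * (2 * π * (k i j : ℝ) : ℝ) * coef F k := by
  have h0 := integral_fderiv_eq_zero ((periodic_wave (-k)).mul hF)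
    (((contDiff_wave (-k)).of_le (by norm_cast)).mul hc) i j
  have h1 : ∀ x, fderiv ℝ (fun x => wave (-k) x * F x) x (dir d N i j) =
      wave (-k) x * fderiv ℝ F x (dir d N i j) -
        Complex.I * (2 * π * (k i j : ℝ) : ℝ) * (wave (-k) x * F x) := by
    intro x
    rw [fderiv_fun_mul ((contDiff_wave (-k)).differentiable (by simp)).differentiableAt
      (hc.differentiable one_ne_zero).differentiableAt]
    simp only [_root_.add_apply, _root_.smul_apply, smul_eq_mul,
      fderiv_wave, Pi.neg_apply]
    push_cast; ring
  simp only [h1] at h0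
  have hcf : Continuous (fderiv ℝ F) := hc.continuous_fderiv one_ne_zero
  have hw := continuous_wave (-k)
  have hF' := hc.continuous
  rw [integral_sub, sub_eq_zero, integral_const_mul] at h0
  · exact h0
  · exact integrableOn_boxN (by fun_prop)
  · exact integrableOn_boxN (by fun_prop)

end Parts

section Density

variable {d N : ℕ}

/-- The Fourier transform `∑ᵢ e^{ip·xᵢ}` of the particle density. -/
def rho (p : Fin d → ℤ) (x : Fin N → Fin d → ℝ) : ℂ := ∑ i, wave (Pi.single i p) x

lemma continuous_rho (p : Fin d → ℤ) : Continuous (rho p : (Fin N → Fin d → ℝ) → ℂ) :=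
  continuous_finsetSum _ fun _ _ => continuous_wave _

lemma periodic_rho (p : Fin d → ℤ) : PeriodicFn (rho p : (Fin N → Fin d → ℝ) → ℂ) :=
  PeriodicFn.sum fun _ _ => periodic_wave _

lemma coef_rho_mul {F : (Fin N → Fin d → ℝ) → ℂ} (hc : Continuous F) (p : Fin d → ℤ)
    (k : Fin N → Fin d → ℤ) :
    coef (fun x => rho p x * F x) k = ∑ i, coef F (Function.update k i (k i - p)) := by
  have h : ∀ x, wave (-k) x * (rho p x * F x) =
      ∑ i, wave (-(Function.update k i (k i - p))) x * F x := by
    intro x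
    rw [rho, ← mul_assoc, Finset.mul_sum, Finset.sum_mul]
    refine Finset.sum_congr rfl fun i _ => ?_
    rw [← wave_add]
    congr 2
    funext i'
    by_cases hi : i' = i
    · subst hi; simp; abel
    · simp [hi]
  simp only [coef, h]
  rw [integral_finsetSum]
  intro i _
  have hw := continuous_wave (d := d) (-(Function.update k i (k i - p)))
  exact integrableOn_boxN (by fun_prop)

lemma coef_comp_perm {F : (Fin N → Fin d → ℝ) → ℂ} (hF : SymmetricWF d N F)
    (σ : Equiv.Perm (Fin N)) (k : Fin N → Fin d → ℤ) :
    coef F (fun i => k (σ i)) = coef F k := by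
  rw [coef, coef, ← (volume_measurePreserving_piCongrLeft (fun _ => Fin d → ℝ)
    σ.symm).setIntegral_preimage_emb (MeasurableEquiv.measurableEmbedding _)]
  have hx : ∀ x : Fin N → Fin d → ℝ,
      MeasurableEquiv.piCongrLeft (fun _ => Fin d → ℝ) σ.symm x = fun i => x (σ i) := by
    intro x; funext i
    simp [MeasurableEquiv.piCongrLeft, Equiv.piCongrLeft, Equiv.piCongrLeft']
  have hs : (MeasurableEquiv.piCongrLeft (fun _ => Fin d → ℝ) σ.symm) ⁻¹' boxN d N =
      boxN d N := by
    ext x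
    simp only [Set.mem_preimage, hx, boxN, Set.mem_univ_pi]
    exact ⟨fun h i => by simpa using h (σ.symm i), fun h i => h (σ i)⟩
  rw [hs]
  refine setIntegral_congr_fun measurableSet_boxN fun x _ => ?_
  simp only [hx, hF σ x]
  congr 1
  rw [wave, wave]
  congr 3
  exact Equiv.sum_comp σ fun i => ∑ j, 2 * π * ((-k i j : ℤ) : ℝ) * x i j

lemma sum_eq_of_coef_ne_zero {F : (Fin N → Fin d → ℝ) → ℂ} {P : Fin d → ℤ}
    (hF : PeriodicFn F) (hP : MomentumWF d N P F) {k : Fin N → Fin d → ℤ} (hk : coef F k ≠ 0) :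
    ∑ i, k i = P := by
  by_contra hne
  obtain ⟨j, hj⟩ := Function.ne_iff.mp hne
  rw [Finset.sum_apply] at hj
  set n : ℤ := P j - ∑ i, k i j with hn
  have hn0 : (n : ℝ) ≠ 0 := by
    have : n ≠ 0 := fun h => hj (by omega)
    exact_mod_cast this
  set t : Fin d → ℝ := Pi.single j (1 / (2 * (n : ℝ))) with ht
  have h1 := integral_boxN_translate ((periodic_wave (-k)).mul hF) (fun _ => t)
  have h2 : ∀ x : Fin N → Fin d → ℝ, wave (-k) ((fun _ => t) + x) * F ((fun _ => t) + x) =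
      -1 * (wave (-k) x * F x) := by
    intro x
    have h3 := hP t x
    have h4 : (fun i => x i + t) = (fun _ => t) + x := by
      funext i; rw [add_comm]; rfl
    have h5 : wave (-k) ((fun _ => t) + x) =
        Complex.exp (Complex.I * ((-(∑ i, k i j : ℤ) * (2 * π * t j) : ℝ) : ℂ)) * wave (-k) x := by
      rw [wave, wave, ← Complex.exp_add, ← mul_add, ← Complex.ofReal_add]
      congr 3
      have h6 : ∀ i,
          ∑ j', 2 * π * (((-k) i j' : ℤ) : ℝ) * ((fun _ => t : Fin N → Fin d → ℝ) + x) i j' =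
          -(k i j : ℝ) * (2 * π * t j) + ∑ j', 2 * π * (((-k) i j' : ℤ) : ℝ) * x i j' := by
        intro i
        simp only [Pi.add_apply, mul_add, Finset.sum_add_distrib]
        congr 1
        rw [Finset.sum_eq_single j]
        · simp only [Pi.neg_apply]; push_cast; ring
        · intro b _ hb; simp [ht, hb]
        · simp
      simp only [h6, Finset.sum_add_distrib]
      congr 1
      push_cast
      rw [← Finset.sum_mul, Finset.sum_neg_distrib]
    have h7 : ∑ j', 2 * π * (P j' : ℝ) * t j' = P j * (2 * π * t j) := by
      rw [Finset.sum_eq_single j]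
      · ring
      · intro b _ hb; simp [ht, hb]
      · simp
    rw [← h4, h3, h4, h5, h7]
    have h8 : Complex.exp (Complex.I * ((-(∑ i, k i j : ℤ) * (2 * π * t j) : ℝ) : ℂ)) *
        Complex.exp (Complex.I * ((P j * (2 * π * t j) : ℝ) : ℂ)) = -1 := by
      rw [← Complex.exp_add, ← mul_add, ← Complex.ofReal_add, ← Complex.exp_pi_mul_I, mul_comm]
      congr 3
      have : (-(∑ i, k i j : ℤ) * (2 * π * t j) + P j * (2 * π * t j) : ℝ) = n * (2 * π * t j) := by
        rw [hn]; push_cast; ring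
      rw [this, ht]
      simp only [Pi.single_eq_same]
      field_simp
    linear_combination (wave (-k) x * F x) * h8
  simp only [h2] at h1
  rw [integral_const_mul] at h1
  apply hk
  rw [coef]
  linear_combination (-1 / 2 : ℂ) * h1

end Density

section Truncation

variable {d N : ℕ}

/-- The cube of momenta with all coordinates at most `n` in absolute value. -/
def momentumCube (d N n : ℕ) : Finset (Fin N → Fin d → ℤ) :=
  Fintype.piFinset fun _ => Fintype.piFinset fun _ => Finset.Icc (-(n : ℤ)) n

lemma mem_momentumCube {n : ℕ} {k : Fin N → Fin d → ℤ} :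
    k ∈ momentumCube d N n ↔ ∀ i j, -(n : ℤ) ≤ k i j ∧ k i j ≤ n := by
  simp [momentumCube, Fintype.mem_piFinset]

lemma eventually_mem_momentumCube (k : Fin N → Fin d → ℤ) :
    ∀ᶠ n in Filter.atTop, k ∈ momentumCube d N n := by
  filter_upwards [Filter.eventually_ge_atTop (∑ i, ∑ j, (k i j).natAbs)] with n hn
  rw [mem_momentumCube]
  intro i j
  have h1 : (k i j).natAbs ≤ ∑ j, (k i j).natAbs :=
    Finset.single_le_sum (f := fun j => (k i j).natAbs) (fun _ _ => Nat.zero_le _)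
      (Finset.mem_univ j)
  have h2 : ∑ j, (k i j).natAbs ≤ ∑ i, ∑ j, (k i j).natAbs :=
    Finset.single_le_sum (f := fun i => ∑ j, (k i j).natAbs) (fun _ _ => Nat.zero_le _)
      (Finset.mem_univ i)
  omega

/-- Truncation of a coefficient family to a cube. -/
def truncCoef (Θ : (Fin N → Fin d → ℤ) → ℂ) (n : ℕ) : (Fin N → Fin d → ℤ) →₀ ℂ :=
  Finsupp.onFinset (momentumCube d N n) (fun k => if k ∈ momentumCube d N n then Θ k else 0)
    fun k hk => by
      by_contra h
      simp [h] at hk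

lemma truncCoef_apply (Θ : (Fin N → Fin d → ℤ) → ℂ) (n : ℕ) (k : Fin N → Fin d → ℤ) :
    truncCoef Θ n k = if k ∈ momentumCube d N n then Θ k else 0 := rfl

lemma norm_truncCoef_le (Θ : (Fin N → Fin d → ℤ) → ℂ) (n : ℕ) (k : Fin N → Fin d → ℤ) :
    ‖truncCoef Θ n k‖ ≤ ‖Θ k‖ := by
  rw [truncCoef_apply]; split_ifs <;> simp

lemma tendsto_truncCoef (Θ : (Fin N → Fin d → ℤ) → ℂ) (k : Fin N → Fin d → ℤ) :
    Filter.Tendsto (fun n => truncCoef Θ n k) Filter.atTop (nhds (Θ k)) := by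
  refine tendsto_const_nhds.congr' ?_
  filter_upwards [eventually_mem_momentumCube k] with n hn
  rw [truncCoef_apply, if_pos hn]

lemma ev_eq_tsum {ι : Type*} (m : ι → ℝ) (f : ι →₀ ℂ) : ev m f = ∑' k, m k * ‖f k‖ ^ 2 := by
  rw [ev, Finsupp.sum, tsum_eq_sum]
  intro k hk
  simp [Finsupp.notMem_support_iff.mp hk]

lemma norm_sq_eq_tsum {ι : Type*} (f : ι →₀ ℂ) : ‖f‖ ^ 2 = ∑' k, ‖f k‖ ^ 2 := by
  rw [← ev_one, ev_eq_tsum]; simp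

lemma tendsto_norm_truncCoef_sq {Θ : (Fin N → Fin d → ℤ) → ℂ}
    (hΘ : Summable fun k => ‖Θ k‖ ^ 2) :
    Filter.Tendsto (fun n => ‖truncCoef Θ n‖ ^ 2) Filter.atTop (nhds (∑' k, ‖Θ k‖ ^ 2)) := by
  simp only [norm_sq_eq_tsum]
  refine tendsto_tsum_of_dominated_convergence hΘ
    (fun k => ((tendsto_truncCoef Θ k).norm).pow 2) (Filter.Eventually.of_forall fun n k => ?_)
  rw [Real.norm_of_nonneg (by positivity)]
  gcongr
  exact norm_truncCoef_le Θ n k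

lemma tendsto_norm_density_truncCoef_sq {Θ : (Fin N → Fin d → ℤ) → ℂ}
    (hΘ : Summable fun k => ‖Θ k‖ ^ 2) (p : Fin d → ℤ) :
    Filter.Tendsto (fun n => ‖density p (truncCoef Θ n)‖ ^ 2) Filter.atTop
      (nhds (∑' k, ‖∑ i, Θ (Function.update k i (k i - p))‖ ^ 2)) := by
  simp only [norm_sq_eq_tsum]
  have hd : ∀ (f : (Fin N → Fin d → ℤ) →₀ ℂ) k,
      density p f k = ∑ i, f (Function.update k i (k i - p)) := by
    intro f k
    simp only [density, LinearMap.sum_apply, Finsupp.finsetSum_apply, shiftOp_apply]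
  simp only [hd]
  have hinj : ∀ i : Fin N, Function.Injective
      fun k : Fin N → Fin d → ℤ => Function.update k i (k i - p) := by
    intro i k l hkl
    funext i'
    have h := congrFun hkl i'
    by_cases hi : i' = i
    · subst hi; simpa using h
    · simpa [hi] using h
  refine tendsto_tsum_of_dominated_convergence
    (bound := fun k => N * ∑ i, ‖Θ (Function.update k i (k i - p))‖ ^ 2) ?_
    (fun k => ((tendsto_finsetSum _ fun i _ => tendsto_truncCoef Θ _).norm).pow 2)
    (Filter.Eventually.of_forall fun n k => ?_)
  · refine Summable.mul_left _ (summable_sum fun i _ => ?_)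
    exact hΘ.comp_injective (hinj i)
  · rw [Real.norm_of_nonneg (by positivity)]
    refine (norm_sum_sq_le _).trans ?_
    rw [Fintype.card_fin]
    gcongr with i
    exact norm_truncCoef_le Θ n _

lemma norm_I_mul_ofReal_mul_sq (t : ℝ) (z : ℂ) : ‖Complex.I * (t : ℂ) * z‖ ^ 2 = t ^ 2 * ‖z‖ ^ 2 := by
  rw [norm_mul, norm_mul, Complex.norm_I, Complex.norm_real, one_mul, mul_pow, Real.norm_eq_abs,
    sq_abs]

/-- Plancherel formula for the kinetic energy. -/
lemma hasSum_kineticEnergy {Ψ : (Fin N → Fin d → ℝ) → ℂ} (hp : PeriodicFn Ψ)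
    (hc : ContDiff ℝ 1 Ψ) :
    HasSum (fun k => (∑ i, pSq d (k i)) * ‖coef Ψ k‖ ^ 2) (kineticEnergy d N Ψ) := by
  have hcf : Continuous (fderiv ℝ Ψ) := hc.continuous_fderiv one_ne_zero
  have h : ∀ i j, HasSum (fun k => (2 * π * (k i j : ℝ)) ^ 2 * ‖coef Ψ k‖ ^ 2)
      (∫ x in boxN d N, ‖fderiv ℝ Ψ x (dir d N i j)‖ ^ 2) := by
    intro i j
    have h1 := hasSum_norm_coef_sq ((periodicFn_fderiv hp).comp fun L => L (dir d N i j))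
      (by fun_prop)
    refine h1.congr_fun fun k => ?_
    rw [coef_fderiv hp hc, norm_I_mul_ofReal_mul_sq]
  have h2 := hasSum_sum (s := Finset.univ) fun i _ => hasSum_sum (s := Finset.univ)
    fun j _ => h i j
  have h3 : kineticEnergy d N Ψ = ∑ i, ∑ j,
      ∫ x in boxN d N, ‖fderiv ℝ Ψ x (dir d N i j)‖ ^ 2 := by
    refine Finset.sum_congr rfl fun i _ => ?_
    rw [integral_finsetSum]
    intro j _
    exact integrableOn_boxN (by fun_prop)
  rw [h3]
  refine h2.congr_fun fun k => ?_
  rw [Finset.sum_mul]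
  refine Finset.sum_congr rfl fun i _ => ?_
  rw [pSq, Finset.sum_mul]

lemma tsum_norm_coef_rho_mul {Ψ : (Fin N → Fin d → ℝ) → ℂ} (hp : PeriodicFn Ψ)
    (hc : Continuous Ψ) (p : Fin d → ℤ) :
    ∑' k, ‖∑ i, coef Ψ (Function.update k i (k i - p))‖ ^ 2 =
      ∫ x in boxN d N, ‖rho p x‖ ^ 2 * ‖Ψ x‖ ^ 2 := by
  have hr := continuous_rho (d := d) (N := N) p
  have h := hasSum_norm_coef_sq ((periodic_rho p).mul hp) (by fun_prop)
  simp only [coef_rho_mul hc, norm_mul, mul_pow] at h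
  exact h.tsum_eq

/-- A lower bound on the truncated quadratic form passes to wave functions. -/
lemma le_of_hamForm_ge {Ψ : (Fin N → Fin d → ℝ) → ℂ} (hp : PeriodicFn Ψ) (hc : ContDiff ℝ 1 Ψ)
    (hs : SymmetricWF d N Ψ) {S : Finset (Fin d → ℤ)} {w : (Fin d → ℤ) → ℝ} {K : ℝ}
    (hK : ∀ f : (Fin N → Fin d → ℤ) →₀ ℂ, SymmState f → (∀ k, f k ≠ 0 → coef Ψ k ≠ 0) →
      K * ‖f‖ ^ 2 ≤ hamForm (pSq d) w S f) :
    K * ∫ x in boxN d N, ‖Ψ x‖ ^ 2 ≤ kineticEnergy d N Ψ +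
      ∑ p ∈ S, w p * ∫ x in boxN d N, ‖rho p x‖ ^ 2 * ‖Ψ x‖ ^ 2 := by
  have hP := hasSum_norm_coef_sq hp hc.continuous
  have h1 := tendsto_norm_truncCoef_sq hP.summable
  rw [hP.tsum_eq] at h1
  have h2 : Filter.Tendsto (fun n => kineticEnergy d N Ψ +
      ∑ p ∈ S, w p * ‖density p (truncCoef (coef Ψ) n)‖ ^ 2) Filter.atTop
      (nhds (kineticEnergy d N Ψ +
        ∑ p ∈ S, w p * ∫ x in boxN d N, ‖rho p x‖ ^ 2 * ‖Ψ x‖ ^ 2)) := by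
    refine tendsto_const_nhds.add (tendsto_finsetSum _ fun p _ => ?_)
    have h3 := tendsto_norm_density_truncCoef_sq hP.summable p
    rw [tsum_norm_coef_rho_mul hp hc.continuous] at h3
    exact h3.const_mul _
  refine le_of_tendsto_of_tendsto' (h1.const_mul K) h2 fun n => ?_
  have hkin := hasSum_kineticEnergy hp hc
  refine (hK _ ?_ ?_).trans ?_
  · intro σ k
    have hmem : (fun i => k (σ i)) ∈ momentumCube d N n ↔ k ∈ momentumCube d N n := by
      simp only [mem_momentumCube]
      exact ⟨fun h i j => by simpa using h (σ.symm i) j, fun h i j => h (σ i) j⟩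
    simp only [truncCoef_apply, hmem, coef_comp_perm hs]
  · intro k hk
    rw [truncCoef_apply] at hk
    split_ifs at hk with h
    · exact hk
    · exact absurd rfl hk
  · rw [hamForm]
    refine add_le_add ?_ le_rfl
    rw [ev, Finsupp.sum]
    refine le_trans (Finset.sum_le_sum fun k _ => ?_)
      (sum_le_hasSum (truncCoef (coef Ψ) n).support (fun k _ => ?_) hkin)
    · have : 0 ≤ ∑ i, pSq d (k i) :=
        Finset.sum_nonneg fun i _ => Finset.sum_nonneg fun j _ => sq_nonneg _
      gcongr
      exact norm_truncCoef_le _ n k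
    · exact mul_nonneg (Finset.sum_nonneg fun i _ => Finset.sum_nonneg fun j _ => sq_nonneg _)
        (sq_nonneg _)

end Truncation

section Potential

variable {d N : ℕ}

lemma wave_single (i : Fin N) (p : Fin d → ℤ) (x : Fin N → Fin d → ℝ) :
    wave (Pi.single i p) x = Complex.exp (Complex.I * ∑ j, (2 * π * (p j : ℝ)) * x i j) := by
  rw [wave]
  congr 3
  rw [Finset.sum_eq_single i]
  · simp
  · intro b _ hb; simp [hb]
  · simp

lemma conj_wave (k : Fin N → Fin d → ℤ) (x : Fin N → Fin d → ℝ) :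
    conj (wave k x) = wave (-k) x := by
  rw [wave, wave, ← Complex.exp_conj, map_mul, Complex.conj_I, Complex.conj_ofReal, neg_mul,
    ← mul_neg, ← Complex.ofReal_neg, ← Finset.sum_neg_distrib]
  congr 3
  refine Finset.sum_congr rfl fun i _ => ?_
  rw [← Finset.sum_neg_distrib]
  refine Finset.sum_congr rfl fun j _ => ?_
  simp only [Pi.neg_apply]; push_cast; ring

lemma conj_rho (p : Fin d → ℤ) (x : Fin N → Fin d → ℝ) : conj (rho p x) = rho (-p) x := by
  simp only [rho, map_sum, conj_wave, Pi.single_neg]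

lemma norm_rho_le (p : Fin d → ℤ) (x : Fin N → Fin d → ℝ) : ‖rho p x‖ ≤ N := by
  refine (norm_sum_le _ _).trans ?_
  simp [norm_wave]

lemma rho_zero (x : Fin N → Fin d → ℝ) : rho 0 x = N := by
  simp [rho, wave]

lemma ofReal_norm_rho_sq (p : Fin d → ℤ) (x : Fin N → Fin d → ℝ) :
    ((‖rho p x‖ ^ 2 : ℝ) : ℂ) = rho p x * rho (-p) x := by
  rw [← conj_rho, Complex.mul_conj, Complex.normSq_eq_norm_sq]

lemma norm_rho_neg (p : Fin d → ℤ) (x : Fin N → Fin d → ℝ) : ‖rho (-p) x‖ = ‖rho p x‖ := by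
  rw [← conj_rho, RCLike.norm_conj]

/-- The interaction, summed over pairs. -/
def pairSum (v : (Fin d → ℝ) → ℝ) (x : Fin N → Fin d → ℝ) : ℝ :=
  ∑ i, ∑ j, if i < j then v (x i - x j) else 0

lemma hasSum_norm_rho_sq {v : (Fin d → ℝ) → ℝ} {vhat : (Fin d → ℤ) → ℝ}
    (hv : PotentialAssumptions d v vhat) (x : Fin N → Fin d → ℝ) :
    HasSum (fun p => vhat p * ‖rho p x‖ ^ 2) (∑ i, ∑ j, v (x i - x j)) := by
  have h1 : ∀ y : Fin d → ℝ, HasSum (fun k : Fin d → ℤ => (vhat k : ℂ) *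
      Complex.exp (Complex.I * ∑ j, (2 * π * (k j : ℝ)) * y j)) (v y) := by
    intro y
    rw [hv.expansion y]
    refine Summable.hasSum (Summable.of_norm ?_)
    refine hv.summable.congr fun k => ?_
    rw [norm_mul, mul_comm Complex.I, Complex.norm_exp_ofReal_mul_I, mul_one, Complex.norm_real,
      Real.norm_of_nonneg (hv.nonneg k)]
  have h2 := hasSum_sum (s := Finset.univ) fun (i : Fin N) _ =>
    hasSum_sum (s := Finset.univ) fun (j : Fin N) _ => h1 (x i - x j)
  have h3 : (∑ i, ∑ j, (v (x i - x j) : ℂ)) = ((∑ i, ∑ j, v (x i - x j) : ℝ) : ℂ) := by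
    push_cast; rfl
  rw [h3] at h2
  rw [← Complex.hasSum_ofReal]
  refine h2.congr_fun fun p => ?_
  rw [Complex.ofReal_mul, ofReal_norm_rho_sq, rho, rho, Finset.sum_mul_sum, Finset.mul_sum]
  refine Finset.sum_congr rfl fun i _ => ?_
  rw [Finset.mul_sum]
  refine Finset.sum_congr rfl fun j _ => ?_
  congr 1
  rw [wave_single, wave_single, ← Complex.exp_add, ← mul_add, ← Complex.ofReal_add,
    ← Finset.sum_add_distrib]
  congr 3
  refine Finset.sum_congr rfl fun l _ => ?_
  simp only [Pi.neg_apply, Pi.sub_apply]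
  push_cast; ring

lemma apply_zero_eq_tsum {v : (Fin d → ℝ) → ℝ} {vhat : (Fin d → ℤ) → ℝ}
    (hv : PotentialAssumptions d v vhat) : v 0 = ∑' p, vhat p := by
  have := hv.expansion 0
  simp only [Pi.zero_apply, mul_zero, Finset.sum_const_zero, Complex.ofReal_zero,
    Complex.exp_zero, mul_one] at this
  exact_mod_cast this

lemma pairSum_eq {v : (Fin d → ℝ) → ℝ} (he : ∀ x, v (-x) = v x) (x : Fin N → Fin d → ℝ) :
    ∑ i, ∑ j, v (x i - x j) = 2 * pairSum v x + N * v 0 := by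
  have h1 : ∀ i j : Fin N, v (x i - x j) = (if i < j then v (x i - x j) else 0) +
      (if j < i then v (x j - x i) else 0) + (if i = j then v 0 else 0) := by
    intro i j
    rcases lt_trichotomy i j with h | h | h
    · simp [h, h.ne, h.not_gt]
    · subst h; simp
    · simp only [h, h.ne', h.not_gt, if_true, if_false, zero_add, add_zero]
      rw [← he (x i - x j), neg_sub]
  rw [Finset.sum_congr rfl fun i _ => Finset.sum_congr rfl fun j _ => h1 i j]
  simp only [Finset.sum_add_distrib]
  rw [Finset.sum_comm (f := fun i j => if j < i then v (x j - x i) else 0), pairSum]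
  have : ∑ i : Fin N, ∑ j : Fin N, (if i = j then v 0 else 0) = N * v 0 := by simp
  rw [this]
  ring

variable {v : (Fin d → ℝ) → ℝ} {vhat : (Fin d → ℤ) → ℝ}

/-- The total weight of the nonzero modes outside `S`. -/
def tailSum (vhat : (Fin d → ℤ) → ℝ) (S : Finset (Fin d → ℤ)) : ℝ :=
  ∑' p, vhat p - vhat 0 - ∑ p ∈ S, vhat p

lemma tailSum_nonneg (hv : PotentialAssumptions d v vhat) {S : Finset (Fin d → ℤ)}
    (hS : (0 : Fin d → ℤ) ∉ S) : 0 ≤ tailSum vhat S := by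
  have := hv.summable.sum_le_tsum (insert 0 S) fun p _ => hv.nonneg p
  rw [Finset.sum_insert hS] at this
  rw [tailSum]; linarith

lemma pairSum_ge (hv : PotentialAssumptions d v vhat) {S : Finset (Fin d → ℤ)}
    (hS : (0 : Fin d → ℤ) ∉ S) (x : Fin N → Fin d → ℝ) :
    (1 / 2) * (vhat 0 * (N ^ 2 - N) + ∑ p ∈ S, vhat p * ‖rho p x‖ ^ 2 -
      N * (∑ p ∈ S, vhat p + tailSum vhat S)) ≤ pairSum v x := by
  have h1 := sum_le_hasSum (insert 0 S) (fun p _ => mul_nonneg (hv.nonneg p) (sq_nonneg _))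
    (hasSum_norm_rho_sq hv x)
  rw [pairSum_eq hv.even, apply_zero_eq_tsum hv, Finset.sum_insert hS, rho_zero,
    Complex.norm_natCast] at h1
  rw [tailSum]
  linarith

lemma pairSum_le (hv : PotentialAssumptions d v vhat) {S : Finset (Fin d → ℤ)}
    (hS : (0 : Fin d → ℤ) ∉ S) (x : Fin N → Fin d → ℝ) :
    pairSum v x ≤ (1 / 2) * (vhat 0 * (N ^ 2 - N) + ∑ p ∈ S, vhat p * ‖rho p x‖ ^ 2 -
      N * ∑ p ∈ S, vhat p + N ^ 2 * tailSum vhat S) := by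
  have h0 := (hv.summable.hasSum.mul_left ((N : ℝ) ^ 2)).sub (hasSum_norm_rho_sq hv x)
  have h1 := sum_le_hasSum (insert 0 S) (fun p _ => ?_) h0
  · rw [pairSum_eq hv.even, apply_zero_eq_tsum hv, Finset.sum_insert hS, rho_zero,
      Complex.norm_natCast, Finset.sum_sub_distrib, ← Finset.mul_sum] at h1
    have h2 : 0 ≤ N * tailSum vhat S := mul_nonneg (by positivity) (tailSum_nonneg hv hS)
    rw [tailSum] at *
    linarith
  · have := pow_le_pow_left₀ (norm_nonneg _) (norm_rho_le p x) 2
    nlinarith [hv.nonneg p]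

lemma continuous_pairSum (hv : Continuous v) :
    Continuous (pairSum v : (Fin N → Fin d → ℝ) → ℝ) := by
  refine continuous_finsetSum _ fun i _ => continuous_finsetSum _ fun j _ => ?_
  split_ifs
  · fun_prop
  · fun_prop

lemma potentialEnergy_eq (hv : Continuous v) {Ψ : (Fin N → Fin d → ℝ) → ℂ} (hc : Continuous Ψ) :
    potentialEnergy d N v Ψ = ((N : ℝ) - 1)⁻¹ * ∫ x in boxN d N, pairSum v x * ‖Ψ x‖ ^ 2 := by
  rw [potentialEnergy]
  congr 1
  simp only [pairSum, Finset.sum_mul]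
  rw [integral_finsetSum]
  · refine Finset.sum_congr rfl fun i _ => ?_
    rw [integral_finsetSum]
    · refine Finset.sum_congr rfl fun j _ => ?_
      split_ifs <;> simp
    · intro j _
      refine integrableOn_boxN ?_
      split_ifs <;> fun_prop
  · intro i _
    refine integrableOn_boxN (continuous_finsetSum _ fun j _ => ?_)
    split_ifs <;> fun_prop

lemma integral_mode_form {Ψ : (Fin N → Fin d → ℝ) → ℂ} (hc : Continuous Ψ)
    (hn : Normalized d N Ψ) (S : Finset (Fin d → ℤ)) (w : (Fin d → ℤ) → ℝ) (α : ℝ) :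
    ∫ x in boxN d N, (1 / 2) * (α + ∑ p ∈ S, w p * ‖rho p x‖ ^ 2) * ‖Ψ x‖ ^ 2 =
      (1 / 2) * (α + ∑ p ∈ S, w p * ∫ x in boxN d N, ‖rho p x‖ ^ 2 * ‖Ψ x‖ ^ 2) := by
  have hr := fun p => continuous_rho (d := d) (N := N) p
  have h1 : ∀ x : Fin N → Fin d → ℝ,
      (1 / 2) * (α + ∑ p ∈ S, w p * ‖rho p x‖ ^ 2) * ‖Ψ x‖ ^ 2 =
      (1 / 2) * α * ‖Ψ x‖ ^ 2 + ∑ p ∈ S, (1 / 2) * w p * (‖rho p x‖ ^ 2 * ‖Ψ x‖ ^ 2) := by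
    intro x
    rw [mul_add, add_mul, Finset.mul_sum, Finset.sum_mul]
    congr 1
    exact Finset.sum_congr rfl fun p _ => by ring
  simp only [h1]
  have hi : ∀ p, IntegrableOn (fun x => (1 / 2) * w p * (‖rho p x‖ ^ 2 * ‖Ψ x‖ ^ 2))
      (boxN d N) := fun p => integrableOn_boxN (by have := hr p; fun_prop)
  rw [integral_add (integrableOn_boxN (by fun_prop)) (integrable_finsetSum _ fun p _ => hi p),
    integral_const_mul, integral_finsetSum _ fun p _ => hi p]
  simp only [integral_const_mul]
  rw [show ∫ x in boxN d N, ‖Ψ x‖ ^ 2 = 1 from hn, mul_add, Finset.mul_sum]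
  congr 1
  · ring
  · exact Finset.sum_congr rfl fun p _ => by ring

/-- The part of the energy carried by the modes in `S`. -/
def modePotential (d N : ℕ) (w : (Fin d → ℤ) → ℝ) (S : Finset (Fin d → ℤ))
    (Ψ : (Fin N → Fin d → ℝ) → ℂ) : ℝ :=
  ∑ p ∈ S, w p * ∫ x in boxN d N, ‖rho p x‖ ^ 2 * ‖Ψ x‖ ^ 2

lemma potentialEnergy_ge (hv : PotentialAssumptions d v vhat) (hN : 2 ≤ N)
    {S : Finset (Fin d → ℤ)} (hS : (0 : Fin d → ℤ) ∉ S) {Ψ : (Fin N → Fin d → ℝ) → ℂ}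
    (hc : Continuous Ψ) (hn : Normalized d N Ψ) :
    N * vhat 0 / 2 - N / (2 * ((N : ℝ) - 1)) * (∑ p ∈ S, vhat p + tailSum vhat S) +
      modePotential d N (fun p => vhat p / (2 * ((N : ℝ) - 1))) S Ψ ≤
      potentialEnergy d N v Ψ := by
  have hN' : (2 : ℝ) ≤ N := by exact_mod_cast hN
  have hN1 : (0 : ℝ) < N - 1 := by linarith
  have hr := fun p => continuous_rho (d := d) (N := N) p
  have hps := continuous_pairSum (d := d) (N := N) hv.continuous
  rw [potentialEnergy_eq hv.continuous hc]
  have h1 := integral_mode_form hc hn S vhat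
    (vhat 0 * (N ^ 2 - N) - N * (∑ p ∈ S, vhat p + tailSum vhat S))
  have h2 := setIntegral_mono_on (μ := volume) (s := boxN d N)
    (f := fun x => (1 / 2) * ((vhat 0 * (N ^ 2 - N) - N * (∑ p ∈ S, vhat p + tailSum vhat S)) +
      ∑ p ∈ S, vhat p * ‖rho p x‖ ^ 2) * ‖Ψ x‖ ^ 2)
    (g := fun x => pairSum v x * ‖Ψ x‖ ^ 2) (integrableOn_boxN (by fun_prop))
    (integrableOn_boxN (by fun_prop)) measurableSet_boxN fun x _ => by
      have := pairSum_ge hv hS x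
      gcongr
      linarith
  rw [h1] at h2
  refine le_trans (le_of_eq ?_) (mul_le_mul_of_nonneg_left h2 (inv_nonneg.mpr hN1.le))
  have h3 : modePotential d N (fun p => vhat p / (2 * ((N : ℝ) - 1))) S Ψ =
      (2 * ((N : ℝ) - 1))⁻¹ *
        ∑ p ∈ S, vhat p * ∫ x in boxN d N, ‖rho p x‖ ^ 2 * ‖Ψ x‖ ^ 2 := by
    rw [modePotential, Finset.mul_sum]
    exact Finset.sum_congr rfl fun p _ => by field_simp
  rw [h3]
  generalize ∑ p ∈ S, vhat p * ∫ x in boxN d N, ‖rho p x‖ ^ 2 * ‖Ψ x‖ ^ 2 = X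
  generalize ∑ p ∈ S, vhat p = Y
  field_simp

lemma potentialEnergy_le (hv : PotentialAssumptions d v vhat) (hN : 2 ≤ N)
    {S : Finset (Fin d → ℤ)} (hS : (0 : Fin d → ℤ) ∉ S) {Ψ : (Fin N → Fin d → ℝ) → ℂ}
    (hc : Continuous Ψ) (hn : Normalized d N Ψ) :
    potentialEnergy d N v Ψ ≤
    N * vhat 0 / 2 - N / (2 * ((N : ℝ) - 1)) * (∑ p ∈ S, vhat p - N * tailSum vhat S) +
      modePotential d N (fun p => vhat p / (2 * ((N : ℝ) - 1))) S Ψ := by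
  have hN' : (2 : ℝ) ≤ N := by exact_mod_cast hN
  have hN1 : (0 : ℝ) < N - 1 := by linarith
  have hr := fun p => continuous_rho (d := d) (N := N) p
  have hps := continuous_pairSum (d := d) (N := N) hv.continuous
  rw [potentialEnergy_eq hv.continuous hc]
  have h1 := integral_mode_form hc hn S vhat
    (vhat 0 * (N ^ 2 - N) - N * (∑ p ∈ S, vhat p - N * tailSum vhat S))
  have h2 := setIntegral_mono_on (μ := volume) (s := boxN d N)
    (g := fun x => (1 / 2) * ((vhat 0 * (N ^ 2 - N) - N * (∑ p ∈ S, vhat p - N * tailSum vhat S))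
      + ∑ p ∈ S, vhat p * ‖rho p x‖ ^ 2) * ‖Ψ x‖ ^ 2)
    (f := fun x => pairSum v x * ‖Ψ x‖ ^ 2) (integrableOn_boxN (by fun_prop))
    (integrableOn_boxN (by fun_prop)) measurableSet_boxN fun x _ => by
      have := pairSum_le hv hS x
      gcongr
      linarith
  rw [h1] at h2
  refine le_trans (mul_le_mul_of_nonneg_left h2 (inv_nonneg.mpr hN1.le)) (le_of_eq ?_)
  have h3 : modePotential d N (fun p => vhat p / (2 * ((N : ℝ) - 1))) S Ψ =
      (2 * ((N : ℝ) - 1))⁻¹ *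
        ∑ p ∈ S, vhat p * ∫ x in boxN d N, ‖rho p x‖ ^ 2 * ‖Ψ x‖ ^ 2 := by
    rw [modePotential, Finset.mul_sum]
    exact Finset.sum_congr rfl fun p _ => by field_simp
  rw [h3]
  generalize ∑ p ∈ S, vhat p * ∫ x in boxN d N, ‖rho p x‖ ^ 2 * ‖Ψ x‖ ^ 2 = X
  generalize ∑ p ∈ S, vhat p = Y
  field_simp

end Potential

section Correlations

attribute [local instance] instMeasureSpaceUnitAddCircle instIsAddHaarMeasureUnitAddCircleVolume
  instIsProbabilityMeasureUnitAddCircleVolume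

variable {d N : ℕ}

lemma contDiff_rho (p : Fin d → ℤ) :
    ContDiff ℝ (⊤ : ℕ∞) (rho p : (Fin N → Fin d → ℝ) → ℂ) :=
  ContDiff.sum fun _ _ => contDiff_wave _

lemma rho_comp_perm (p : Fin d → ℤ) (σ : Equiv.Perm (Fin N)) (x : Fin N → Fin d → ℝ) :
    rho p (fun i => x (σ i)) = rho p x := by
  simp only [rho, wave_single]
  exact Equiv.sum_comp σ fun i => Complex.exp (Complex.I * ∑ j, (2 * π * (p j : ℝ)) * x i j)

lemma differentiableAt_wave (k : Fin N → Fin d → ℤ) (x : Fin N → Fin d → ℝ) :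
    DifferentiableAt ℝ (wave k) x := ((contDiff_wave k).differentiable (by simp)).differentiableAt

lemma differentiableAt_rho (p : Fin d → ℤ) (x : Fin N → Fin d → ℝ) :
    DifferentiableAt ℝ (rho p) x := ((contDiff_rho p).differentiable (by simp)).differentiableAt

lemma fderiv_rho (p : Fin d → ℤ) (x : Fin N → Fin d → ℝ) (i : Fin N) (j : Fin d) :
    fderiv ℝ (rho p) x (dir d N i j) =
      Complex.I * (2 * π * (p j : ℝ) : ℝ) * wave (Pi.single i p) x := by
  have h : (rho p : (Fin N → Fin d → ℝ) → ℂ) = fun x => ∑ i', wave (Pi.single i' p) x := rfl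
  rw [h, fderiv_fun_sum fun i' _ => differentiableAt_wave _ _, _root_.sum_apply,
    Finset.sum_eq_single i]
  · rw [fderiv_wave]; simp
  · intro b _ hb
    rw [fderiv_wave]
    simp [hb.symm]
  · simp

lemma fderiv_mul_dir {F G : (Fin N → Fin d → ℝ) → ℂ} {x y : Fin N → Fin d → ℝ}
    (hF : DifferentiableAt ℝ F x) (hG : DifferentiableAt ℝ G x) :
    fderiv ℝ (fun x => F x * G x) x y = fderiv ℝ F x y * G x + F x * fderiv ℝ G x y := by
  rw [fderiv_fun_mul hF hG]
  simp only [_root_.add_apply, _root_.smul_apply, smul_eq_mul]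
  ring

lemma pSq_eq_sum_complex (p : Fin d → ℤ) :
    (pSq d p : ℂ) = ∑ j, ((2 * π * (p j : ℝ) : ℝ) : ℂ) ^ 2 := by
  rw [pSq]; push_cast; rfl

/-- Integration by parts against the density modes. -/
lemma integral_rho_parts (p : Fin d → ℤ) {H : (Fin N → Fin d → ℝ) → ℂ} (hH : PeriodicFn H)
    (hc : ContDiff ℝ 1 H) :
    Complex.I * pSq d p * ∫ x in boxN d N, (rho p x * rho (-p) x - N) * H x =
      -∫ x in boxN d N, ∑ i, ∑ j, (2 * π * (p j : ℝ) : ℝ) * wave (Pi.single i p) x * rho (-p) x *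
        fderiv ℝ H x (dir d N i j) := by
  have hcw := fun k => continuous_wave (d := d) (N := N) k
  have hcr := fun k => continuous_rho (d := d) (N := N) k
  have hcd : Continuous (fderiv ℝ H) := hc.continuous_fderiv (by simp)
  have hcH := hc.continuous
  rw [eq_neg_iff_add_eq_zero, ← integral_const_mul,
    ← integral_add (integrableOn_boxN (by fun_prop)) (integrableOn_boxN (by fun_prop))]
  have h0 : ∀ i j, ∫ x in boxN d N, fderiv ℝ (fun x => (wave (Pi.single i p) x * rho (-p) x) * H x)
      x (dir d N i j) = 0 := fun i j =>
    integral_fderiv_eq_zero (((periodic_wave _).mul (periodic_rho _)).mul hH)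
      ((((contDiff_wave _).mul (contDiff_rho _)).of_le (by exact_mod_cast le_top)).mul hc) i j
  have h1 : ∀ i j, ∀ x, fderiv ℝ (fun x => (wave (Pi.single i p) x * rho (-p) x) * H x)
      x (dir d N i j) = Complex.I * (2 * π * (p j : ℝ) : ℝ) *
        (wave (Pi.single i p) x * rho (-p) x - 1) * H x +
        wave (Pi.single i p) x * rho (-p) x * fderiv ℝ H x (dir d N i j) := by
    intro i j x
    have hw : wave (Pi.single i p) x * wave (Pi.single i (-p)) x = 1 := by
      rw [← wave_add, ← Pi.single_add]; simp [wave]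
    rw [fderiv_mul_dir (F := fun x => wave (Pi.single i p) x * rho (-p) x)
      ((differentiableAt_wave _ _).fun_mul (differentiableAt_rho _ _))
      (hc.differentiable (by simp)).differentiableAt,
      fderiv_mul_dir (differentiableAt_wave _ _) (differentiableAt_rho _ _), fderiv_wave,
      fderiv_rho]
    simp only [Pi.single_eq_same, Pi.neg_apply]
    push_cast
    linear_combination (-Complex.I * (2 * π * (p j : ℝ)) * H x) * hw
  have h2 : ∫ x in boxN d N, ∑ i, ∑ j, ((2 * π * (p j : ℝ) : ℝ) : ℂ) *
      fderiv ℝ (fun x => (wave (Pi.single i p) x * rho (-p) x) * H x) x (dir d N i j) = 0 := by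
    simp only [h1]
    rw [integral_finsetSum _ fun i _ => integrableOn_boxN (by fun_prop)]
    refine Finset.sum_eq_zero fun i _ => ?_
    rw [integral_finsetSum _ fun j _ => integrableOn_boxN (by fun_prop)]
    refine Finset.sum_eq_zero fun j _ => ?_
    rw [integral_const_mul]
    simp only [← h1]
    rw [h0, mul_zero]
  rw [← h2]
  congr 1
  funext x
  simp only [h1]
  have h3 : rho p x * rho (-p) x - N = ∑ i, (wave (Pi.single i p) x * rho (-p) x - 1) := by
    rw [Finset.sum_sub_distrib, ← Finset.sum_mul]; simp [rho]
  rw [h3, pSq_eq_sum_complex, Finset.sum_mul, Finset.mul_sum, ← Finset.sum_add_distrib]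
  refine Finset.sum_congr rfl fun i _ => ?_
  rw [Finset.mul_sum, Finset.sum_mul, ← Finset.sum_add_distrib]
  exact Finset.sum_congr rfl fun j _ => by ring

lemma integral_one_boxN : ∫ _ in boxN d N, (1 : ℝ) = 1 := by
  rw [integral_boxN_eq]
  have : volume.real (Set.univ : Set (UnitAddTorus (Fin N × Fin d))) = 1 := probReal_univ
  simp [torusLift, this]

lemma integral_norm_rho_sq {p : Fin d → ℤ} (hp : pSq d p ≠ 0) :
    ∫ x in boxN d N, ‖rho p x‖ ^ 2 = N := by
  have hcr := fun k => continuous_rho (d := d) (N := N) k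
  have h := integral_rho_parts (N := N) p (H := fun _ => 1) (fun _ _ => rfl) contDiff_const
  simp only [fderiv_fun_const, Pi.zero_apply, _root_.zero_apply, mul_zero,
    Finset.sum_const_zero, integral_zero, neg_zero, mul_eq_zero, Complex.I_ne_zero, false_or,
    Complex.ofReal_eq_zero, hp, mul_one] at h
  have h2 : ∀ x : Fin N → Fin d → ℝ, rho p x * rho (-p) x - N = ((‖rho p x‖ ^ 2 - N * 1 : ℝ) : ℂ) :=
    fun x => by rw [Complex.ofReal_sub, ofReal_norm_rho_sq]; simp
  simp only [h2] at h
  rw [integral_complex_ofReal, Complex.ofReal_eq_zero,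
    integral_sub (integrableOn_boxN (by fun_prop)) (integrableOn_boxN (by fun_prop)),
    integral_const_mul, integral_one_boxN] at h
  linarith

lemma integral_norm_rho_pow_four_le (hN : 2 ≤ N) {p : Fin d → ℤ} (hp : pSq d p ≠ 0) :
    ∫ x in boxN d N, ‖rho p x‖ ^ 4 ≤ 5 * N ^ 2 := by
  have hcr := fun k => continuous_rho (d := d) (N := N) k
  have hp2 : pSq d (p + p) ≠ 0 := by
    have : pSq d (p + p) = 4 * pSq d p := by
      rw [pSq, pSq, Finset.mul_sum]
      refine Finset.sum_congr rfl fun j _ => ?_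
      simp only [Pi.add_apply]; push_cast; ring
    rw [this]; positivity
  have h := integral_rho_parts (N := N) p (H := fun x => rho p x * rho (-p) x)
    ((periodic_rho _).mul (periodic_rho _))
    (((contDiff_rho _).mul (contDiff_rho _)).of_le (by exact_mod_cast le_top))
  have h1 : ∀ x : Fin N → Fin d → ℝ, ∑ i, ∑ j, ((2 * π * (p j : ℝ) : ℝ) : ℂ) *
      wave (Pi.single i p) x * rho (-p) x *
        fderiv ℝ (fun x => rho p x * rho (-p) x) x (dir d N i j) =
      Complex.I * pSq d p * (rho (p + p) x * rho (-p) x ^ 2 - N * (rho p x * rho (-p) x)) := by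
    intro x
    have h2 : rho (p + p) x * rho (-p) x ^ 2 - N * (rho p x * rho (-p) x) = ∑ i,
        (wave (Pi.single i p) x * wave (Pi.single i p) x * rho (-p) x ^ 2 -
          wave (Pi.single i p) x * wave (Pi.single i (-p)) x * rho (-p) x * rho p x) := by
      rw [Finset.sum_sub_distrib, ← Finset.sum_mul, ← Finset.sum_mul, ← Finset.sum_mul]
      simp only [← wave_add, ← Pi.single_add, add_neg_cancel]
      have h3 : ∑ i : Fin N, wave (Pi.single i (0 : Fin d → ℤ)) x = N := rho_zero x
      rw [h3]
      have h4 : ∑ i : Fin N, wave (Pi.single i (p + p)) x = rho (p + p) x := rfl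
      rw [h4]
      ring
    rw [h2, pSq_eq_sum_complex, Finset.mul_sum]
    refine Finset.sum_congr rfl fun i _ => ?_
    rw [Finset.mul_sum, Finset.sum_mul]
    refine Finset.sum_congr rfl fun j _ => ?_
    rw [fderiv_mul_dir (differentiableAt_rho _ _) (differentiableAt_rho _ _), fderiv_rho,
      fderiv_rho]
    simp only [Pi.neg_apply]
    push_cast
    ring
  simp only [h1] at h
  rw [integral_const_mul, ← mul_neg, mul_right_inj' (by simp [hp])] at h
  have hb := fun p x => norm_rho_le (d := d) (N := N) p x
  have h6 : ∀ x : Fin N → Fin d → ℝ, (((‖rho p x‖ ^ 2 : ℝ) : ℂ) - N) *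
      ((‖rho p x‖ ^ 2 : ℝ) : ℂ) = ((‖rho p x‖ ^ 4 - N * ‖rho p x‖ ^ 2 : ℝ) : ℂ) := fun x => by
    rw [show ‖rho p x‖ ^ 4 - N * ‖rho p x‖ ^ 2 = (‖rho p x‖ ^ 2 - N) * ‖rho p x‖ ^ 2 by ring,
      Complex.ofReal_mul, Complex.ofReal_sub, Complex.ofReal_natCast]
  simp only [← ofReal_norm_rho_sq, h6] at h
  rw [integral_complex_ofReal, integral_sub (integrableOn_boxN (by fun_prop))
    (integrableOn_boxN (by fun_prop)), integral_const_mul, integral_norm_rho_sq hp,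
    integral_sub (integrableOn_boxN (by fun_prop))
    (integrableOn_boxN (by fun_prop)), integral_const_mul, integral_complex_ofReal,
    integral_norm_rho_sq hp] at h
  have h7 : ‖∫ x in boxN d N, rho (p + p) x * rho (-p) x ^ 2‖ ≤
      (N + ∫ x in boxN d N, ‖rho p x‖ ^ 4) / 2 := by
    rw [← integral_norm_rho_sq (N := N) hp2, ← integral_add (integrableOn_boxN (by fun_prop))
      (integrableOn_boxN (by fun_prop)), ← integral_div]
    refine (norm_integral_le_integral_norm _).trans ?_
    refine integral_mono (integrableOn_boxN (by fun_prop)) (integrableOn_boxN (by fun_prop))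
      fun x => ?_
    simp only [norm_mul, norm_pow, norm_rho_neg]
    nlinarith [sq_nonneg (‖rho (p + p) x‖ - ‖rho p x‖ ^ 2)]
  have h8 : ((∫ x in boxN d N, ‖rho p x‖ ^ 4 : ℝ) : ℂ) =
      ((2 * N ^ 2 : ℝ) : ℂ) - ∫ x in boxN d N, rho (p + p) x * rho (-p) x ^ 2 := by
    push_cast at h ⊢
    linear_combination h
  have h9 := norm_sub_le ((2 * N ^ 2 : ℝ) : ℂ) (∫ x in boxN d N, rho (p + p) x * rho (-p) x ^ 2)
  have h10 : (0 : ℝ) ≤ ∫ x in boxN d N, ‖rho p x‖ ^ 4 := integral_nonneg fun x => by positivity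
  rw [← h8, Complex.norm_real, Complex.norm_real, Real.norm_of_nonneg h10,
    Real.norm_of_nonneg (by positivity)] at h9
  have hN' : (2 : ℝ) ≤ N := by exact_mod_cast hN
  nlinarith

end Correlations

section Jastrow

variable {d N : ℕ}

/-- The inner product of two lattice momenta. -/
def dotMom (p q : Fin d → ℤ) : ℝ := ∑ j, (2 * π * (p j : ℝ)) * (2 * π * (q j : ℝ))

lemma pSq_nonneg (p : Fin d → ℤ) : 0 ≤ pSq d p := Finset.sum_nonneg fun _ _ => sq_nonneg _

lemma abs_dotMom_le (p q : Fin d → ℤ) : |dotMom p q| ≤ √(pSq d p) * √(pSq d q) := by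
  rw [← Real.sqrt_mul (pSq_nonneg p)]
  exact Real.abs_le_sqrt (Finset.sum_mul_sq_le_sq_mul_sq _ _ _)

lemma pSq_neg (p : Fin d → ℤ) : pSq d (-p) = pSq d p := by
  refine Finset.sum_congr rfl fun j _ => ?_
  simp only [Pi.neg_apply]; push_cast; ring

lemma one_le_pSq {p : Fin d → ℤ} (hp : p ≠ 0) : 1 ≤ pSq d p := by
  obtain ⟨j, hj⟩ := Function.ne_iff.mp hp
  have h1 : (1 : ℝ) ≤ (p j : ℝ) ^ 2 := by
    have h2 : (1 : ℤ) ≤ p j ^ 2 := by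
      have : 0 < p j ^ 2 := by have := hj; simp only [Pi.zero_apply] at this; positivity
      lia
    exact_mod_cast h2
  have h3 : (1 : ℝ) ≤ (2 * π) ^ 2 := by nlinarith [Real.pi_gt_three]
  calc (1 : ℝ) ≤ (2 * π * (p j : ℝ)) ^ 2 := by rw [mul_pow]; nlinarith
    _ ≤ pSq d p := Finset.single_le_sum (f := fun j => (2 * π * (p j : ℝ)) ^ 2)
        (fun _ _ => sq_nonneg _) (Finset.mem_univ j)

lemma integral_three_modes_le (hN : 2 ≤ N) {p q : Fin d → ℤ} (hp : p ≠ 0) (hq : q ≠ 0)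
    (hpq : p + q ≠ 0) :
    ∫ x in boxN d N, ‖rho (p + q) x‖ * ‖rho p x‖ * ‖rho q x‖ ≤ 3 * (N * √N) := by
  have hcr := fun k => continuous_rho (d := d) (N := N) k
  have hN' : (0 : ℝ) < N := by exact_mod_cast (by lia : 0 < N)
  have hs : 0 < √(N : ℝ) := Real.sqrt_pos.mpr hN'
  have hss : √(N : ℝ) * √N = N := Real.mul_self_sqrt hN'.le
  have hne : ∀ {k : Fin d → ℤ}, k ≠ 0 → pSq d k ≠ 0 := fun h => by
    have := one_le_pSq h; positivity
  have h1 : ∫ x in boxN d N, ‖rho (p + q) x‖ * ‖rho p x‖ * ‖rho q x‖ ≤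
      ∫ x in boxN d N, (√N / 2 * ‖rho (p + q) x‖ ^ 2 +
        ((4 * √N)⁻¹ * ‖rho p x‖ ^ 4 + (4 * √N)⁻¹ * ‖rho q x‖ ^ 4)) := by
    refine integral_mono (integrableOn_boxN (by fun_prop)) (integrableOn_boxN (by fun_prop))
      fun x => ?_
    simp only
    generalize ‖rho (p + q) x‖ = a
    generalize ‖rho p x‖ = b
    generalize ‖rho q x‖ = c
    have : √N / 2 * a ^ 2 + ((4 * √N)⁻¹ * b ^ 4 + (4 * √N)⁻¹ * c ^ 4) - a * b * c =
        (2 * √N)⁻¹ * ((√N * a - b * c) ^ 2 + (b ^ 2 - c ^ 2) ^ 2 / 2) := by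
      field_simp
      ring
    have h2 : 0 ≤ (2 * √(N : ℝ))⁻¹ * ((√N * a - b * c) ^ 2 + (b ^ 2 - c ^ 2) ^ 2 / 2) := by
      positivity
    linarith
  refine h1.trans ?_
  rw [integral_add (integrableOn_boxN (by fun_prop)) (integrableOn_boxN (by fun_prop)),
    integral_add (integrableOn_boxN (by fun_prop)) (integrableOn_boxN (by fun_prop)),
    integral_const_mul, integral_const_mul, integral_const_mul, integral_norm_rho_sq (hne hpq)]
  have h2 := integral_norm_rho_pow_four_le (N := N) hN (hne hp)
  have h3 := integral_norm_rho_pow_four_le (N := N) hN (hne hq)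
  have h4 : (4 * √(N : ℝ))⁻¹ * (5 * N ^ 2) = 5 / 4 * (N * √N) := by
    rw [show (5 : ℝ) * N ^ 2 = 5 * (N * (√N * √N)) by rw [hss]; ring]
    field_simp
  have h5 := mul_le_mul_of_nonneg_left h2 (by positivity : 0 ≤ (4 * √(N : ℝ))⁻¹)
  have h6 := mul_le_mul_of_nonneg_left h3 (by positivity : 0 ≤ (4 * √(N : ℝ))⁻¹)
  rw [h4] at h5 h6
  linarith

/-- The exponent of the trial state. -/
def jastrow (c : (Fin d → ℤ) → ℝ) (S : Finset (Fin d → ℤ)) (x : Fin N → Fin d → ℝ) : ℝ :=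
  (2 * (N : ℝ))⁻¹ * ∑ q ∈ S, c q * ‖rho q x‖ ^ 2

variable {c : (Fin d → ℤ) → ℝ} {S : Finset (Fin d → ℤ)}

lemma contDiff_jastrow : ContDiff ℝ (⊤ : ℕ∞) (jastrow c S : (Fin N → Fin d → ℝ) → ℝ) :=
  contDiff_const.mul (ContDiff.sum fun q _ => contDiff_const.mul ((contDiff_rho q).norm_sq ℝ))

lemma periodic_jastrow : PeriodicFn (jastrow c S : (Fin N → Fin d → ℝ) → ℝ) := fun x k => by
  simp only [jastrow]
  congr 1
  exact Finset.sum_congr rfl fun q _ => by rw [periodic_rho q x k]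

lemma jastrow_comp_perm (σ : Equiv.Perm (Fin N)) (x : Fin N → Fin d → ℝ) :
    jastrow c S (fun i => x (σ i)) = jastrow c S x := by
  simp only [jastrow, rho_comp_perm]

lemma jastrow_nonneg (hc : ∀ q, 0 ≤ c q) (x : Fin N → Fin d → ℝ) : 0 ≤ jastrow c S x := by
  rw [jastrow]
  exact mul_nonneg (by positivity) (Finset.sum_nonneg fun q _ => mul_nonneg (hc q) (sq_nonneg _))

lemma fderiv_ofReal_comp {f : (Fin N → Fin d → ℝ) → ℝ} {x y : Fin N → Fin d → ℝ}
    (hf : DifferentiableAt ℝ f x) :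
    fderiv ℝ (fun x => (f x : ℂ)) x y = fderiv ℝ f x y := by
  have := (Complex.ofRealCLM.hasFDerivAt.comp x hf.hasFDerivAt).fderiv
  have h : (fun x => (f x : ℂ)) = Complex.ofRealCLM ∘ f := rfl
  rw [h, this]
  rfl

lemma fderiv_jastrow (hc : ∀ q, c (-q) = c q) (hS : ∀ q ∈ S, -q ∈ S) (x : Fin N → Fin d → ℝ)
    (i : Fin N) (j : Fin d) :
    (fderiv ℝ (jastrow c S) x (dir d N i j) : ℂ) = Complex.I / N *
      ∑ q ∈ S, c q * ((2 * π * (q j : ℝ) : ℝ) * wave (Pi.single i q) x * rho (-q) x) := by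
  rw [← fderiv_ofReal_comp (contDiff_jastrow.differentiable (by simp)).differentiableAt]
  have h : (fun x : Fin N → Fin d → ℝ => ((jastrow c S x : ℝ) : ℂ)) =
      fun x => (2 * (N : ℂ))⁻¹ * ∑ q ∈ S, c q * (rho q x * rho (-q) x) := by
    funext x
    rw [jastrow]
    simp only [Complex.ofReal_mul, Complex.ofReal_sum, ofReal_norm_rho_sq]
    push_cast
    rfl
  have hd : ∀ q ∈ S, DifferentiableAt ℝ (fun x : Fin N → Fin d → ℝ =>
      (c q : ℂ) * (rho q x * rho (-q) x)) x := fun q _ =>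
    ((differentiableAt_rho _ _).fun_mul (differentiableAt_rho _ _)).const_mul _
  rw [h, fderiv_const_mul (DifferentiableAt.fun_sum hd), _root_.smul_apply, fderiv_fun_sum hd,
    _root_.sum_apply]
  have h2 : ∀ q ∈ S, fderiv ℝ (fun x : Fin N → Fin d → ℝ =>
      (c q : ℂ) * (rho q x * rho (-q) x)) x (dir d N i j) =
      c q * (Complex.I * ((2 * π * (q j : ℝ) : ℝ) * wave (Pi.single i q) x * rho (-q) x)) +
      c (-q) * (Complex.I * ((2 * π * ((-q) j : ℝ) : ℝ) * wave (Pi.single i (-q)) x *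
        rho (- -q) x)) := by
    intro q _
    rw [fderiv_const_mul ((differentiableAt_rho _ _).fun_mul (differentiableAt_rho _ _)),
      _root_.smul_apply, fderiv_mul_dir (differentiableAt_rho _ _) (differentiableAt_rho _ _),
      fderiv_rho, fderiv_rho, hc, neg_neg, smul_eq_mul]
    simp only [Pi.neg_apply]
    push_cast
    ring
  rw [Finset.sum_congr rfl h2, Finset.sum_add_distrib]
  have h3 : ∀ g : (Fin d → ℤ) → ℂ, ∑ q ∈ S, g (-q) = ∑ q ∈ S, g q := fun g =>
    Finset.sum_nbij' (fun q => -q) (fun q => -q) (fun q hq => hS q hq) (fun q hq => hS q hq)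
      (fun q _ => neg_neg q) (fun q _ => neg_neg q) (fun q _ => rfl)
  rw [h3 (fun q => c q * (Complex.I * ((2 * π * (q j : ℝ) : ℝ) * wave (Pi.single i q) x *
    rho (-q) x))), ← two_mul, smul_eq_mul, Finset.mul_sum, Finset.mul_sum, Finset.mul_sum]
  refine Finset.sum_congr rfl fun q _ => ?_
  rw [mul_inv]
  ring

lemma fderiv_exp_jastrow (t : ℝ) (x y : Fin N → Fin d → ℝ) :
    fderiv ℝ (fun x => ((Real.exp (t * jastrow c S x) : ℝ) : ℂ)) x y =
      t * fderiv ℝ (jastrow c S) x y * (Real.exp (t * jastrow c S x) : ℝ) := by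
  have hd : DifferentiableAt ℝ (jastrow c S) x :=
    (contDiff_jastrow.differentiable (by simp)).differentiableAt
  rw [fderiv_ofReal_comp (hd.const_mul t).exp, fderiv_exp (hd.const_mul t), _root_.smul_apply,
    fderiv_const_mul hd, _root_.smul_apply]
  simp only [smul_eq_mul]
  push_cast
  ring

/-- The partition function of the weight `e^{-2φ}`. -/
def jastrowZ (N : ℕ) (c : (Fin d → ℤ) → ℝ) (S : Finset (Fin d → ℤ)) : ℝ :=
  ∫ x in boxN d N, Real.exp (-2 * jastrow c S x)

/-- The unnormalized density correlation in the weight `e^{-2φ}`. -/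
def jastrowJ (N : ℕ) (c : (Fin d → ℤ) → ℝ) (S : Finset (Fin d → ℤ)) (p : Fin d → ℤ) : ℝ :=
  ∫ x in boxN d N, ‖rho p x‖ ^ 2 * Real.exp (-2 * jastrow c S x)

lemma continuous_jastrow : Continuous (jastrow c S : (Fin N → Fin d → ℝ) → ℝ) :=
  contDiff_jastrow.continuous

lemma continuous_fderiv_jastrow :
    Continuous (fderiv ℝ (jastrow c S : (Fin N → Fin d → ℝ) → ℝ)) :=
  contDiff_jastrow.continuous_fderiv (by simp)

lemma jastrow_parts (p : Fin d → ℤ) :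
    Complex.I * pSq d p * (jastrowJ N c S p - N * jastrowZ N c S : ℝ) =
      2 * ∫ x in boxN d N, (∑ i, ∑ j, (2 * π * (p j : ℝ) : ℝ) * wave (Pi.single i p) x *
        rho (-p) x * fderiv ℝ (jastrow c S) x (dir d N i j)) *
        (Real.exp (-2 * jastrow c S x) : ℝ) := by
  have hcr := fun k => continuous_rho (d := d) (N := N) k
  have hcj := continuous_jastrow (N := N) (c := c) (S := S)
  have h := integral_rho_parts (N := N) p
    (H := fun x => ((Real.exp (-2 * jastrow c S x) : ℝ) : ℂ))
    (periodic_jastrow.comp fun t => ((Real.exp (-2 * t) : ℝ) : ℂ))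
    (Complex.ofRealCLM.contDiff.comp
      ((contDiff_const.mul (contDiff_jastrow.of_le (by exact_mod_cast le_top))).exp))
  have h1 : ∀ x : Fin N → Fin d → ℝ, (rho p x * rho (-p) x - N) *
      ((Real.exp (-2 * jastrow c S x) : ℝ) : ℂ) = ((‖rho p x‖ ^ 2 * Real.exp (-2 * jastrow c S x)
        - N * Real.exp (-2 * jastrow c S x) : ℝ) : ℂ) := fun x => by
    rw [← ofReal_norm_rho_sq]; push_cast; ring
  simp only [h1] at h
  rw [integral_complex_ofReal, integral_sub (integrableOn_boxN (by fun_prop))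
    (integrableOn_boxN (by fun_prop)), integral_const_mul] at h
  rw [jastrowJ, jastrowZ, h, ← integral_neg, ← integral_const_mul]
  congr 1
  funext x
  rw [Finset.sum_mul, Finset.mul_sum, ← Finset.sum_neg_distrib]
  refine Finset.sum_congr rfl fun i _ => ?_
  rw [Finset.sum_mul, Finset.mul_sum, ← Finset.sum_neg_distrib]
  refine Finset.sum_congr rfl fun j _ => ?_
  rw [fderiv_exp_jastrow]
  push_cast
  ring

lemma sum_wave_fderiv_jastrow (hc : ∀ q, c (-q) = c q) (hS : ∀ q ∈ S, -q ∈ S) (p : Fin d → ℤ)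
    (x : Fin N → Fin d → ℝ) :
    ∑ i, ∑ j, (2 * π * (p j : ℝ) : ℝ) * wave (Pi.single i p) x *
        rho (-p) x * fderiv ℝ (jastrow c S) x (dir d N i j) = Complex.I / N *
      ∑ q ∈ S, (c q * dotMom p q : ℝ) * (rho (p + q) x * rho (-p) x * rho (-q) x) := by
  simp only [fderiv_jastrow hc hS]
  have h1 : ∀ q, (c q * dotMom p q : ℝ) * (rho (p + q) x * rho (-p) x * rho (-q) x) =
      ∑ i, ∑ j, (c q : ℂ) * (((2 * π * (p j : ℝ) : ℝ) * (2 * π * (q j : ℝ) : ℝ)) *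
        (wave (Pi.single i p) x * wave (Pi.single i q) x * rho (-p) x * rho (-q) x)) := by
    intro q
    simp only [← wave_add, ← Pi.single_add, ← Finset.mul_sum, ← Finset.sum_mul]
    rw [dotMom, rho]
    push_cast
    ring
  simp only [h1]
  simp only [Finset.mul_sum]
  rw [Finset.sum_comm (s := S)]
  refine Finset.sum_congr rfl fun i _ => ?_
  rw [Finset.sum_comm (s := S)]
  refine Finset.sum_congr rfl fun j _ => ?_
  refine Finset.sum_congr rfl fun q _ => ?_
  ring

lemma jastrowJ_le (hN : 2 ≤ N) (hc : ∀ q, c (-q) = c q) (hc0 : ∀ q, 0 ≤ c q)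
    (hS : ∀ q ∈ S, -q ∈ S) (h0 : 0 ∉ S) {p : Fin d → ℤ} (hp : p ∈ S) :
    (1 + 2 * c p) * jastrowJ N c S p ≤
      N * jastrowZ N c S + 6 * √N * ∑ q ∈ S, c q * √(pSq d q) := by
  have hcr := fun k => continuous_rho (d := d) (N := N) k
  have hcj := continuous_jastrow (N := N) (c := c) (S := S)
  have hN' : (0 : ℝ) < N := by exact_mod_cast (by lia : 0 < N)
  have hNc : (N : ℂ) ≠ 0 := by exact_mod_cast hN'.ne'
  have hp0 : p ≠ 0 := fun h => h0 (h ▸ hp)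
  have ha := one_le_pSq hp0
  set T : (Fin d → ℤ) → ℂ := fun q => ∫ x in boxN d N, (rho (p + q) x * rho (-p) x * rho (-q) x) *
    (Real.exp (-2 * jastrow c S x) : ℝ) with hT
  have h1 : (pSq d p * (jastrowJ N c S p - N * jastrowZ N c S) : ℝ) =
      2 / (N : ℂ) * ∑ q ∈ S, (c q * dotMom p q : ℝ) * T q := by
    have h := jastrow_parts (N := N) (c := c) (S := S) p
    simp only [sum_wave_fderiv_jastrow hc hS, hT, ← integral_const_mul] at h ⊢
    rw [← mul_right_inj' Complex.I_ne_zero, Complex.ofReal_mul, ← mul_assoc, h,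
      ← integral_finsetSum _ fun q _ => integrableOn_boxN (by fun_prop), ← integral_const_mul,
      ← integral_const_mul]
    congr 1
    funext x
    simp only [Finset.sum_mul, Finset.mul_sum]
    exact Finset.sum_congr rfl fun q _ => by ring
  have hTp : T (-p) = ((N * jastrowJ N c S p : ℝ) : ℂ) := by
    simp only [hT, jastrowJ]
    rw [← integral_const_mul, ← integral_complex_ofReal]
    congr 1
    funext x
    rw [add_neg_cancel, rho_zero, neg_neg]
    push_cast
    rw [← Complex.ofReal_pow, ofReal_norm_rho_sq]
    ring
  have hdp : dotMom p (-p) = -pSq d p := by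
    rw [dotMom, pSq, ← Finset.sum_neg_distrib]
    refine Finset.sum_congr rfl fun j _ => ?_
    simp only [Pi.neg_apply]; push_cast; ring
  have h2 : (pSq d p * ((1 + 2 * c p) * jastrowJ N c S p - N * jastrowZ N c S) : ℝ) =
      2 / (N : ℂ) * ∑ q ∈ S.erase (-p), (c q * dotMom p q : ℝ) * T q := by
    rw [← Finset.add_sum_erase S _ (hS p hp), hTp, hdp, hc] at h1
    push_cast at h1 ⊢
    have : 2 / (N : ℂ) * (c p * -pSq d p * (N * jastrowJ N c S p)) =
      -(2 * c p * pSq d p * jastrowJ N c S p) := by field_simp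
    linear_combination h1 + this
  have hTn : ∀ q ∈ S.erase (-p), ‖(c q * dotMom p q : ℝ) * T q‖ ≤
      √(pSq d p) * (3 * (N * √N)) * (c q * √(pSq d q)) := by
    intro q hq
    obtain ⟨hq1, hq2⟩ := Finset.mem_erase.mp hq
    have hT3 : ‖T q‖ ≤ 3 * (N * √N) := by
      refine le_trans ?_ (integral_three_modes_le hN hp0 (fun h => h0 (h ▸ hq2))
        (fun h => hq1 (eq_neg_of_add_eq_zero_right h)))
      refine (norm_integral_le_integral_norm _).trans ?_
      refine integral_mono (integrableOn_boxN (by fun_prop)) (integrableOn_boxN (by fun_prop))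
        fun x => ?_
      simp only [norm_mul, norm_rho_neg, Complex.norm_real, Real.norm_eq_abs, Real.abs_exp]
      refine mul_le_of_le_one_right (by positivity) (Real.exp_le_one_iff.mpr ?_)
      have := jastrow_nonneg (S := S) hc0 x
      linarith
    rw [norm_mul, Complex.norm_real, Real.norm_eq_abs, abs_mul, abs_of_nonneg (hc0 q)]
    calc c q * |dotMom p q| * ‖T q‖
        ≤ c q * (√(pSq d p) * √(pSq d q)) * (3 * (N * √N)) := by
          have := hc0 q
          gcongr
          exact abs_dotMom_le p q
      _ = _ := by ring
  have h3 : pSq d p * ((1 + 2 * c p) * jastrowJ N c S p - N * jastrowZ N c S) ≤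
      pSq d p * (6 * √N * ∑ q ∈ S, c q * √(pSq d q)) := by
    refine (le_abs_self _).trans ?_
    rw [← Real.norm_eq_abs, ← Complex.norm_real, h2, norm_mul, norm_div, Complex.norm_natCast,
      Complex.norm_ofNat]
    have h4 := (norm_sum_le _ _).trans (Finset.sum_le_sum hTn)
    rw [← Finset.mul_sum] at h4
    have h5 : ∑ q ∈ S.erase (-p), c q * √(pSq d q) ≤ ∑ q ∈ S, c q * √(pSq d q) :=
      Finset.sum_le_sum_of_subset_of_nonneg (Finset.erase_subset _ _) fun q _ _ =>
        mul_nonneg (hc0 q) (Real.sqrt_nonneg _)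
    have h6 : 0 ≤ ∑ q ∈ S, c q * √(pSq d q) :=
        Finset.sum_nonneg fun q _ => mul_nonneg (hc0 q) (Real.sqrt_nonneg _)
    have h7 : √(pSq d p) ≤ pSq d p := Real.sqrt_le_iff.mpr ⟨by linarith, by nlinarith⟩
    calc 2 / (N : ℝ) * ‖∑ q ∈ S.erase (-p), (c q * dotMom p q : ℝ) * T q‖
        ≤ 2 / (N : ℝ) * (√(pSq d p) * (3 * (N * √N)) * ∑ q ∈ S, c q * √(pSq d q)) := by
          refine mul_le_mul_of_nonneg_left (h4.trans ?_) (by positivity)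
          exact mul_le_mul_of_nonneg_left h5 (by positivity)
      _ = √(pSq d p) * (6 * √N * ∑ q ∈ S, c q * √(pSq d q)) := by field_simp; ring
      _ ≤ _ := mul_le_mul_of_nonneg_right h7 (by positivity)
  have h8 := le_of_mul_le_mul_left h3 (by linarith)
  linarith

end Jastrow

section Trial

variable {d N : ℕ} {v : (Fin d → ℝ) → ℝ} {vhat : (Fin d → ℤ) → ℝ}

/-- The exponent optimizing the energy of a single mode. -/
def modeExponent (a w : ℝ) : ℝ := (√(a ^ 2 + 2 * a * w) - a) / (2 * a)

lemma modeExponent_nonneg {a w : ℝ} (ha : 0 ≤ a) (hw : 0 ≤ w) : 0 ≤ modeExponent a w := by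
  refine div_nonneg (sub_nonneg.mpr (Real.le_sqrt_of_sq_le ?_)) (by positivity)
  have := mul_nonneg ha hw
  linarith

lemma modeExponent_mul_le {a w : ℝ} (ha : 0 < a) (hw : 0 ≤ w) : modeExponent a w * a ≤ w / 2 := by
  have h : √(a ^ 2 + 2 * a * w) ≤ a + w := Real.sqrt_le_iff.mpr ⟨by linarith, by nlinarith⟩
  rw [modeExponent, show (√(a ^ 2 + 2 * a * w) - a) / (2 * a) * a =
      (√(a ^ 2 + 2 * a * w) - a) / 2 by
    field_simp]
  linarith

lemma mode_energy_le {a w n ε j : ℝ} (ha : 0 < a) (hw : 0 ≤ w) (hn : 2 ≤ n) (hε : 0 ≤ ε)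
    (hj : (1 + 2 * modeExponent a w) * j ≤ n * (1 + ε)) :
    -(2 * n)⁻¹ * (modeExponent a w * a * (j - n)) + w / (2 * (n - 1)) * j ≤
      (√(a ^ 2 + 2 * a * w) - a) / 2 + (ε / 2 + (1 + ε) / n) * w := by
  have hc0 := modeExponent_nonneg ha.le hw
  have hca := modeExponent_mul_le ha hw
  set c := modeExponent a w with hc
  set e := √(a ^ 2 + 2 * a * w) with he
  have he2 : e ^ 2 = a ^ 2 + 2 * a * w := Real.sq_sqrt (by positivity)
  have hce : e = a * (1 + 2 * c) := by rw [hc, modeExponent, ← he]; field_simp; ring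
  have hw2 : w = 2 * a * c * (1 + c) := by
    have : 2 * a * w = 2 * a * (2 * a * c * (1 + c)) := by
      rw [hce] at he2; linarith
    exact mul_left_cancel₀ (by positivity) this
  have hn1 : 0 < n - 1 := by linarith
  have hjn : j ≤ n * (1 + ε) / (1 + 2 * c) := by
    rw [le_div_iff₀ (by positivity)]; linarith
  have hk : w / (2 * (n - 1)) - c * a / (2 * n) ≤ (w - c * a) / (2 * n) + w / n ^ 2 := by
    have : 1 / (2 * (n - 1)) ≤ 1 / (2 * n) + 1 / n ^ 2 := by
      rw [div_add_div _ _ (by positivity) (by positivity), div_le_div_iff₀ (by positivity)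
        (by positivity)]
      nlinarith
    have h2 := mul_le_mul_of_nonneg_left this hw
    calc w / (2 * (n - 1)) - c * a / (2 * n) = w * (1 / (2 * (n - 1))) - c * a / (2 * n) := by ring
      _ ≤ w * (1 / (2 * n) + 1 / n ^ 2) - c * a / (2 * n) := by linarith
      _ = _ := by ring
  have hk0 : 0 ≤ w / (2 * (n - 1)) - c * a / (2 * n) := by
    have h1 : c * a / (2 * n) ≤ w / (2 * (n - 1)) := by
      refine div_le_div₀ hw (by linarith) (by positivity) (by linarith)
    linarith
  have h1 : (w / (2 * (n - 1)) - c * a / (2 * n)) * j ≤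
      ((w - c * a) / (2 * n) + w / n ^ 2) * (n * (1 + ε) / (1 + 2 * c)) :=
    (mul_le_mul_of_nonneg_left hjn hk0).trans
      (mul_le_mul_of_nonneg_right hk (by positivity))
  have h2 : ((w - c * a) / (2 * n) + w / n ^ 2) * (n * (1 + ε) / (1 + 2 * c)) =
      (1 + ε) * (c * a / 2) + (1 + ε) / n * (w / (1 + 2 * c)) := by
    rw [show w - c * a = a * c * (1 + 2 * c) by rw [hw2]; ring]
    field_simp
  have h3 : w / (1 + 2 * c) ≤ w := div_le_self hw (by linarith)
  have h4 := mul_le_mul_of_nonneg_left h3 (by positivity : 0 ≤ (1 + ε) / n)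
  have h5 := mul_le_mul_of_nonneg_left hca hε
  have h6 : -(2 * n)⁻¹ * (c * a * (j - n)) + w / (2 * (n - 1)) * j =
      c * a / 2 + (w / (2 * (n - 1)) - c * a / (2 * n)) * j := by field_simp; ring
  rw [h6, hce]
  nlinarith

lemma vhat_neg (hv : PotentialAssumptions d v vhat) (p : Fin d → ℤ) : vhat (-p) = vhat p := by
  have h := congrArg conj (hv.coeffs p)
  rw [← integral_conj, Complex.conj_ofReal] at h
  have : (vhat p : ℂ) = vhat (-p) := by
    rw [h, hv.coeffs (-p)]
    congr 1
    funext x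
    rw [map_mul, Complex.conj_ofReal, ← Complex.exp_conj, map_mul, map_neg, Complex.conj_I,
      Complex.conj_ofReal]
    congr 2
    simp only [Pi.neg_apply]
    push_cast
    simp only [mul_neg, neg_mul, Finset.sum_neg_distrib]
  exact_mod_cast this.symm

/-- The normalized trial state. -/
def trial (c : (Fin d → ℤ) → ℝ) (S : Finset (Fin d → ℤ)) (x : Fin N → Fin d → ℝ) : ℂ :=
  ((√(jastrowZ N c S))⁻¹ : ℝ) * (Real.exp (-1 * jastrow c S x) : ℝ)

variable {c : (Fin d → ℤ) → ℝ} {S : Finset (Fin d → ℤ)}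

lemma exp_le_jastrowZ (hN : 2 ≤ N) (h0 : 0 ∉ S) :
    Real.exp (-∑ q ∈ S, c q) ≤ jastrowZ N c S := by
  have hcj := continuous_jastrow (N := N) (c := c) (S := S)
  have hcr := fun k => continuous_rho (d := d) (N := N) k
  have hN' : (0 : ℝ) < N := by exact_mod_cast (by lia : 0 < N)
  set t := ∑ q ∈ S, c q with ht
  have h1 : ∫ x in boxN d N, jastrow c S x = t / 2 := by
    simp only [jastrow]
    rw [integral_const_mul, integral_finsetSum _ fun q _ => integrableOn_boxN (by fun_prop)]
    have : ∀ q ∈ S, ∫ x in boxN d N, c q * ‖rho q x‖ ^ 2 = c q * N := fun q hq => by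
      have := one_le_pSq (p := q) fun h => h0 (h ▸ hq)
      rw [integral_const_mul, integral_norm_rho_sq (by positivity)]
    rw [Finset.sum_congr rfl this, ← Finset.sum_mul, ← ht]
    field_simp
  have h2 : ∫ x in boxN d N, (Real.exp (-t) * (1 + t) * 1 - Real.exp (-t) * 2 * jastrow c S x) =
      Real.exp (-t) := by
    rw [integral_sub (integrableOn_boxN (by fun_prop)) (integrableOn_boxN (by fun_prop)),
      integral_const_mul, integral_const_mul, h1, integral_one_boxN]
    ring
  rw [← h2, jastrowZ]
  refine integral_mono (integrableOn_boxN (by fun_prop)) (integrableOn_boxN (by fun_prop))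
    fun x => ?_
  have h3 := Real.add_one_le_exp (t - 2 * jastrow c S x)
  have h4 := mul_le_mul_of_nonneg_left h3 (Real.exp_pos (-t)).le
  rw [← Real.exp_add] at h4
  simp only
  rw [show -2 * jastrow c S x = -t + (t - 2 * jastrow c S x) by ring]
  linarith

lemma contDiff_trial : ContDiff ℝ (⊤ : ℕ∞) (trial c S : (Fin N → Fin d → ℝ) → ℂ) :=
  contDiff_const.mul (Complex.ofRealCLM.contDiff.comp (contDiff_const.mul contDiff_jastrow).exp)

lemma norm_trial_sq (hZ : 0 < jastrowZ N c S) (x : Fin N → Fin d → ℝ) :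
    ‖trial c S x‖ ^ 2 = (jastrowZ N c S)⁻¹ * Real.exp (-2 * jastrow c S x) := by
  rw [trial, norm_mul, mul_pow, Complex.norm_real, Complex.norm_real, Real.norm_eq_abs,
    Real.norm_eq_abs, sq_abs, sq_abs, inv_pow, Real.sq_sqrt hZ.le, ← Real.exp_nat_mul]
  congr 2
  push_cast
  ring

lemma kineticEnergy_trial (hc : ∀ q, c (-q) = c q) (hS : ∀ q ∈ S, -q ∈ S)
    (hZ : 0 < jastrowZ N c S) :
    kineticEnergy d N (trial c S) = ∑ q ∈ S, -(2 * (N : ℝ))⁻¹ *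
      (c q * pSq d q * (jastrowJ N c S q / jastrowZ N c S - N)) := by
  have hcr := fun k => continuous_rho (d := d) (N := N) k
  have hcw := fun k => continuous_wave (d := d) (N := N) k
  have hcj := continuous_jastrow (N := N) (c := c) (S := S)
  have hcd := continuous_fderiv_jastrow (N := N) (c := c) (S := S)
  have h1 : ∀ x i j, ‖fderiv ℝ (trial c S) x (dir d N i j)‖ ^ 2 = (jastrowZ N c S)⁻¹ *
      (fderiv ℝ (jastrow c S) x (dir d N i j) ^ 2 * Real.exp (-2 * jastrow c S x)) := by
    intro x i j
    have hd : DifferentiableAt ℝ (fun x : Fin N → Fin d → ℝ =>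
        ((Real.exp (-1 * jastrow c S x) : ℝ) : ℂ)) x :=
      ((Complex.ofRealCLM.contDiff.comp (contDiff_const.mul
        (contDiff_jastrow (N := N) (c := c) (S := S))).exp).differentiable
        (by simp)).differentiableAt
    have : fderiv ℝ (trial c S) x (dir d N i j) =
        -fderiv ℝ (jastrow c S) x (dir d N i j) * trial c S x := by
      have ht : (trial c S : (Fin N → Fin d → ℝ) → ℂ) = fun x =>
        (((√(jastrowZ N c S))⁻¹ : ℝ) : ℂ) * (Real.exp (-1 * jastrow c S x) : ℝ) := rfl
      rw [ht, fderiv_const_mul hd, _root_.smul_apply, fderiv_exp_jastrow, smul_eq_mul]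
      push_cast
      ring
    rw [this, norm_mul, mul_pow, norm_trial_sq hZ, norm_neg, Complex.norm_real, Real.norm_eq_abs,
      sq_abs]
    ring
  have h2 : ((∫ x in boxN d N, (∑ i, ∑ j, fderiv ℝ (jastrow c S) x (dir d N i j) ^ 2) *
      Real.exp (-2 * jastrow c S x) : ℝ) : ℂ) = ((∑ q ∈ S, -(2 * (N : ℝ))⁻¹ *
      (c q * pSq d q * (jastrowJ N c S q - N * jastrowZ N c S)) : ℝ) : ℂ) := by
    have h3 : ∀ x : Fin N → Fin d → ℝ, (((∑ i, ∑ j, fderiv ℝ (jastrow c S) x (dir d N i j) ^ 2) *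
        Real.exp (-2 * jastrow c S x) : ℝ) : ℂ) = ∑ q ∈ S, Complex.I / N * c q *
        ((∑ i, ∑ j, (2 * π * (q j : ℝ) : ℝ) * wave (Pi.single i q) x *
        rho (-q) x * fderiv ℝ (jastrow c S) x (dir d N i j)) *
        (Real.exp (-2 * jastrow c S x) : ℝ)) := by
      intro x
      simp only [Complex.ofReal_mul, Complex.ofReal_sum, Finset.sum_mul, Finset.mul_sum]
      rw [Finset.sum_comm (s := S)]
      refine Finset.sum_congr rfl fun i _ => ?_
      rw [Finset.sum_comm (s := S)]
      refine Finset.sum_congr rfl fun j _ => ?_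
      rw [sq, Complex.ofReal_mul]
      nth_rw 1 [fderiv_jastrow hc hS]
      simp only [Finset.sum_mul, Finset.mul_sum]
      exact Finset.sum_congr rfl fun q _ => by push_cast; ring
    rw [← integral_complex_ofReal]
    simp only [h3]
    rw [integral_finsetSum _ fun q _ => integrableOn_boxN (by fun_prop), Complex.ofReal_sum]
    refine Finset.sum_congr rfl fun q _ => ?_
    rw [integral_const_mul]
    have h4 := jastrow_parts (N := N) (c := c) (S := S) q
    have h5 : ∀ X Y : ℂ, Complex.I * (pSq d q : ℂ) * Y = 2 * X →
        Complex.I / N * c q * X = -(2 * (N : ℂ))⁻¹ * (c q * pSq d q * Y) := fun X Y h => by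
      rw [mul_inv]
      linear_combination (-Complex.I / N * c q / 2) * h +
        (c q * pSq d q * Y / N / 2) * Complex.I_mul_I
    rw [h5 _ _ h4]
    push_cast
    ring
  have h6 : ∑ q ∈ S, -(2 * (N : ℝ))⁻¹ *
      (c q * pSq d q * (jastrowJ N c S q / jastrowZ N c S - N)) = (jastrowZ N c S)⁻¹ *
      ∑ q ∈ S, -(2 * (N : ℝ))⁻¹ *
      (c q * pSq d q * (jastrowJ N c S q - N * jastrowZ N c S)) := by
    rw [Finset.mul_sum]
    refine Finset.sum_congr rfl fun q _ => ?_
    field_simp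
  rw [h6, ← Complex.ofReal_injective h2, ← integral_const_mul, kineticEnergy,
    ← integral_finsetSum _ fun i _ => integrableOn_boxN (by simp only [h1]; fun_prop)]
  congr 1
  funext x
  simp only [h1, Finset.sum_mul, Finset.mul_sum]

lemma exists_trial (hv : PotentialAssumptions d v vhat) (hN : 2 ≤ N) (hS : ∀ q ∈ S, -q ∈ S)
    (h0 : 0 ∉ S) {V : ℝ} (hV : ∑ q ∈ S, vhat q ≤ V) :
    ∃ Ψ : (Fin N → Fin d → ℝ) → ℂ, ContDiff ℝ (⊤ : ℕ∞) Ψ ∧ PeriodicWF d N Ψ ∧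
      SymmetricWF d N Ψ ∧ Normalized d N Ψ ∧ kineticEnergy d N Ψ +
        modePotential d N (fun p => vhat p / (2 * ((N : ℝ) - 1))) S Ψ ≤
      (1 / 2) * ∑ p ∈ S, (√(pSq d p ^ 2 + 2 * pSq d p * vhat p) - pSq d p) +
      (3 * V * Real.exp (V / 2) / √N / 2 + (1 + 3 * V * Real.exp (V / 2) / √N) / N) * V := by
  have hcr := fun k => continuous_rho (d := d) (N := N) k
  have hN' : (2 : ℝ) ≤ N := by exact_mod_cast hN
  set c : (Fin d → ℤ) → ℝ := fun q => modeExponent (pSq d q) (vhat q) with hcdef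
  have hcj := continuous_jastrow (N := N) (c := c) (S := S)
  have hc : ∀ q, c (-q) = c q := fun q => by simp only [hcdef, pSq_neg, vhat_neg hv]
  have hc0 : ∀ q, 0 ≤ c q := fun q => modeExponent_nonneg (pSq_nonneg q) (hv.nonneg q)
  have ha : ∀ q ∈ S, 1 ≤ pSq d q := fun q hq => one_le_pSq fun h => h0 (h ▸ hq)
  have hca : ∀ q ∈ S, c q * pSq d q ≤ vhat q / 2 := fun q hq =>
    modeExponent_mul_le (by have := ha q hq; linarith) (hv.nonneg q)
  have hV0 : 0 ≤ V := (Finset.sum_nonneg fun q _ => hv.nonneg q).trans hV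
  have hsum1 : ∑ q ∈ S, c q ≤ V / 2 := by
    refine (Finset.sum_le_sum fun q hq => ?_).trans
      ((Finset.sum_div S vhat 2).symm.le.trans (by linarith))
    exact (le_mul_of_one_le_right (hc0 q) (ha q hq)).trans (hca q hq)
  have hsum2 : ∑ q ∈ S, c q * √(pSq d q) ≤ V / 2 := by
    refine (Finset.sum_le_sum fun q hq => ?_).trans
      ((Finset.sum_div S vhat 2).symm.le.trans (by linarith))
    refine (mul_le_mul_of_nonneg_left ?_ (hc0 q)).trans (hca q hq)
    have := ha q hq
    exact Real.sqrt_le_iff.mpr ⟨by linarith, by nlinarith⟩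
  have hZe : Real.exp (-(V / 2)) ≤ jastrowZ N c S :=
    (Real.exp_le_exp.mpr (by linarith)).trans (exp_le_jastrowZ hN h0)
  have hZ : 0 < jastrowZ N c S := (Real.exp_pos _).trans_le hZe
  have hZi : (jastrowZ N c S)⁻¹ ≤ Real.exp (V / 2) := by
    rw [← neg_neg (V / 2), Real.exp_neg]
    exact inv_anti₀ (Real.exp_pos _) hZe
  refine ⟨trial c S, contDiff_trial, ?_, ?_, ?_, ?_⟩
  · intro x k
    simp only [trial]
    rw [periodic_jastrow x k]
  · intro σ x
    simp only [trial]
    rw [jastrow_comp_perm]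
  · rw [Normalized]
    simp only [norm_trial_sq hZ]
    rw [integral_const_mul, ← jastrowZ, inv_mul_cancel₀ hZ.ne']
  · set ε := 3 * V * Real.exp (V / 2) / √N with hε
    have hs : 0 < √(N : ℝ) := Real.sqrt_pos.mpr (by linarith)
    have hss : √(N : ℝ) * √N = N := Real.mul_self_sqrt (by linarith)
    have hε0 : 0 ≤ ε := by positivity
    have hmode : modePotential d N (fun p => vhat p / (2 * ((N : ℝ) - 1))) S (trial c S) =
        ∑ p ∈ S, vhat p / (2 * ((N : ℝ) - 1)) * (jastrowJ N c S p / jastrowZ N c S) := by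
      refine Finset.sum_congr rfl fun p _ => ?_
      congr 1
      simp only [norm_trial_sq hZ, jastrowJ, div_eq_inv_mul]
      rw [← integral_const_mul]
      congr 1
      funext x
      ring
    rw [kineticEnergy_trial hc hS hZ, hmode, ← Finset.sum_add_distrib, Finset.mul_sum]
    refine le_trans (Finset.sum_le_sum (g := fun p =>
      1 / 2 * (√(pSq d p ^ 2 + 2 * pSq d p * vhat p) - pSq d p) + (ε / 2 + (1 + ε) / N) * vhat p)
      fun p hp => ?_) ?_
    · refine (mode_energy_le (by have := ha p hp; linarith) (hv.nonneg p) hN' hε0 ?_).trans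
        (le_of_eq (by ring))
      have h1 := jastrowJ_le hN hc hc0 hS h0 hp
      have h2 : (1 + 2 * c p) * jastrowJ N c S p ≤
          N * jastrowZ N c S + 3 * V * √N := by
        have := mul_le_mul_of_nonneg_left hsum2 (by positivity : 0 ≤ 6 * √(N : ℝ))
        linarith
      have h3 := mul_le_mul_of_nonneg_right h2 (inv_pos.mpr hZ).le
      have h4 := mul_le_mul_of_nonneg_left hZi (by positivity : 0 ≤ 3 * V * √(N : ℝ))
      calc (1 + 2 * c p) * (jastrowJ N c S p / jastrowZ N c S)
          = (1 + 2 * c p) * jastrowJ N c S p * (jastrowZ N c S)⁻¹ := by ring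
        _ ≤ (N * jastrowZ N c S + 3 * V * √N) * (jastrowZ N c S)⁻¹ := h3
        _ = N + 3 * V * √N * (jastrowZ N c S)⁻¹ := by field_simp
        _ ≤ N + 3 * V * √N * Real.exp (V / 2) := by linarith
        _ = N * (1 + ε) := by
          rw [hε, show (N : ℝ) * (1 + 3 * V * Real.exp (V / 2) / √N) =
            N + 3 * V * Real.exp (V / 2) * (N / √N) by ring, Real.div_sqrt]
          ring
    · rw [Finset.sum_add_distrib, ← Finset.mul_sum, ← Finset.mul_sum]
      gcongr

end Trial

section Energies

variable {d N : ℕ} {v : (Fin d → ℝ) → ℝ} {vhat : (Fin d → ℤ) → ℝ} {S : Finset (Fin d → ℤ)}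

lemma kineticEnergy_nonneg (Ψ : (Fin N → Fin d → ℝ) → ℂ) : 0 ≤ kineticEnergy d N Ψ :=
  Finset.sum_nonneg fun _ _ => integral_nonneg fun _ => Finset.sum_nonneg fun _ _ => sq_nonneg _

lemma half_ratio_le_one (hN : 2 ≤ N) : (N : ℝ) / (2 * ((N : ℝ) - 1)) ≤ 1 := by
  have hN' : (2 : ℝ) ≤ N := by exact_mod_cast hN
  rw [div_le_one (by linarith)]
  linarith

lemma half_ratio_nonneg (hN : 2 ≤ N) : 0 ≤ (N : ℝ) / (2 * ((N : ℝ) - 1)) := by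
  have hN' : (2 : ℝ) ≤ N := by exact_mod_cast hN
  exact div_nonneg (by linarith) (by linarith)

lemma energyForm_ge (hv : PotentialAssumptions d v vhat) (hN : 2 ≤ N)
    {Ψ : (Fin N → Fin d → ℝ) → ℂ} (hc : ContDiff ℝ (⊤ : ℕ∞) Ψ) (hn : Normalized d N Ψ) :
    N * vhat 0 / 2 - ∑' p, vhat p ≤ energyForm d N v Ψ := by
  have h1 := potentialEnergy_ge hv hN (S := ∅) (by simp) hc.continuous hn
  have h2 := kineticEnergy_nonneg Ψ
  have h3 : tailSum vhat ∅ ≤ ∑' p, vhat p := by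
    have := hv.nonneg 0
    simp [tailSum, this]
  have h4 : 0 ≤ tailSum vhat ∅ := tailSum_nonneg hv (by simp)
  have h5 := mul_le_of_le_one_left h4 (half_ratio_le_one hN)
  simp only [modePotential, Finset.sum_empty, zero_add, add_zero] at h1
  rw [energyForm]
  linarith

lemma E0_le (hv : PotentialAssumptions d v vhat) (hN : 2 ≤ N) (hS : ∀ q ∈ S, -q ∈ S)
    (h0 : 0 ∉ S) {V : ℝ} (hV : ∑ q ∈ S, vhat q ≤ V) :
    E0 d N v ≤ N * vhat 0 / 2 - N / (2 * ((N : ℝ) - 1)) * (∑ p ∈ S, vhat p - N * tailSum vhat S) +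
      (1 / 2) * ∑ p ∈ S, (√(pSq d p ^ 2 + 2 * pSq d p * vhat p) - pSq d p) +
      (3 * V * Real.exp (V / 2) / √N / 2 + (1 + 3 * V * Real.exp (V / 2) / √N) / N) * V := by
  obtain ⟨Ψ, h1, h2, h3, h4, h5⟩ := exists_trial hv hN hS h0 hV
  have h6 : E0 d N v ≤ energyForm d N v Ψ := by
    refine csInf_le ⟨N * vhat 0 / 2 - ∑' p, vhat p, ?_⟩ ⟨Ψ, h1, h2, h3, h4, rfl⟩
    rintro _ ⟨Φ, g1, g2, g3, g4, rfl⟩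
    exact energyForm_ge hv hN g1 g4
  have h7 := potentialEnergy_le hv hN h0 h1.continuous h4
  rw [energyForm] at h6
  linarith

lemma exists_momentum_state (hN : 2 ≤ N) (P : Fin d → ℤ) :
    ∃ Ψ : (Fin N → Fin d → ℝ) → ℂ, ContDiff ℝ (⊤ : ℕ∞) Ψ ∧ PeriodicWF d N Ψ ∧
      SymmetricWF d N Ψ ∧ MomentumWF d N P Ψ ∧ Normalized d N Ψ := by
  have hK : 0 < ∫ x in boxN d N, ‖rho P x‖ ^ 2 := by
    have hN' : (0 : ℝ) < N := by exact_mod_cast (by lia : 0 < N)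
    rcases eq_or_ne P 0 with rfl | hP
    · have h : ∀ x : Fin N → Fin d → ℝ, ‖rho 0 x‖ ^ 2 = (N : ℝ) ^ 2 * 1 := fun x => by
        rw [rho_zero]; simp
      simp only [h]
      rw [integral_const_mul, integral_one_boxN]
      positivity
    · rwa [integral_norm_rho_sq (by have := one_le_pSq hP; positivity)]
  set K := ∫ x in boxN d N, ‖rho P x‖ ^ 2 with hKd
  refine ⟨fun x => ((√K)⁻¹ : ℝ) * rho P x, contDiff_const.mul (contDiff_rho P), fun x k => ?_,
    fun σ x => ?_, fun t x => ?_, ?_⟩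
  · simp only
    rw [periodic_rho P x k]
  · simp only
    rw [rho_comp_perm]
  · simp only [rho, wave_single, Finset.mul_sum]
    refine Finset.sum_congr rfl fun i _ => ?_
    rw [mul_left_comm, ← Complex.exp_add, ← mul_add, ← Complex.ofReal_add,
      ← Finset.sum_add_distrib]
    congr 4
    refine Finset.sum_congr rfl fun j _ => ?_
    simp only [Pi.add_apply]
    ring
  · rw [Normalized]
    simp only [norm_mul, mul_pow, Complex.norm_real, Real.norm_eq_abs, sq_abs, inv_pow]
    rw [integral_const_mul, ← hKd, Real.sq_sqrt hK.le, inv_mul_cancel₀ hK.ne']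

lemma finite_setOf_pSq_le (R : ℝ) : {p : Fin d → ℤ | pSq d p ≤ R}.Finite := by
  refine (Set.finite_Icc (fun _ : Fin d => -⌈R⌉) (fun _ => ⌈R⌉)).subset fun p hp => ?_
  have h : ∀ j, |p j| ≤ ⌈R⌉ := by
    intro j
    have h1 : (2 * π * (p j : ℝ)) ^ 2 ≤ pSq d p :=
      Finset.single_le_sum (f := fun j => (2 * π * (p j : ℝ)) ^ 2)
        (fun _ _ => sq_nonneg _) (Finset.mem_univ j)
    have h2 : (p j : ℝ) ^ 2 ≤ (2 * π * (p j : ℝ)) ^ 2 := by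
      have : (1 : ℝ) ≤ (2 * π) ^ 2 := by nlinarith [Real.pi_gt_three]
      rw [mul_pow]
      nlinarith [sq_nonneg (p j : ℝ)]
    have h3 : |p j| ≤ p j ^ 2 := by
      rw [← sq_abs]
      rcases (abs_nonneg (p j)).eq_or_lt with h | h
      · rw [← h]; simp
      · nlinarith
    have hp' : pSq d p ≤ R := hp
    have h4 : ((p j ^ 2 : ℤ) : ℝ) ≤ ⌈R⌉ := by
      push_cast
      exact (h2.trans h1).trans (hp'.trans (Int.le_ceil R))
    exact h3.trans (by exact_mod_cast h4)
  exact ⟨fun j => (abs_le.mp (h j)).1, fun j => (abs_le.mp (h j)).2⟩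

lemma exists_modes (hv : PotentialAssumptions d v vhat) (R : ℝ) {δ : ℝ} (hδ : 0 < δ) :
    ∃ S : Finset (Fin d → ℤ), 0 ∉ S ∧ (∀ p ∈ S, -p ∈ S) ∧ (∀ p, p ≠ 0 → pSq d p ≤ R → p ∈ S) ∧
      tailSum vhat S ≤ δ := by
  classical
  have h1 : ∀ᶠ s : Finset (Fin d → ℤ) in Filter.atTop, ∑' p, vhat p - δ < ∑ p ∈ s, vhat p :=
    hv.summable.hasSum.eventually (lt_mem_nhds (by linarith))
  obtain ⟨s, hs⟩ := h1.exists
  set T := s ∪ (finite_setOf_pSq_le (d := d) R).toFinset with hT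
  refine ⟨(T ∪ T.image Neg.neg).erase 0, by simp, fun p hp => ?_, fun p hp hpR => ?_, ?_⟩
  · simp only [Finset.mem_erase, Finset.mem_union, Finset.mem_image, ne_eq, neg_eq_zero] at hp ⊢
    refine ⟨hp.1, ?_⟩
    rcases hp.2 with h | ⟨q, hq, rfl⟩
    · exact Or.inr ⟨p, h, rfl⟩
    · exact Or.inl (by rwa [neg_neg])
  · simp [hT, hp, hpR]
  · have h2 : ∑ p ∈ s, vhat p ≤
        ∑ p ∈ insert 0 ((T ∪ T.image Neg.neg).erase 0), vhat p := by
      refine Finset.sum_le_sum_of_subset_of_nonneg (fun p hp => ?_) fun p _ _ => hv.nonneg p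
      rcases eq_or_ne p 0 with rfl | h
      · simp
      · simp [hT, hp, h]
    rw [Finset.sum_insert (by simp)] at h2
    rw [tailSum]
    linarith

/-- The critical speed, the infimum of `e_p / |p|`. -/
def critSpeed (d : ℕ) (vhat : (Fin d → ℤ) → ℝ) : ℝ :=
  ⨅ p : {k : Fin d → ℤ // k ≠ 0}, √(2 * vhat p.1 + pSq d p.1)

lemma critSpeed_nonneg : 0 ≤ critSpeed d vhat := Real.iInf_nonneg fun _ => Real.sqrt_nonneg _

lemma critSpeed_le {p : Fin d → ℤ} (hp : p ≠ 0) : critSpeed d vhat ≤ √(2 * vhat p + pSq d p) :=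
  ciInf_le ⟨0, by rintro _ ⟨q, rfl⟩; exact Real.sqrt_nonneg _⟩
    (⟨p, hp⟩ : {k : Fin d → ℤ // k ≠ 0})

/-- The linear functional comparing momentum and energy. -/
def speedForm (vhat : (Fin d → ℤ) → ℝ) (P p : Fin d → ℤ) : ℝ :=
  critSpeed d vhat * dotMom P p / √(pSq d P)

lemma abs_speedForm_le (P p : Fin d → ℤ) :
    |speedForm vhat P p| ≤ critSpeed d vhat * √(pSq d p) := by
  rw [speedForm, abs_div, abs_of_nonneg (Real.sqrt_nonneg _), abs_mul,
    abs_of_nonneg critSpeed_nonneg]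
  have h0 := critSpeed_nonneg (d := d) (vhat := vhat)
  refine div_le_of_le_mul₀ (Real.sqrt_nonneg _) (by positivity) ?_
  calc critSpeed d vhat * |dotMom P p| ≤ critSpeed d vhat * (√(pSq d P) * √(pSq d p)) := by
        gcongr; exact abs_dotMom_le P p
    _ = _ := by ring

lemma speedForm_sum (P : Fin d → ℤ) (k : Fin N → Fin d → ℤ) :
    ∑ i, speedForm vhat P (k i) = speedForm vhat P (∑ i, k i) := by
  simp only [speedForm]
  rw [← Finset.sum_div, ← Finset.mul_sum]
  congr 2
  simp only [dotMom, Finset.sum_apply]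
  rw [Finset.sum_comm]
  refine Finset.sum_congr rfl fun j _ => ?_
  push_cast
  simp only [Finset.mul_sum]

lemma speedForm_self (P : Fin d → ℤ) : speedForm vhat P P = √(pSq d P) * critSpeed d vhat := by
  have h : dotMom P P = pSq d P := Finset.sum_congr rfl fun j _ => by ring
  rw [speedForm, h, mul_div_assoc, Real.div_sqrt, mul_comm]

lemma modes_speedForm (hv : PotentialAssumptions d v vhat) (h0 : 0 ∉ S) (hS : ∀ p ∈ S, -p ∈ S)
    (hR : ∀ p, p ≠ 0 → pSq d p ≤ critSpeed d vhat ^ 2 → p ∈ S) (P : Fin d → ℤ) :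
    Modes (pSq d) vhat (speedForm vhat P) S (∑' p, vhat p) where
  zero_notMem := h0
  neg_mem := hS
  a_zero := by simp [pSq]
  one_le_a _ h := one_le_pSq h
  a_neg := pSq_neg
  vh_nonneg := hv.nonneg
  vh_neg := vhat_neg hv
  l_neg p := by simp [speedForm, dotMom, neg_div]
  abs_l_le p hp := by
    refine (abs_speedForm_le P p).trans ((mul_le_mul_of_nonneg_right
      (critSpeed_le fun h => h0 (h ▸ hp)) (Real.sqrt_nonneg _)).trans (le_of_eq ?_))
    rw [← Real.sqrt_mul (add_nonneg (mul_nonneg zero_le_two (hv.nonneg p)) (pSq_nonneg p))]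
    congr 1
    ring
  l_le p hp := by
    refine (le_abs_self _).trans ((abs_speedForm_le P p).trans ?_)
    rcases eq_or_ne p 0 with rfl | h
    · simp [pSq]
    · have h1 : critSpeed d vhat ≤ √(pSq d p) := by
        refine Real.le_sqrt_of_sq_le (le_of_not_ge fun h2 => hp (hR p h h2))
      calc critSpeed d vhat * √(pSq d p) ≤ √(pSq d p) * √(pSq d p) := by gcongr
        _ = pSq d p := Real.mul_self_sqrt (pSq_nonneg p)
  sum_le := hv.summable.sum_le_tsum S fun p _ => hv.nonneg p

lemma le_EP (hN : 2 ≤ N) (P : Fin d → ℤ) {K : ℝ}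
    (h : ∀ Ψ : (Fin N → Fin d → ℝ) → ℂ, ContDiff ℝ (⊤ : ℕ∞) Ψ → PeriodicWF d N Ψ →
      SymmetricWF d N Ψ → MomentumWF d N P Ψ → Normalized d N Ψ → K ≤ energyForm d N v Ψ) :
    K ≤ EP d N v P := by
  obtain ⟨Ψ, h1, h2, h3, h4, h5⟩ := exists_momentum_state hN P
  refine le_csInf ⟨_, Ψ, h1, h2, h3, h4, h5, rfl⟩ ?_
  rintro _ ⟨Φ, g1, g2, g3, g4, g5, rfl⟩
  exact h Φ g1 g2 g3 g4 g5

lemma EP_ge (hv : PotentialAssumptions d v vhat) (hN : 2 ≤ N) (h0 : 0 ∉ S)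
    (hS : ∀ p ∈ S, -p ∈ S) (hR : ∀ p, p ≠ 0 → pSq d p ≤ critSpeed d vhat ^ 2 → p ∈ S)
    (P : Fin d → ℤ) {B V : ℝ} (hV : V = ∑' p, vhat p) (hB : 1 ≤ B) (hBN : B ≤ N) :
    N * vhat 0 / 2 - N / (2 * ((N : ℝ) - 1)) * (∑ p ∈ S, vhat p + tailSum vhat S) +
      min B (√(pSq d P) * critSpeed d vhat +
        (1 / 2) * ∑ p ∈ S, (√(pSq d p ^ 2 + 2 * pSq d p * vhat p) - pSq d p)
        - V * (1 + 2 * (3 + 3 * V) + √(6 * (3 + 3 * V))) * √(B ^ 3 / N)) ≤ EP d N v P := by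
  refine le_EP hN P fun Ψ g1 g2 g3 g4 g5 => ?_
  have h1 := potentialEnergy_ge hv hN h0 g1.continuous g5
  have h2 := le_of_hamForm_ge (S := S) (w := fun p => vhat p / (2 * ((N : ℝ) - 1)))
    g2 (g1.of_le (by exact_mod_cast le_top)) g3 fun f hf hfc =>
    hamForm_ge (m := √(pSq d P) * critSpeed d vhat) (modes_speedForm hv h0 hS hR P) hN hB hBN hf
      fun k hk => by
        rw [speedForm_sum, sum_eq_of_coef_ne_zero g2 g4 (hfc k hk), speedForm_self]
  rw [show ∫ x in boxN d N, ‖Ψ x‖ ^ 2 = 1 from g5, mul_one] at h2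
  rw [energyForm, hV]
  rw [modePotential] at h1
  linarith

end Energies

section Gap

variable {d N : ℕ} {v : (Fin d → ℝ) → ℝ} {vhat : (Fin d → ℤ) → ℝ} {S : Finset (Fin d → ℤ)}

/-- The Bogoliubov excitation energy exceeds the kinetic one by at most `v̂`. -/
lemma sum_excitation_sub_le (hv : PotentialAssumptions d v vhat) :
    ∑ p ∈ S, (√(pSq d p ^ 2 + 2 * pSq d p * vhat p) - pSq d p) ≤ ∑' p, vhat p := by
  refine le_trans (Finset.sum_le_sum fun p _ => ?_)
    (hv.summable.sum_le_tsum S fun p _ => hv.nonneg p)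
  have h1 := hv.nonneg p
  have h2 : 0 ≤ pSq d p := pSq_nonneg p
  rw [sub_le_iff_le_add, Real.sqrt_le_left (by linarith)]
  nlinarith [sq_nonneg (vhat p)]

lemma E0_le_of_tailSum_le (hv : PotentialAssumptions d v vhat) (hN : 2 ≤ N)
    (hS : ∀ q ∈ S, -q ∈ S) (h0 : 0 ∉ S) {V : ℝ} (hV : V = ∑' p, vhat p) :
    E0 d N v ≤ N * vhat 0 / 2
      - N / (2 * ((N : ℝ) - 1)) * (∑ p ∈ S, vhat p - N * tailSum vhat S)
      + (1 / 2) * ∑ p ∈ S, (√(pSq d p ^ 2 + 2 * pSq d p * vhat p) - pSq d p)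
      + (1 + 2 * (3 * V * Real.exp (V / 2))) * V / √N := by
  have hN' : (2 : ℝ) ≤ N := by exact_mod_cast hN
  have hV0 : 0 ≤ V := hV ▸ tsum_nonneg hv.nonneg
  have h := E0_le hv hN hS h0 (V := V)
    (hV ▸ hv.summable.sum_le_tsum S fun p _ => hv.nonneg p)
  refine h.trans ?_
  set D := 3 * V * Real.exp (V / 2)
  have hD : 0 ≤ D := by positivity
  have hn : 1 ≤ √(N : ℝ) := Real.one_le_sqrt.2 (by linarith)
  obtain ⟨r, hr⟩ : ∃ r, r = (√(N : ℝ))⁻¹ := ⟨_, rfl⟩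
  have hr0 : 0 < r := hr ▸ by positivity
  have hr1 : r ≤ 1 := hr ▸ inv_le_one_of_one_le₀ hn
  have hr2 : (N : ℝ)⁻¹ = r ^ 2 := by rw [hr, inv_pow, Real.sq_sqrt (by linarith)]
  have key : (D / √N / 2 + (1 + D / √N) / N) * V ≤ (1 + 2 * D) * V / √N := by
    simp only [div_eq_mul_inv, hr2, ← hr]
    have h1 : D * r * 2⁻¹ + (1 + D * r) * r ^ 2 ≤ (1 + 2 * D) * r := by
      have h2 : r ^ 2 ≤ r := by nlinarith
      have h3 : r ^ 3 ≤ r := by nlinarith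
      nlinarith [mul_nonneg hD hr0.le, mul_le_mul_of_nonneg_left h3 hD]
    nlinarith [mul_le_mul_of_nonneg_right h1 hV0]
  linarith

/-- The gap bound for momenta that are small compared to `N`. -/
lemma gap_of_le (hv : PotentialAssumptions d v vhat) (hN : 2 ≤ N) (P : Fin d → ℤ) {V B : ℝ}
    (hV : V = ∑' p, vhat p) (hB : 1 ≤ B) (hBN : B ≤ N)
    (hBc : √(pSq d P) * critSpeed d vhat + V / 2 ≤ B) :
    √(pSq d P) * critSpeed d vhat
      - V * (1 + 2 * (3 + 3 * V) + √(6 * (3 + 3 * V))) * √(B ^ 3 / N)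
      - ((1 + 2 * (3 * V * Real.exp (V / 2))) * V + 2) / √N ≤ EP d N v P - E0 d N v := by
  have hN' : (2 : ℝ) ≤ N := by exact_mod_cast hN
  have hV0 : 0 ≤ V := hV ▸ tsum_nonneg hv.nonneg
  obtain ⟨S, h0, hS, hR, hT⟩ := exists_modes hv (critSpeed d vhat ^ 2)
    (δ := 1 / (N : ℝ) ^ 2) (by positivity)
  have h1 := EP_ge hv hN h0 hS hR P hV hB hBN
  have h2 := E0_le_of_tailSum_le hv hN hS h0 hV
  have h3 := hV ▸ sum_excitation_sub_le (S := S) hv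
  have h4 := half_ratio_le_one hN
  have h5 := half_ratio_nonneg hN
  have h6 := tailSum_nonneg hv h0
  have hn : 1 ≤ √(N : ℝ) := Real.one_le_sqrt.2 (by linarith)
  have h7 : (N + 1) * tailSum vhat S ≤ 2 / √N := by
    calc (N + 1) * tailSum vhat S ≤ (N + 1) * (1 / (N : ℝ) ^ 2) := by gcongr
      _ ≤ 2 / N := by
        rw [mul_one_div, div_le_div_iff₀ (by positivity) (by positivity)]
        nlinarith
      _ ≤ 2 / √N := by
        gcongr
        exact (Real.sqrt_le_left (by linarith)).2 (by nlinarith)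
  have h8 : N / (2 * ((N : ℝ) - 1)) * ((N + 1) * tailSum vhat S) ≤ 2 / √N :=
    (mul_le_of_le_one_left (by positivity) h4).trans h7
  set X := V * (1 + 2 * (3 + 3 * V) + √(6 * (3 + 3 * V))) * √(B ^ 3 / N)
  have hX : 0 ≤ X := by positivity
  set e := ∑ p ∈ S, (√(pSq d p ^ 2 + 2 * pSq d p * vhat p) - pSq d p)
  have h9 : √(pSq d P) * critSpeed d vhat + (1 / 2) * e - X ≤
      min B (√(pSq d P) * critSpeed d vhat + (1 / 2) * e - X) :=
    le_min (by linarith) le_rfl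
  rw [add_div]
  linarith

/-- The crude gap bound, useful for momenta that are large compared to `N`. -/
lemma gap_ge (hv : PotentialAssumptions d v vhat) (hN : 2 ≤ N) (P : Fin d → ℤ) {V : ℝ}
    (hV : V = ∑' p, vhat p) :
    -(1 + 2 * V + (1 + 2 * (3 * V * Real.exp (V / 2))) * V) ≤ EP d N v P - E0 d N v := by
  have hN' : (2 : ℝ) ≤ N := by exact_mod_cast hN
  have hV0 : 0 ≤ V := hV ▸ tsum_nonneg hv.nonneg
  obtain ⟨S, h0, hS, -, hT⟩ := exists_modes hv 0 (δ := 1 / (N : ℝ)) (by positivity)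
  have h1 : N * vhat 0 / 2 - V ≤ EP d N v P :=
    le_EP hN P fun Ψ g1 _ _ _ g5 => hV ▸ energyForm_ge hv hN g1 g5
  have h2 := E0_le_of_tailSum_le hv hN hS h0 hV
  have h3 := hV ▸ sum_excitation_sub_le (S := S) hv
  have h4 := half_ratio_le_one hN
  have h5 := half_ratio_nonneg hN
  have h6 := tailSum_nonneg hv h0
  have hn : 1 ≤ √(N : ℝ) := Real.one_le_sqrt.2 (by linarith)
  have h7 : N * tailSum vhat S ≤ 1 := by
    calc N * tailSum vhat S ≤ N * (1 / (N : ℝ)) := by gcongr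
      _ = 1 := by field_simp
  have h8 : N / (2 * ((N : ℝ) - 1)) * (N * tailSum vhat S) ≤ 1 :=
    (mul_le_of_le_one_left (by positivity) h4).trans h7
  have h9 := mul_nonneg h5 (Finset.sum_nonneg fun p (_ : p ∈ S) => hv.nonneg p)
  have h10 : (1 + 2 * (3 * V * Real.exp (V / 2))) * V / √N ≤
      (1 + 2 * (3 * V * Real.exp (V / 2))) * V := div_le_self (by positivity) hn
  linarith

end Gap

theorem statement2 (d : ℕ) (hd : 1 ≤ d) (v : (Fin d → ℝ) → ℝ) (vhat : (Fin d → ℤ) → ℝ)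
    (hv : PotentialAssumptions d v vhat) :
    ∃ C > 0, ∀ N : ℕ, 2 ≤ N → ∀ P : Fin d → ℤ,
      EP d N v P - E0 d N v ≥
        Real.sqrt (pSq d P) *
          (⨅ p : {k : Fin d → ℤ // k ≠ 0}, Real.sqrt (2 * vhat p.1 + pSq d p.1))
        - C * (1 + Real.sqrt (pSq d P)) ^ ((3 : ℝ) / 2) / Real.sqrt N := by
  obtain ⟨V, hV⟩ : ∃ V, V = ∑' p, vhat p := ⟨_, rfl⟩
  have hV0 : 0 ≤ V := hV ▸ tsum_nonneg hv.nonneg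
  obtain ⟨c, hc⟩ : ∃ c, c = critSpeed d vhat := ⟨_, rfl⟩
  have hc0 : 0 ≤ c := hc ▸ critSpeed_nonneg
  obtain ⟨K, hK⟩ : ∃ K, K = 1 + c + V := ⟨_, rfl⟩
  have hK1 : 1 ≤ K := by linarith
  obtain ⟨L, hL⟩ : ∃ L, L = V * (1 + 2 * (3 + 3 * V) + √(6 * (3 + 3 * V))) := ⟨_, rfl⟩
  have hL0 : 0 ≤ L := hL ▸ by positivity
  obtain ⟨D, hD⟩ : ∃ D, D = (1 + 2 * (3 * V * Real.exp (V / 2))) * V := ⟨_, rfl⟩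
  have hD0 : 0 ≤ D := hD ▸ by positivity
  refine ⟨(L * √(K ^ 3) + (D + 2)) + √K * (1 + 2 * V + D + c), by positivity,
    fun N hN P => ?_⟩
  rw [ge_iff_le, ← critSpeed, ← hc]
  have hN' : (2 : ℝ) ≤ N := by exact_mod_cast hN
  obtain ⟨s, hs⟩ : ∃ s, s = √(pSq d P) := ⟨_, rfl⟩
  have hs0 : 0 ≤ s := hs ▸ Real.sqrt_nonneg _
  have hn : 0 < √(N : ℝ) := Real.sqrt_pos.2 (by linarith)
  have hu : (1 + s) ^ ((3 : ℝ) / 2) = √((1 + s) ^ 3) := by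
    rw [Real.sqrt_eq_rpow, ← Real.rpow_natCast, ← Real.rpow_mul (by linarith)]
    norm_num
  rw [← hs, hu]
  have hq1 : 1 ≤ √((1 + s) ^ 3) := Real.one_le_sqrt.2 (one_le_pow₀ (by linarith))
  have hq : √((1 + s) ^ 3) = (1 + s) * √(1 + s) := by
    rw [pow_succ, Real.sqrt_mul (by positivity), Real.sqrt_sq (by linarith)]
  rw [add_mul, add_div]
  have hC1 : 0 ≤ (L * √(K ^ 3) + (D + 2)) * √((1 + s) ^ 3) / √N := by positivity
  have hC2 : 0 ≤ √K * (1 + 2 * V + D + c) * √((1 + s) ^ 3) / √N := by positivity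
  rcases le_or_gt (K * (1 + s)) N with h | h
  · have h1 := gap_of_le hv hN P hV (one_le_mul_of_one_le_of_one_le hK1 (by linarith)) h
      (by rw [← hc, ← hs]; nlinarith [mul_nonneg hV0 hs0])
    rw [← hc, ← hs, ← hL, ← hD, mul_pow, Real.sqrt_div (by positivity),
      Real.sqrt_mul (by positivity)] at h1
    have h2 : (D + 2) / √N ≤ (D + 2) * √((1 + s) ^ 3) / √N := by
      gcongr
      exact le_mul_of_one_le_right (by positivity) hq1
    have h3 : (L * √(K ^ 3) + (D + 2)) * √((1 + s) ^ 3) / √N =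
        L * (√(K ^ 3) * √((1 + s) ^ 3) / √N) + (D + 2) * √((1 + s) ^ 3) / √N := by ring
    linarith
  · have h1 := gap_ge hv hN P hV
    rw [← hD] at h1
    have h2 : √N ≤ √K * √(1 + s) := by
      rw [← Real.sqrt_mul (by linarith)]
      exact Real.sqrt_le_sqrt h.le
    have h3 : (1 + 2 * V + D + c) * (1 + s) ≤
        √K * (1 + 2 * V + D + c) * √((1 + s) ^ 3) / √N := by
      rw [le_div_iff₀ hn, hq]
      calc (1 + 2 * V + D + c) * (1 + s) * √N
          ≤ (1 + 2 * V + D + c) * (1 + s) * (√K * √(1 + s)) := by gcongr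
        _ = _ := by ring
    nlinarith [mul_nonneg hV0 hs0, mul_nonneg hD0 hs0]
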